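/- Generalized Yoshinaga criterion: Let ℓ ≥ 5, let A be an essential hyperplane arrangement in K^ℓ, and assume A is locally free along H ∈ A. Then the following are equivalent: (1) A is tame; (2) pd_S Ω^1(A) ≤ 1; (3) the Ziegler restriction (A^H, m^H) is tame; (4) pd_{S̄} Ω^1(A^H, m^H) ≤ 1, where S̄ = S/α_H S. -/

import Mathlib

noncomputable section
open Classical MvPolynomial

/-- `pdLE R n M` : the `R`-module `M` has projective dimension at most `n`. -/
def pdLE (R : Type) [CommRing R] : ℕ → (M : Type) → [AddCommGroup M] → [Module R M] → Prop
  | 0, M, _, _ => Module.Projective R M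
  | n + 1, M, _, _ => ∃ (ι : Type) (f : (ι →₀ R) →ₗ[R] M),
      Function.Surjective f ∧ pdLE R n (LinearMap.ker f)

/-- Projective dimension as an element of `ℕ∞`. -/
def pdim (R : Type) [CommRing R] (M : Type) [AddCommGroup M] [Module R M] : ℕ∞ :=
  sInf {n : ℕ∞ | ∃ k : ℕ, pdLE R k M ∧ n = (k : ℕ∞)}

/-- The coordinate ring `S = K[x_1, …, x_ℓ]`. -/
abbrev PS (K : Type) [Field K] (ℓ : ℕ) : Type := MvPolynomial (Fin ℓ) K

/-- The free `S`-module of polynomial differential forms of all degrees, realized as the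
exterior algebra over `S` on the free module `S^ℓ` (with `dx_i` the standard basis). -/
abbrev ExtF (K : Type) [Field K] (ℓ : ℕ) : Type :=
  ExteriorAlgebra (PS K ℓ) (Fin ℓ → PS K ℓ)

variable {K : Type} [Field K] {ℓ : ℕ}

/-- The module `Ω^p_V` of polynomial differential `p`-forms. -/
def formsP (K : Type) [Field K] (ℓ : ℕ) (p : ℕ) : Submodule (PS K ℓ) (ExtF K ℓ) :=
  (LinearMap.range (ExteriorAlgebra.ι (PS K ℓ) :
      (Fin ℓ → PS K ℓ) →ₗ[PS K ℓ] ExtF K ℓ)) ^ p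

/-- The defining linear form `α = ∑ c_i x_i` of the hyperplane with coefficient vector `c`. -/
def linP (c : Fin ℓ → K) : PS K ℓ := ∑ i, MvPolynomial.C (c i) * MvPolynomial.X i

/-- The constant one-form `dα = ∑ c_i dx_i`. -/
def dP (c : Fin ℓ → K) : ExtF K ℓ :=
  ExteriorAlgebra.ι (PS K ℓ) (fun i => MvPolynomial.C (c i))

/-- A central hyperplane arrangement in `K^ℓ`: a finite set of (pairwise non-proportional,
nonzero) coefficient vectors of defining linear forms, each representing the hyperplane
`{x : ∑ c_i x_i = 0}`. -/
structure Arrangement (K : Type) [Field K] (ℓ : ℕ) : Type where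
  hyps : Finset (Fin ℓ → K)
  ne_zero : ∀ c ∈ hyps, c ≠ 0
  nonprop : ∀ c ∈ hyps, ∀ c' ∈ hyps, c ≠ c' → ∀ t : K, c ≠ t • c'

/-- The polynomial model of the module `Ω^p(A,m)` of logarithmic `p`-forms of the
multiarrangement `(A,m)`; it is `Q(A,m)·Ω^p(A,m)`, i.e. the image of `Ω^p(A,m)` under the
degree-shifting isomorphism given by multiplication with `Q(A,m)`, so that
`η = Q(A,m)·ω` ranges over polynomial `p`-forms with `dα_H ∧ η ∈ α_H^{m(H)} Ω^{p+1}_V`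
for all `H ∈ A`. -/
def Omega (A : Arrangement K ℓ) (m : (Fin ℓ → K) → ℕ) (p : ℕ) :
    Submodule (PS K ℓ) (ExtF K ℓ) :=
  formsP K ℓ p ⊓ ⨅ c ∈ A.hyps,
    Submodule.comap (LinearMap.mulLeft (PS K ℓ) (dP c))
      (Submodule.map (LinearMap.lsmul (PS K ℓ) (ExtF K ℓ) (linP c ^ m c))
        (formsP K ℓ (p + 1)))

/-- Tameness of a multiarrangement: `pd_S Ω^p(A,m) ≤ p` for all `0 ≤ p ≤ ℓ`. -/
def TameM (A : Arrangement K ℓ) (m : (Fin ℓ → K) → ℕ) : Prop :=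
  ∀ p : ℕ, p ≤ ℓ → pdLE (PS K ℓ) p (Omega A m p)

/-- Tameness of a simple arrangement (constant multiplicity `1`). -/
def Tame (A : Arrangement K ℓ) : Prop := TameM A (fun _ => 1)

/-- Freeness of a multiarrangement: `Ω^1(A,m)` is a free `S`-module. -/
def FreeM (A : Arrangement K ℓ) (m : (Fin ℓ → K) → ℕ) : Prop :=
  Module.Free (PS K ℓ) (Omega A m 1)

/-- An arrangement is essential when the intersection of its hyperplanes is `{0}`,
equivalently the defining forms span the dual space. -/
def Essential (A : Arrangement K ℓ) : Prop :=
  Submodule.span K (A.hyps : Set (Fin ℓ → K)) = ⊤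

/-- The localization `A_x = {H ∈ A : x ∈ H}` of an arrangement at a point `x`. -/
def locArr (A : Arrangement K ℓ) (x : Fin ℓ → K) : Arrangement K ℓ where
  hyps := A.hyps.filter (fun c => ∑ i, c i * x i = 0)
  ne_zero := fun c hc => A.ne_zero c (Finset.mem_filter.mp hc).1
  nonprop := fun c hc c' hc' =>
    A.nonprop c (Finset.mem_filter.mp hc).1 c' (Finset.mem_filter.mp hc').1

/-- `(A,m)` is locally free along the hyperplane `{x : ∑ (c0)_i x_i = 0}` :
`(A_x, m_x)` is free for every nonzero point `x` of this hyperplane. -/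
def LocallyFreeAlong (A : Arrangement K ℓ) (m : (Fin ℓ → K) → ℕ) (c0 : Fin ℓ → K) : Prop :=
  ∀ x : Fin ℓ → K, x ≠ 0 → (∑ i, c0 i * x i = 0) → FreeM (locArr A x) m

/-- The deletion `A ∖ {H}`. -/
def delArr (A : Arrangement K ℓ) (c0 : Fin ℓ → K) : Arrangement K ℓ where
  hyps := A.hyps.erase c0
  ne_zero := fun c hc => A.ne_zero c (Finset.mem_of_mem_erase hc)
  nonprop := fun c hc c' hc' =>
    A.nonprop c (Finset.mem_of_mem_erase hc) c' (Finset.mem_of_mem_erase hc')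

/-- The coefficient vector of the restriction of the linear form `c` to the hyperplane `H`
along the linear identification `e : K^{ℓ-1} ≃ H`. -/
def restrictForm (e : (Fin (ℓ - 1) → K) →ₗ[K] (Fin ℓ → K)) (c : Fin ℓ → K) :
    Fin (ℓ - 1) → K := fun i => ∑ j, c j * e (Pi.single i 1) j

/-- The linear form on `K^ℓ` with coefficient vector `c`. -/
def dotLin (c : Fin ℓ → K) : (Fin ℓ → K) →ₗ[K] K := ∑ i, c i • LinearMap.proj i

/-- `e` identifies `K^{ℓ-1}` with the hyperplane `ker(α_{c0})`. -/
def IsHypEmbedding (c0 : Fin ℓ → K) (e : (Fin (ℓ - 1) → K) →ₗ[K] (Fin ℓ → K)) : Prop :=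
  Function.Injective e ∧ LinearMap.range e = LinearMap.ker (dotLin c0)

/-- `B` (an arrangement in `K^{ℓ-1}`) represents the restriction `A^H` of `A` to the
hyperplane `H` determined by `c0 ∈ A`, via the identification `e : K^{ℓ-1} ≃ H`:
its hyperplanes are exactly the restrictions to `H` of the hyperplanes of `A ∖ {H}`. -/
def IsRestrictionOf (B : Arrangement K (ℓ - 1)) (A : Arrangement K ℓ) (c0 : Fin ℓ → K)
    (e : (Fin (ℓ - 1) → K) →ₗ[K] (Fin ℓ → K)) : Prop :=
  (∀ c ∈ A.hyps, c ≠ c0 → ∃ c' ∈ B.hyps, ∃ t : K, t ≠ 0 ∧ restrictForm e c = t • c') ∧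
  (∀ c' ∈ B.hyps, ∃ c ∈ A.hyps, c ≠ c0 ∧ ∃ t : K, t ≠ 0 ∧ restrictForm e c = t • c')
/-- The Ziegler multiplicity `m^H` on the restriction: `m^H(X) = #{L ∈ A∖{H} : L ∩ H = X}`. -/
def zieglerMult (A : Arrangement K ℓ) (c0 : Fin ℓ → K)
    (e : (Fin (ℓ - 1) → K) →ₗ[K] (Fin ℓ → K)) (c' : Fin (ℓ - 1) → K) : ℕ :=
  (A.hyps.filter (fun c => c ≠ c0 ∧ ∃ t : K, t ≠ 0 ∧ restrictForm e c = t • c')).card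

/-- The wedge `dx_{i_1} ∧ ⋯ ∧ dx_{i_p}` for a list of indices. -/
def wedgeList (l : List (Fin ℓ)) : ExtF K ℓ :=
  (l.map (fun i => ExteriorAlgebra.ι (PS K ℓ) (Pi.single i (1 : PS K ℓ)))).prod

/-- A polynomial `p`-form is homogeneous of (coefficient) degree `d` if it is a sum of
terms `f · dx_{i_1} ∧ ⋯ ∧ dx_{i_p}` with `f` homogeneous of degree `d`. -/
def IsHomogForm (p d : ℕ) (η : ExtF K ℓ) : Prop :=
  η ∈ AddSubgroup.closure {ξ : ExtF K ℓ | ∃ (f : PS K ℓ) (l : List (Fin ℓ)),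
    f.IsHomogeneous d ∧ l.length = p ∧ ξ = f • wedgeList l}

/-- `|m| = ∑_{H ∈ A} m(H)`. -/
def msum (A : Arrangement K ℓ) (m : (Fin ℓ → K) → ℕ) : ℕ := ∑ c ∈ A.hyps, m c

/-- The multiarrangement `(A,m)` is free with exponents `(d_1, …, d_ℓ)`: the polynomial
model of `Ω^1(A,m)` has a homogeneous basis whose `i`-th member has coefficient degree
`|m| - d_i`. -/
def FreeWithExp (A : Arrangement K ℓ) (m : (Fin ℓ → K) → ℕ) (d : Fin ℓ → ℕ) : Prop :=
  ∃ b : Fin ℓ → ExtF K ℓ,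
    (∀ i, b i ∈ Omega A m 1) ∧
    (∀ i, IsHomogForm 1 (msum A m - d i) (b i)) ∧
    LinearIndependent (PS K ℓ) b ∧
    Omega A m 1 ≤ Submodule.span (PS K ℓ) (Set.range b)

/-- The exponent vector `(d_1, d_2, 0, …, 0)`. -/
def expVec (d1 d2 : ℕ) : Fin ℓ → ℕ := fun i =>
  if (i : ℕ) = 0 then d1 else if (i : ℕ) = 1 then d2 else 0

/-- The localization `A_X` of `A` at the lattice element `X = H ∩ L` corresponding,
via the identification `e` of `H` with `K^{ℓ-1}`, to the hyperplane of `H`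
with coefficient vector `c'`. -/
def locOnRestr (A : Arrangement K ℓ) (e : (Fin (ℓ - 1) → K) →ₗ[K] (Fin ℓ → K))
    (c' : Fin (ℓ - 1) → K) : Arrangement K ℓ where
  hyps := A.hyps.filter (fun c => ∃ t : K, restrictForm e c = t • c')
  ne_zero := fun c hc => A.ne_zero c (Finset.mem_filter.mp hc).1
  nonprop := fun c hc c'' hc'' =>
    A.nonprop c (Finset.mem_filter.mp hc).1 c'' (Finset.mem_filter.mp hc'').1

/-- The multiplicity `m - δ_H`. -/
def mdel (m : (Fin ℓ → K) → ℕ) (c0 : Fin ℓ → K) : (Fin ℓ → K) → ℕ :=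
  fun c => if c = c0 then m c - 1 else m c

/-- `ms` is the Euler multiplicity `m^*` on the restriction `B = A^H` (presented via the
identification `e`): for each `X ∈ A^H` the rank-two localization `(A_X, m_X)` is free
with exponents `(d_1^X, d_2^X, 0, …, 0)` ordered so that `(A_X, m_X - δ_H)` is free with
exponents `(d_1^X - 1, d_2^X, 0, …, 0)`, and `m^*(X) = d_2^X`. -/
def IsEulerMult (A : Arrangement K ℓ) (m : (Fin ℓ → K) → ℕ) (c0 : Fin ℓ → K)
    (e : (Fin (ℓ - 1) → K) →ₗ[K] (Fin ℓ → K)) (B : Arrangement K (ℓ - 1))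
    (ms : (Fin (ℓ - 1) → K) → ℕ) : Prop :=
  ∀ c' ∈ B.hyps, ∃ d1 d2 : ℕ,
    FreeWithExp (locOnRestr A e c') m (expVec d1 d2) ∧
    FreeWithExp (locOnRestr A e c') (mdel m c0) (expVec (d1 - 1) d2) ∧
    ms c' = d2

/-- An arrangement is generic if any `k ≤ ℓ-1` of its hyperplanes intersect in
codimension `k`, i.e. any `≤ ℓ-1` of its defining forms are linearly independent. -/
def GenericArr (A : Arrangement K ℓ) : Prop :=
  ∀ s : Finset (Fin ℓ → K), s ⊆ A.hyps → s.card ≤ ℓ - 1 →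
    LinearIndependent K (fun x : {c // c ∈ s} => (x : Fin ℓ → K))

/-- An arrangement is irreducible if it is not a product of two lower-dimensional
arrangements, i.e. its defining forms cannot be split into two complementary proper
subspaces of the dual space. -/
def IrreducibleArr (A : Arrangement K ℓ) : Prop :=
  ¬ ∃ U1 U2 : Submodule K (Fin ℓ → K), U1 ≠ ⊥ ∧ U2 ≠ ⊥ ∧ U1 ⊓ U2 = ⊥ ∧ U1 ⊔ U2 = ⊤ ∧
      ∀ c ∈ A.hyps, c ∈ U1 ∨ c ∈ U2

/-- The defining polynomial `Q(A,m) = ∏_{H ∈ A} α_H^{m(H)}`. -/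
def Qpoly (A : Arrangement K ℓ) (m : (Fin ℓ → K) → ℕ) : PS K ℓ :=
  ∏ c ∈ A.hyps, linP c ^ m c

section ProjectiveDimension

open CategoryTheory

variable {R : Type} [CommRing R] {M M₁ M₂ M₃ : Type}
  [AddCommGroup M] [Module R M] [AddCommGroup M₁] [Module R M₁]
  [AddCommGroup M₂] [Module R M₂] [AddCommGroup M₃] [Module R M₃]

theorem pdLE_iff_hasProjectiveDimensionLE (n : ℕ) (M : Type) [AddCommGroup M] [Module R M] :
    pdLE R n M ↔ HasProjectiveDimensionLE (ModuleCat.of R M) n := by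
  induction n generalizing M with
  | zero =>
    rw [← projective_iff_hasProjectiveDimensionLE_zero, ← IsProjective.iff_projective]
    rfl
  | succ n ih =>
    constructor
    · rintro ⟨ι, f, hf, hk⟩
      rw [ih] at hk
      have hS := LinearMap.shortExact_shortComplexKer hf
      have h2 : Projective (ModuleCat.of R (ι →₀ R)) :=
        (IsProjective.iff_projective _).mp inferInstance
      exact (hS.hasProjectiveDimensionLT_X₃_iff n h2).mpr hk
    · intro h
      refine ⟨M, Finsupp.linearCombination R (id : M → M),
        Finsupp.linearCombination_id_surjective R M, ?_⟩
      rw [ih]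
      have hS := LinearMap.shortExact_shortComplexKer
        (Finsupp.linearCombination_id_surjective R M)
      have h2 : Projective (ModuleCat.of R (M →₀ R)) :=
        (IsProjective.iff_projective _).mp inferInstance
      exact (hS.hasProjectiveDimensionLT_X₃_iff n h2).mp h

theorem pdLE_of_linearEquiv {n : ℕ} (e : M₁ ≃ₗ[R] M₂) (h : pdLE R n M₁) : pdLE R n M₂ := by
  rw [pdLE_iff_hasProjectiveDimensionLE] at h ⊢
  exact hasProjectiveDimensionLT_of_iso e.toModuleIso (n + 1)

theorem pdLE_of_retract {n : ℕ} (i : M₁ →ₗ[R] M₂) (r : M₂ →ₗ[R] M₁) (hri : ∀ x, r (i x) = x)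
    (h : pdLE R n M₂) : pdLE R n M₁ := by
  rw [pdLE_iff_hasProjectiveDimensionLE] at h ⊢
  exact (Retract.mk (ModuleCat.ofHom i) (ModuleCat.ofHom r)
    (by ext x; exact hri x)).hasProjectiveDimensionLT (n + 1)

theorem pdLE_mono {m n : ℕ} (hmn : m ≤ n) (h : pdLE R m M) : pdLE R n M := by
  rw [pdLE_iff_hasProjectiveDimensionLE] at h ⊢
  exact hasProjectiveDimensionLT_of_ge _ (m + 1) (n + 1) (by lia)

theorem pdLE_of_projective [h : Module.Projective R M] (n : ℕ) : pdLE R n M :=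
  pdLE_mono (Nat.zero_le n) h

section

variable {f : M₁ →ₗ[R] M₂} {g : M₂ →ₗ[R] M₃}

theorem shortExact_of_linearMap (hf : Function.Injective f) (hg : Function.Surjective g)
    (hfg : Function.Exact f g) :
    (ShortComplex.mk (ModuleCat.ofHom f) (ModuleCat.ofHom g)
      (by ext x; exact hfg.apply_apply_eq_zero x)).ShortExact where
  exact := (ShortComplex.ShortExact.moduleCat_exact_iff_function_exact _).mpr hfg
  mono_f := (ModuleCat.mono_iff_injective _).mpr hf
  epi_g := (ModuleCat.epi_iff_surjective _).mpr hg

theorem pdLE_mid {n : ℕ} (hf : Function.Injective f) (hg : Function.Surjective g)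
    (hfg : Function.Exact f g) (h₁ : pdLE R n M₁) (h₃ : pdLE R n M₃) : pdLE R n M₂ := by
  rw [pdLE_iff_hasProjectiveDimensionLE] at *
  exact (shortExact_of_linearMap hf hg hfg).hasProjectiveDimensionLT_X₂ (n + 1) h₁ h₃

theorem pdLE_right {n : ℕ} (hf : Function.Injective f) (hg : Function.Surjective g)
    (hfg : Function.Exact f g) (h₁ : pdLE R n M₁) (h₂ : pdLE R (n + 1) M₂) :
    pdLE R (n + 1) M₃ := by
  rw [pdLE_iff_hasProjectiveDimensionLE] at *
  exact (shortExact_of_linearMap hf hg hfg).hasProjectiveDimensionLT_X₃ (n + 1) h₁ h₂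

theorem pdLE_left {n : ℕ} (hf : Function.Injective f) (hg : Function.Surjective g)
    (hfg : Function.Exact f g) (h₂ : pdLE R n M₂) (h₃ : pdLE R (n + 1) M₃) :
    pdLE R n M₁ := by
  rw [pdLE_iff_hasProjectiveDimensionLE] at *
  exact (shortExact_of_linearMap hf hg hfg).hasProjectiveDimensionLT_X₁ (n + 1) h₂ h₃

end

theorem pdLE_prod {n : ℕ} (h₁ : pdLE R n M₁) (h₂ : pdLE R n M₂) : pdLE R n (M₁ × M₂) :=
  pdLE_mid (f := LinearMap.inl R M₁ M₂) (g := LinearMap.snd R M₁ M₂)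
    LinearMap.inl_injective LinearMap.snd_surjective .inl_snd h₁ h₂

theorem pdLE_ker {n : ℕ} {g : M₂ →ₗ[R] M₃} (hg : Function.Surjective g)
    (h₂ : pdLE R n M₂) (h₃ : pdLE R (n + 1) M₃) : pdLE R n (LinearMap.ker g) :=
  pdLE_left (Submodule.subtype_injective _) hg g.exact_subtype_ker_map h₂ h₃

theorem pdLE_of_pdLE_ker {n : ℕ} {g : M₂ →ₗ[R] M₃} (hg : Function.Surjective g)
    (h₁ : pdLE R n (LinearMap.ker g)) (h₂ : pdLE R (n + 1) M₂) : pdLE R (n + 1) M₃ :=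
  pdLE_right (Submodule.subtype_injective _) hg g.exact_subtype_ker_map h₁ h₂

/-- Kernels of maps between projective modules are second syzygies. -/
theorem pdLE_ker_of_forall_two {n : ℕ} (hR : ∀ (N : Type) [AddCommGroup N] [Module R N],
      pdLE R (n + 2) N) [Module.Projective R M₂] [Module.Projective R M₃] (g : M₂ →ₗ[R] M₃) :
    pdLE R n (LinearMap.ker g) := by
  refine pdLE_of_linearEquiv (LinearEquiv.ofEq _ _ (LinearMap.ker_rangeRestrict g))
    (pdLE_ker g.surjective_rangeRestrict (pdLE_of_projective n) ?_)
  exact pdLE_left (Submodule.subtype_injective _) (Submodule.mkQ_surjective (LinearMap.range g))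
    (LinearMap.exact_subtype_mkQ _) (pdLE_of_projective _) (hR _)

end ProjectiveDimension
section Purity

open CategoryTheory Abelian RingTheory.Sequence

variable {R : Type} [CommRing R]

theorem ext_eq_zero_of_isWeaklyRegular (C : Type) [AddCommGroup C] [Module R C]
    (rs : List R) (hC : ∀ r ∈ rs, ∀ c : C, r • c = 0)
    (P : Type) [AddCommGroup P] [Module R P] (hP : IsWeaklyRegular P rs) :
    ∀ i < rs.length, Subsingleton (Ext (ModuleCat.of R C) (ModuleCat.of R P) i) := by
  induction rs generalizing P with
  | nil => simp
  | cons a rs ih =>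
    rw [isWeaklyRegular_cons_iff] at hP
    intro i hi
    have hk : a ∈ Module.annihilator R (ModuleCat.of R C) :=
      Module.mem_annihilator.mpr fun c => hC a (by simp) c
    match i with
    | 0 =>
      have : Subsingleton (C →ₗ[R] P) := by
        refine ⟨fun f g => ?_⟩
        ext c
        apply hP.1
        simp only [← map_smul, hC a (by simp) c, map_zero]
      exact (Ext.addEquiv₀.trans
        (ModuleCat.homAddEquiv (M := ModuleCat.of R C) (N := ModuleCat.of R P))).subsingleton
    | i + 1 =>
      let g := (AddCommGrpCat.ofHom ((Ext.mk₀ ((ModuleCat.of R P).smulShortComplex a).f).postcomp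
        (ModuleCat.of R C) (add_zero (i + 1))))
      have mono_g : Mono g := by
        apply (Ext.covariant_sequence_exact₁' (ModuleCat.of R C)
          (IsSMulRegular.smulShortComplex_shortExact (M := ModuleCat.of R P) hP.1) i (i + 1)
          rfl).mono_g ((AddCommGrpCat.isZero_of_iff_subsingleton.mpr ?_).eq_zero_of_src _)
        exact ih (fun r hr => hC r (List.mem_cons_of_mem _ hr)) _ hP.2 i (by simpa using hi)
      have zero_g : g = 0 := Ext.postcomp_smul_id_eq_zero_of_mem_annihilator hk (i + 1)
      exact AddCommGrpCat.subsingleton_of_isZero (Limits.IsZero.of_mono_eq_zero _ zero_g)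

theorem isWeaklyRegular_of_projective {rs : List R} (h : IsWeaklyRegular R rs)
    (P : Type) [AddCommGroup P] [Module R P] [Module.Projective R P] : IsWeaklyRegular P rs :=
  ((TensorProduct.rid R P).isWeaklyRegular_congr rs).mp h.isWeaklyRegular_lTensor

theorem ext_eq_zero_of_pdLE (C : Type) [AddCommGroup C] [Module R C]
    (rs : List R) (hC : ∀ r ∈ rs, ∀ c : C, r • c = 0) (hR : IsWeaklyRegular R rs) (k : ℕ)
    (I : Type) [AddCommGroup I] [Module R I] (hI : pdLE R k I) :
    ∀ i, i + k < rs.length → Subsingleton (Ext (ModuleCat.of R C) (ModuleCat.of R I) i) := by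
  induction k generalizing I with
  | zero =>
    intro i hi
    have : Module.Projective R I := hI
    exact ext_eq_zero_of_isWeaklyRegular C rs hC I (isWeaklyRegular_of_projective hR I) i hi
  | succ k ih =>
    intro i hi
    obtain ⟨ι, f, hf, hk⟩ := hI
    have hS := LinearMap.shortExact_shortComplexKer hf
    have h1 := ih _ hk (i + 1) (by lia)
    have h2 : Subsingleton (Ext (ModuleCat.of R C) (ModuleCat.of R (ι →₀ R)) i) :=
      ext_eq_zero_of_isWeaklyRegular C rs hC _ (isWeaklyRegular_of_projective hR _) i (by lia)
    refine subsingleton_of_forall_eq 0 fun x => ?_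
    obtain ⟨y, rfl⟩ := Ext.covariant_sequence_exact₃ (ModuleCat.of R C) hS x rfl
      (h1.elim _ _)
    have : y = 0 := h2.elim _ _
    rw [this, Ext.zero_comp]

/-- A submodule of small projective dimension cannot be enlarged in large codimension. -/
theorem eq_top_of_pdLE {Z : Type} [AddCommGroup Z] [Module R Z] (I : Submodule R Z)
    (rs : List R) (hR : IsWeaklyRegular R rs) (hkill : ∀ r ∈ rs, ∀ z : Z, r • z ∈ I)
    (htf : ∀ z : Z, (∀ r ∈ rs, r • z = 0) → z = 0) {k : ℕ} (hk : k + 2 ≤ rs.length)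
    (hI : pdLE R k I) : I = ⊤ := by
  have hC : ∀ r ∈ rs, ∀ c : Z ⧸ I, r • c = 0 := by
    intro r hr c
    obtain ⟨z, rfl⟩ := Submodule.mkQ_surjective I c
    rw [← map_smul]
    exact (Submodule.Quotient.mk_eq_zero I).mpr (hkill r hr z)
  have h1 := ext_eq_zero_of_pdLE (Z ⧸ I) rs hC hR k I hI 1 (by lia)
  have hS := shortExact_of_linearMap (Submodule.subtype_injective I)
    (Submodule.mkQ_surjective I) (LinearMap.exact_subtype_mkQ I)
  obtain ⟨f', hf'⟩ := Ext.covariant_sequence_exact₃ (ModuleCat.of R (Z ⧸ I)) hS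
    (Ext.mk₀ (𝟙 (ModuleCat.of R (Z ⧸ I)))) (zero_add 1) (h1.elim _ _)
  obtain ⟨f, hf⟩ := (Ext.mk₀_bijective (ModuleCat.of R (Z ⧸ I)) (ModuleCat.of R Z)).2 f'
  rw [← hf, Ext.mk₀_comp_mk₀, (Ext.mk₀_bijective _ _).1.eq_iff] at hf'
  have key : ∀ c : Z ⧸ I, I.mkQ (f.hom c) = c := fun c => by
    have := congrArg (fun φ => φ.hom c) hf'
    simpa using this
  rw [eq_top_iff]
  intro z _
  have h0 : f.hom (I.mkQ z) = 0 := htf _ fun r hr => by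
    rw [← map_smul, hC r hr, map_zero]
  have := key (I.mkQ z)
  rw [h0, map_zero] at this
  simpa using this.symm

/-- The version of `eq_top_of_pdLE` for nested submodules. -/
theorem eq_of_pdLE {Z : Type} [AddCommGroup Z] [Module R Z] {I J : Submodule R Z} (hIJ : I ≤ J)
    (rs : List R) (hR : IsWeaklyRegular R rs) (hkill : ∀ r ∈ rs, ∀ z ∈ J, r • z ∈ I)
    (htf : ∀ z ∈ J, (∀ r ∈ rs, r • z = 0) → z = 0) {k : ℕ} (hk : k + 2 ≤ rs.length)
    (hI : pdLE R k I) : I = J := by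
  have h := eq_top_of_pdLE (I.submoduleOf J) rs hR
    (fun r hr z => hkill r hr z z.2)
    (fun z hz => Subtype.ext (htf z z.2 fun r hr => congrArg Subtype.val (hz r hr))) hk
    (pdLE_of_linearEquiv (Submodule.submoduleOfEquivOfLe hIJ).symm hI)
  exact le_antisymm hIJ (Submodule.submoduleOf_eq_top.mp h)

end Purity
section Hilbert

open TensorProduct

theorem pdLE_baseChange {R S : Type} [CommRing R] [CommRing S] [Algebra R S] [Module.Flat R S]
    (n : ℕ) (M : Type) [AddCommGroup M] [Module R M] (h : pdLE R n M) :
    pdLE S n (S ⊗[R] M) := by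
  induction n generalizing M with
  | zero =>
    have : Module.Projective R M := h
    exact pdLE_of_projective 0
  | succ n ih =>
    obtain ⟨ι, f, hf, hk⟩ := h
    have hker := ih _ hk
    have : Module.Projective S (S ⊗[R] (ι →₀ R)) := inferInstance
    refine pdLE_right (f := (LinearMap.ker f).subtype.baseChange S) (g := f.baseChange S)
      ?_ ?_ ?_ hker (pdLE_of_projective _)
    · exact Module.Flat.lTensor_preserves_injective_linearMap _ (Submodule.subtype_injective _)
    · exact LinearMap.lTensor_surjective S hf
    · have h0 : Function.Exact (LinearMap.ker f).subtype f := f.exact_subtype_ker_map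
      have h1 := lTensor_exact (M := LinearMap.ker f) (N := ι →₀ R) (P := M) S
        (f := (LinearMap.ker f).subtype) (g := f) h0 hf
      exact h1

section

open scoped Polynomial

variable {R : Type} [CommRing R] (N : Type) [AddCommGroup N] [Module R N] [Module R[X] N]
  [IsScalarTower R R[X] N]

/-- The map `p ⊗ n ↦ p • n`. -/
def polyAct : R[X] ⊗[R] N →ₗ[R[X]] N :=
  TensorProduct.AlgebraTensorModule.lift
    { toFun := fun p =>
        { toFun := fun n => p • n
          map_add' := fun _ _ => smul_add _ _ _
          map_smul' := fun r n => by
            simp only [RingHom.id_apply, algebra_compatible_smul R[X] r, smul_smul, mul_comm] }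
      map_add' := fun p q => by ext n; exact add_smul p q n
      map_smul' := fun p q => by ext n; exact mul_smul p q n }

/-- Multiplication by the variable on `N`, as a map linear over the constants. -/
def polyX : N →ₗ[R] N where
  toFun n := (Polynomial.X : R[X]) • n
  map_add' := fun _ _ => smul_add _ _ _
  map_smul' := fun r n => by
    simp only [RingHom.id_apply, algebra_compatible_smul R[X] r, smul_smul, mul_comm]

/-- The map `p ⊗ n ↦ X p ⊗ n - p ⊗ X n`. -/
def polyDiff : R[X] ⊗[R] N →ₗ[R[X]] R[X] ⊗[R] N :=
  (Polynomial.X : R[X]) • LinearMap.id - (polyX N).baseChange R[X]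

@[simp] theorem polyAct_tmul (p : R[X]) (n : N) : polyAct N (p ⊗ₜ n) = p • n := rfl

@[simp] theorem polyDiff_tmul (p : R[X]) (n : N) :
    polyDiff N (p ⊗ₜ n) = (Polynomial.X * p) ⊗ₜ n - p ⊗ₜ ((Polynomial.X : R[X]) • n) := by
  simp [polyDiff, TensorProduct.smul_tmul', polyX]

theorem polyAct_surjective : Function.Surjective (polyAct (R := R) N) :=
  fun n => ⟨1 ⊗ₜ n, by simp⟩

theorem polyDiff_injective : Function.Injective (polyDiff (R := R) N) := by
  let e := TensorProduct.equivFinsuppOfBasisLeft (N := N) (Polynomial.basisMonomials R)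
  have he : ∀ (p : R[X]) (n : N) (i : ℕ), e (p ⊗ₜ n) i = p.coeff i • n := by
    intro p n i
    simp [e]
    rfl
  have hd : ∀ (z : R[X] ⊗[R] N) (i : ℕ),
      e (polyDiff N z) (i + 1) = e z i - (Polynomial.X : R[X]) • e z (i + 1) := by
    intro z i
    induction z using TensorProduct.induction_on with
    | zero => simp
    | tmul p n =>
      rw [polyDiff_tmul, map_sub, Finsupp.sub_apply, he, he, he, he, Polynomial.coeff_X_mul]
      congr 1
      exact (smul_algebra_smul_comm _ _ _).symm
    | add a b ha hb =>
      have h1 : e (polyDiff N (a + b)) = e (polyDiff N a) + e (polyDiff N b) := by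
        rw [map_add, map_add]
      have h2 : e (a + b) = e a + e b := map_add _ _ _
      rw [h1, h2, Finsupp.add_apply, Finsupp.add_apply, Finsupp.add_apply, smul_add, ha, hb]
      abel
  rw [injective_iff_map_eq_zero]
  intro z hz
  have h1 : ∀ i, e z i = (Polynomial.X : R[X]) • e z (i + 1) := fun i => by
    have := hd z i
    rw [hz, map_zero] at this
    simpa [sub_eq_zero] using this.symm
  have h2 : ∀ k i, e z i = (Polynomial.X : R[X]) ^ k • e z (i + k) := fun k => by
    induction k with
    | zero => simp
    | succ k ih =>
      intro i
      rw [ih, h1 (i + k), smul_smul, ← pow_succ, add_assoc]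
  apply e.injective
  rw [map_zero]
  ext i
  rw [h2 ((e z).support.sup id + 1) i]
  have : e z (i + ((e z).support.sup id + 1)) = 0 := by
    by_contra h
    have := Finset.le_sup (f := id) (Finsupp.mem_support_iff.mpr h)
    simp only [id] at this
    lia
  rw [this, smul_zero]
  rfl

theorem polyDiff_exact : Function.Exact (polyDiff (R := R) N) (polyAct N) := by
  intro z
  constructor
  · have key : ∀ z : R[X] ⊗[R] N, z - 1 ⊗ₜ[R] polyAct N z ∈ LinearMap.range (polyDiff N) := by
      intro z
      induction z using TensorProduct.induction_on with
      | zero => simp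
      | tmul p n =>
        rw [polyAct_tmul]
        induction p using Polynomial.induction_on' generalizing n with
        | add p q hp hq =>
          rw [TensorProduct.add_tmul, add_smul, TensorProduct.tmul_add, add_sub_add_comm]
          exact add_mem (hp n) (hq n)
        | monomial k a =>
          induction k generalizing n with
          | zero =>
            have : (Polynomial.monomial 0 a : R[X]) = algebraMap R R[X] a := rfl
            rw [this, ← algebra_compatible_smul, TensorProduct.tmul_smul, Algebra.algebraMap_eq_smul_one,
              TensorProduct.smul_tmul']
            simp
          | succ k ih =>
            have h1 : (Polynomial.monomial (k + 1) a : R[X]) = Polynomial.X * Polynomial.monomial k a := by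
              rw [Polynomial.X_mul_monomial]
            have h2 := add_mem (LinearMap.mem_range_self (polyDiff N) ((Polynomial.monomial k a) ⊗ₜ n))
              (ih ((Polynomial.X : R[X]) • n))
            rw [polyDiff_tmul] at h2
            rw [h1, mul_comm Polynomial.X, mul_smul]
            rw [mul_comm Polynomial.X] at h2
            simpa using h2
      | add a b ha hb =>
        rw [map_add, TensorProduct.tmul_add, add_sub_add_comm]
        exact add_mem ha hb
    intro hz
    have := key z
    rw [hz, TensorProduct.tmul_zero, sub_zero] at this
    exact this
  · rintro ⟨y, rfl⟩
    induction y using TensorProduct.induction_on with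
    | zero => simp
    | tmul p n => simp [smul_smul, mul_comm]
    | add a b ha hb => rw [map_add, map_add, ha, hb, add_zero]

end

theorem pdLE_polynomial {R : Type} [CommRing R] {d : ℕ}
    (h : ∀ (N : Type) [AddCommGroup N] [Module R N], pdLE R d N)
    (N : Type) [AddCommGroup N] [Module (Polynomial R) N] : pdLE (Polynomial R) (d + 1) N := by
  let : Module R N := Module.compHom N (algebraMap R (Polynomial R))
  have : IsScalarTower R (Polynomial R) N := IsScalarTower.of_algebraMap_smul fun _ _ => rfl
  have h1 := pdLE_baseChange (S := Polynomial R) d N (h N)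
  exact pdLE_right (polyDiff_injective N) (polyAct_surjective N) (polyDiff_exact N) h1
    (pdLE_mono (Nat.le_succ d) h1)

theorem forall_pdLE_of_ringEquiv {R S : Type} [CommRing R] [CommRing S] (e : R ≃+* S) {d : ℕ}
    (h : ∀ (N : Type) [AddCommGroup N] [Module R N], pdLE R d N)
    (N : Type) [AddCommGroup N] [Module S N] : pdLE S d N := by
  let : Module R N := Module.compHom N e.toRingHom
  have h1 := (pdLE_iff_hasProjectiveDimensionLE d N).mp (h N)
  rw [pdLE_iff_hasProjectiveDimensionLE]
  have := RingHomInvPair.of_ringEquiv e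
  have := RingHomInvPair.symm (RingHomClass.toRingHom e) (RingHomClass.toRingHom e.symm)
  exact ModuleCat.hasProjectiveDimensionLE_of_semiLinearEquiv (M := ModuleCat.of R N)
    (N := ModuleCat.of S N) e
    { toFun := fun x => x, invFun := fun x => x, map_add' := fun _ _ => rfl,
      map_smul' := fun _ _ => rfl, left_inv := fun _ => rfl, right_inv := fun _ => rfl } d

/-- Hilbert's syzygy theorem. -/
theorem pdLE_mvPolynomial (F : Type) [Field F] (n : ℕ) (N : Type) [AddCommGroup N]
    [Module (MvPolynomial (Fin n) F) N] : pdLE (MvPolynomial (Fin n) F) n N := by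
  induction n generalizing N with
  | zero =>
    refine forall_pdLE_of_ringEquiv (MvPolynomial.isEmptyRingEquiv F (Fin 0)).symm ?_ N
    intro N _ _
    exact pdLE_of_projective 0
  | succ n ih =>
    refine forall_pdLE_of_ringEquiv (MvPolynomial.finSuccEquiv F n).symm.toRingEquiv ?_ N
    intro N _ _
    refine pdLE_polynomial ?_ N
    intro N _ _
    exact ih N

end Hilbert
section RegularSequences

open RingTheory.Sequence

theorem isWeaklyRegular_ringEquiv {R T : Type} [CommRing R] [CommRing T] (e : R ≃+* T)
    (rs : List R) (h : IsWeaklyRegular T (rs.map e)) : IsWeaklyRegular R rs := by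
  refine ((AddEquiv.isWeaklyRegular_congr (e := e.toAddEquiv) (as := rs) (bs := rs.map e) ?_)).mpr h
  exact List.forall₂_map_right_iff.mpr (List.forall₂_same.mpr fun r _ x => map_mul e r x)

theorem isWeaklyRegular_polynomial_cons {R : Type} [CommRing R] {g : Polynomial R} (hg : g.Monic)
    {rs : List R} (h : IsWeaklyRegular R rs) :
    IsWeaklyRegular (Polynomial R) (g :: rs.map Polynomial.C) := by
  rw [isWeaklyRegular_cons_iff]
  constructor
  · intro a b hab
    exact hg.isRegular.left hab
  · have : IsWeaklyRegular (Polynomial R ⧸ Ideal.span {g}) (rs.map Polynomial.C) := by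
      have h1 := (isWeaklyRegular_map_algebraMap_iff (R := R) (S := Polynomial R)
        (M := Polynomial R ⧸ Ideal.span {g}) rs).mpr (by
          have : Module.Free R (Polynomial R ⧸ Ideal.span {g}) := hg.free_adjoinRoot
          exact isWeaklyRegular_of_projective h _)
      exact h1
    have e : QuotSMulTop g (Polynomial R) ≃ₗ[Polynomial R] (Polynomial R ⧸ Ideal.span {g}) :=
      Submodule.quotEquivOfEq _ (Ideal.span {g}) (by
        ext x
        simp [Submodule.mem_smul_pointwise_iff_exists, Ideal.mem_span_singleton, dvd_def, eq_comm])
    exact (e.isWeaklyRegular_congr _).mpr this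

/-- Monic polynomials, one in each variable, form a regular sequence. -/
theorem isWeaklyRegular_monic {D : Type} [CommRing D] (n : ℕ) (g : Fin n → Polynomial D)
    (hg : ∀ i, (g i).Monic) :
    IsWeaklyRegular (MvPolynomial (Fin n) D)
      (List.ofFn fun i => Polynomial.aeval (X i : MvPolynomial (Fin n) D) (g i)) := by
  induction n with
  | zero => simp
  | succ n ih =>
    apply isWeaklyRegular_ringEquiv (MvPolynomial.finSuccEquiv D n).toRingEquiv
    have h := isWeaklyRegular_polynomial_cons
      ((hg 0).map (algebraMap D (MvPolynomial (Fin n) D))) (ih (fun i => g i.succ) fun i => hg _)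
    convert h using 1
    rw [List.ofFn_succ, List.map_cons, List.map_ofFn, List.map_ofFn]
    congr 1
    · change MvPolynomial.finSuccEquiv D n _ = _
      rw [← Polynomial.aeval_algHom_apply, MvPolynomial.finSuccEquiv_X_zero]
      rfl
    · congr 1
      funext i
      change MvPolynomial.finSuccEquiv D n _ = Polynomial.C _
      rw [← Polynomial.aeval_algHom_apply, MvPolynomial.finSuccEquiv_X_succ]
      have h2 := Polynomial.aeval_algHom_apply
        (Polynomial.CAlgHom (R := D) (A := MvPolynomial (Fin n) D)) (X i) (g i.succ)
      exact h2

end RegularSequences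
section Reduction

variable {R T : Type} [CommRing R] [CommRing T]

theorem exists_eq_smul_of_finsupp {ρ : R →+* T} {x : R} (hker : ∀ r, ρ r = 0 → ∃ s, r = x * s)
    {ι : Type} (y : ι →₀ R) (hy : ∀ i, ρ (y i) = 0) : ∃ z : ι →₀ R, y = x • z := by
  choose s hs using fun i => hker (y i) (hy i)
  refine ⟨Finsupp.onFinset y.support (fun i => if i ∈ y.support then s i else 0) (by simp; tauto),
    ?_⟩
  ext i
  by_cases h : y i = 0
  · simp [h]
  · simp [h, ← hs]

/-- Reduction modulo a regular element does not increase the projective dimension. -/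
theorem pdLE_reduction (ρ : R →+* T) (hρ : Function.Surjective ρ) (x : R) (hx : ρ x = 0)
    (hker : ∀ r, ρ r = 0 → ∃ s, r = x * s) (hreg : IsSMulRegular R x) (k : ℕ)
    (M N : Type) [AddCommGroup M] [Module R M] [AddCommGroup N] [Module T N]
    (f : M →+ N) (hf : ∀ (r : R) (m : M), f (r • m) = ρ r • f m)
    (hsurj : Function.Surjective f) (hfk : ∀ m, f m = 0 → ∃ m', m = x • m')
    (hM : IsSMulRegular M x) (h : pdLE R k M) : pdLE T k N := by
  induction k generalizing M N with
  | zero =>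
    obtain ⟨s, hs⟩ := (Module.projective_def (R := R) (P := M)).mp h
    let s' : M →+ (M →₀ T) := (Finsupp.mapRange.addMonoidHom ρ.toAddMonoidHom).comp s.toAddMonoidHom
    have hs' : ∀ (r : R) (m : M), s' (r • m) = ρ r • s' m := by
      intro r m
      ext i
      simp [s']
    choose g hg using hsurj
    have hgs : ∀ m, s' (g (f m)) = s' m := by
      intro m
      obtain ⟨m', hm'⟩ := hfk (g (f m) - m) (by rw [map_sub, hg, sub_self])
      rw [← sub_eq_zero, ← map_sub, hm', hs', hx, zero_smul]
    let S : N →ₗ[T] (M →₀ T) :=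
      { toFun := fun n => s' (g n)
        map_add' := fun a b => by
          rw [← map_add s', ← hgs (g a + g b), map_add f, hg, hg]
        map_smul' := fun t n => by
          obtain ⟨r, rfl⟩ := hρ t
          rw [RingHom.id_apply, ← hs', ← hgs (r • g n), hf, hg] }
    have hlc : ∀ y : M →₀ R, Finsupp.linearCombination T (fun m => f m)
        (Finsupp.mapRange.addMonoidHom ρ.toAddMonoidHom y) =
          f (Finsupp.linearCombination R id y) := by
      intro y
      induction y using Finsupp.induction_linear with
      | zero => simp
      | add a b ha hb => rw [map_add, map_add, ha, hb, map_add, map_add]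
      | single i r => simp [hf]
    refine pdLE_of_retract S (Finsupp.linearCombination T (fun m => f m)) (fun n => ?_)
      (pdLE_of_projective 0)
    change Finsupp.linearCombination T (fun m => f m)
      (Finsupp.mapRange.addMonoidHom ρ.toAddMonoidHom (s (g n))) = n
    rw [hlc, hs, hg]
  | succ k ih =>
    obtain ⟨ι, π, hπ, hk⟩ := h
    have hlc : ∀ y : ι →₀ R, Finsupp.linearCombination T (fun i => f (π (Finsupp.single i 1)))
        (Finsupp.mapRange.addMonoidHom ρ.toAddMonoidHom y) = f (π y) := by
      intro y
      induction y using Finsupp.induction_linear with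
      | zero => simp
      | add a b ha hb => rw [map_add, map_add, ha, hb, map_add, map_add]
      | single i r =>
        rw [Finsupp.mapRange.addMonoidHom_apply, Finsupp.mapRange_single,
          Finsupp.linearCombination_single]
        change ρ r • _ = _
        rw [← hf, ← map_smul, Finsupp.smul_single, smul_eq_mul, mul_one]
    have hms : Function.Surjective (Finsupp.mapRange.addMonoidHom (ι := ι) ρ.toAddMonoidHom) :=
      Finsupp.mapRange_surjective _ (map_zero ρ) hρ
    refine ⟨ι, Finsupp.linearCombination T (fun i => f (π (Finsupp.single i 1))), ?_, ?_⟩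
    · intro n
      obtain ⟨m, rfl⟩ := hsurj n
      obtain ⟨y, rfl⟩ := hπ m
      exact ⟨_, hlc y⟩
    · let F : LinearMap.ker π →+ LinearMap.ker
          (Finsupp.linearCombination T (fun i => f (π (Finsupp.single i 1)))) :=
        { toFun := fun y => ⟨Finsupp.mapRange.addMonoidHom ρ.toAddMonoidHom y.1, by
            rw [LinearMap.mem_ker, hlc, LinearMap.mem_ker.mp y.2, map_zero]⟩
          map_zero' := by ext; simp
          map_add' := fun a b => by ext; simp }
      refine ih (LinearMap.ker π) _ F ?_ ?_ ?_ ?_ hk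
      · intro r m
        ext i
        simp [F]
      · rintro ⟨z, hz⟩
        obtain ⟨y, rfl⟩ := hms z
        rw [LinearMap.mem_ker, hlc] at hz
        obtain ⟨m, hm⟩ := hfk _ hz
        obtain ⟨y', rfl⟩ := hπ m
        refine ⟨⟨y - x • y', ?_⟩, ?_⟩
        · rw [LinearMap.mem_ker, map_sub, map_smul, hm, sub_self]
        · ext i
          simp [F, hx]
      · rintro ⟨y, hy⟩ h0
        obtain ⟨z, rfl⟩ := exists_eq_smul_of_finsupp hker y (fun i => by
          have := congrArg (fun w => w.1 i) h0
          simpa [F] using this)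
        refine ⟨⟨z, ?_⟩, rfl⟩
        rw [LinearMap.mem_ker, map_smul] at hy
        exact hM (by simpa using hy)
      · intro a b hab
        have := congrArg Subtype.val hab
        ext i
        apply hreg
        exact congrArg (fun w : ι →₀ R => w i) this

end Reduction
section Graded

theorem homogeneousComponent_mul_of_isHomogeneous {σ R : Type} [CommSemiring R]
    {m : ℕ} {g : MvPolynomial σ R} (hg : g.IsHomogeneous m) (s : MvPolynomial σ R) (n : ℕ) :
    homogeneousComponent n (s * g) = (if m ≤ n then homogeneousComponent (n - m) s else 0) * g := by
  conv_lhs => rw [← sum_homogeneousComponent s, Finset.sum_mul, map_sum]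
  have h : ∀ j, homogeneousComponent n (homogeneousComponent j s * g) =
      if j + m = n then homogeneousComponent j s * g else 0 := fun j =>
    (homogeneousComponent_of_mem ((homogeneousComponent_isHomogeneous j s).mul hg)).trans
      (by simp only [eq_comm])
  simp only [h]
  split_ifs with hmn
  · by_cases hs : n - m < s.totalDegree + 1
    · rw [Finset.sum_eq_single (n - m)]
      · rw [if_pos (by omega)]
      · intro j _ hj
        rw [if_neg (by omega)]
      · intro h
        exact absurd (Finset.mem_range.mpr hs) h
    · rw [homogeneousComponent_eq_zero _ _ (by omega), zero_mul]
      refine Finset.sum_eq_zero fun j hj => if_neg ?_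
      have := Finset.mem_range.mp hj
      omega
  · rw [zero_mul]
    exact Finset.sum_eq_zero fun j _ => if_neg (by omega)

variable {ι : Type}

/-- The component of degree `k` of a vector of polynomials, the `i`-th basis vector having
degree `d i`. -/
def vecComp (d : ι → ℕ) (k : ℕ) : (ι → PS K ℓ) →+ (ι → PS K ℓ) where
  toFun w i := if d i ≤ k then homogeneousComponent (k - d i) (w i) else 0
  map_zero' := by ext1 i; simp
  map_add' v w := by ext1 i; dsimp; split_ifs <;> simp

/-- Homogeneous vectors of degree `e`. -/
def VecHom (d : ι → ℕ) (e : ℕ) (w : ι → PS K ℓ) : Prop :=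
  ∀ i, (d i ≤ e ∧ (w i).IsHomogeneous (e - d i)) ∨ w i = 0

theorem vecHom_vecComp (d : ι → ℕ) (k : ℕ) (w : ι → PS K ℓ) : VecHom d k (vecComp d k w) := by
  intro i
  by_cases h : d i ≤ k
  · left
    refine ⟨h, ?_⟩
    simp only [vecComp, AddMonoidHom.coe_mk, ZeroHom.coe_mk, if_pos h]
    exact homogeneousComponent_isHomogeneous _ _
  · right
    simp [vecComp, h]

theorem vecComp_smul {d : ι → ℕ} {e : ℕ} {w : ι → PS K ℓ} (hw : VecHom d e w) (k : ℕ)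
    (s : PS K ℓ) :
    vecComp d k (s • w) = (if e ≤ k then homogeneousComponent (k - e) s else 0) • w := by
  ext1 i
  simp only [vecComp, AddMonoidHom.coe_mk, ZeroHom.coe_mk, Pi.smul_apply, smul_eq_mul]
  rcases hw i with ⟨h1, h2⟩ | h
  · rw [homogeneousComponent_mul_of_isHomogeneous h2]
    by_cases hek : e ≤ k
    · rw [if_pos (by omega), if_pos (by omega), if_pos hek, show k - d i - (e - d i) = k - e by omega]
    · rw [if_neg hek]
      split_ifs with h3 h4
      · omega
      · rfl
      · simp
  · simp [h]

theorem exists_sum_vecComp [Fintype ι] (d : ι → ℕ) (w : ι → PS K ℓ) :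
    ∃ N, w = ∑ k ∈ Finset.range N, vecComp d k w := by
  refine ⟨(∑ i, (d i + (w i).totalDegree)) + 1, ?_⟩
  ext1 i
  have hi : d i + (w i).totalDegree ≤ ∑ i, (d i + (w i).totalDegree) :=
    Finset.single_le_sum (f := fun i => d i + (w i).totalDegree) (fun _ _ => Nat.zero_le _)
      (Finset.mem_univ i)
  generalize ∑ i, (d i + (w i).totalDegree) = M at hi
  rw [Finset.sum_apply]
  simp only [vecComp, AddMonoidHom.coe_mk, ZeroHom.coe_mk]
  rw [← Finset.sum_filter]
  conv_lhs => rw [← sum_homogeneousComponent (w i)]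
  symm
  have himg : (Finset.range ((w i).totalDegree + 1)).image (fun j => j + d i) ⊆
      (Finset.range (M + 1)).filter (fun k => d i ≤ k) := by
    intro k hk
    simp only [Finset.mem_image, Finset.mem_range, Finset.mem_filter] at hk ⊢
    obtain ⟨j, hj, rfl⟩ := hk
    omega
  rw [← Finset.sum_subset himg, Finset.sum_image]
  · simp
  · intro a _ b _ h
    simpa using h
  · intro k hk hk'
    simp only [Finset.mem_image, Finset.mem_range, Finset.mem_filter, not_exists, not_and]
      at hk hk'
    refine homogeneousComponent_eq_zero _ _ ?_
    by_contra hlt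
    exact hk' (k - d i) (by omega) (by omega)

/-- A homogeneous submodule of a graded free module has a finite system of homogeneous generators
all of whose relations have coefficients without constant term; the module of relations is again
homogeneous. -/
theorem exists_minimal_generators [Fintype ι] (d : ι → ℕ) (Z : Submodule (PS K ℓ) (ι → PS K ℓ))
    (hZ : ∀ w ∈ Z, ∀ k, vecComp d k w ∈ Z) :
    ∃ (r : ℕ) (π : (Fin r → PS K ℓ) →ₗ[PS K ℓ] (ι → PS K ℓ)) (e : Fin r → ℕ),
      LinearMap.range π = Z ∧
      (∀ s ∈ LinearMap.ker π, ∀ j, constantCoeff (s j) = 0) ∧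
      (∀ s ∈ LinearMap.ker π, ∀ k, vecComp e k s ∈ LinearMap.ker π) := by
  have hex : ∃ (r : ℕ) (z : Fin r → (ι → PS K ℓ)), (∀ j, ∃ e, VecHom d e (z j)) ∧
      Submodule.span (PS K ℓ) (Set.range z) = Z := by
    have hG : Submodule.span (PS K ℓ) {w | w ∈ Z ∧ ∃ e, VecHom d e w} = Z := by
      refine le_antisymm (Submodule.span_le.mpr fun w hw => hw.1) fun w hw => ?_
      obtain ⟨N, hN⟩ := exists_sum_vecComp d w
      rw [hN]
      exact Submodule.sum_mem _ fun k _ =>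
        Submodule.subset_span ⟨hZ w hw k, k, vecHom_vecComp d k w⟩
    have hfg : (Submodule.span (PS K ℓ) {w | w ∈ Z ∧ ∃ e, VecHom d e w}).FG :=
      IsNoetherian.noetherian _
    obtain ⟨t, ht, hts⟩ := Submodule.fg_span_iff_fg_span_finset_subset _ |>.mp hfg
    refine ⟨t.card, fun j => (t.equivFin.symm j : ι → PS K ℓ), fun j =>
      (ht (t.equivFin.symm j).2).2, ?_⟩
    rw [← hG, hts]
    congr 1
    ext w
    constructor
    · rintro ⟨j, rfl⟩
      exact (t.equivFin.symm j).2
    · intro hw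
      exact ⟨t.equivFin ⟨w, hw⟩, by simp⟩
  obtain ⟨z, hz, hspan⟩ := Nat.find_spec hex
  have hmin := fun r => Nat.find_min hex (m := r)
  generalize Nat.find hex = r at z hz hspan hmin
  choose e he using hz
  have hrel : ∀ s : Fin r → PS K ℓ, ∑ j, s j • z j = 0 → ∀ k,
      ∑ j, vecComp e k s j • z j = 0 := by
    intro s hs k
    have := congrArg (vecComp d k) hs
    rw [map_sum, map_zero] at this
    rw [← this]
    refine Finset.sum_congr rfl fun j _ => ?_
    rw [vecComp_smul (he j)]
    rfl
  refine ⟨r, Fintype.linearCombination (PS K ℓ) z, e, ?_, ?_, ?_⟩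
  · rw [Fintype.range_linearCombination, hspan]
  · intro s hs i
    rw [LinearMap.mem_ker, Fintype.linearCombination_apply] at hs
    by_contra hne
    have h := hrel s hs (e i)
    rw [← Finset.add_sum_erase _ _ (Finset.mem_univ i)] at h
    have hi : vecComp e (e i) s i = C (constantCoeff (s i)) := by
      simp [vecComp, homogeneousComponent_zero, constantCoeff_eq]
    rw [hi] at h
    have hmem : z i ∈ Submodule.span (PS K ℓ) (z '' {j | j ≠ i}) := by
      have : z i = -(C (constantCoeff (s i))⁻¹ : PS K ℓ) •
          ∑ j ∈ Finset.univ.erase i, vecComp e (e i) s j • z j := by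
        rw [eq_neg_of_add_eq_zero_right h, neg_smul_neg, smul_smul, ← C_mul,
          inv_mul_cancel₀ hne, C_1, one_smul]
      rw [this]
      refine Submodule.smul_mem _ _ (Submodule.sum_mem _ fun j hj => Submodule.smul_mem _ _
        (Submodule.subset_span ⟨j, (Finset.mem_erase.mp hj).1, rfl⟩))
    have hr : r ≠ 0 := by rintro rfl; exact i.elim0
    obtain ⟨r, rfl⟩ := Nat.exists_eq_succ_of_ne_zero hr
    refine hmin r (Nat.lt_succ_self r) ⟨fun j => z (i.succAbove j), fun j => ⟨_, he _⟩, ?_⟩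
    rw [← hspan]
    refine le_antisymm (Submodule.span_mono (by rintro _ ⟨j, rfl⟩; exact ⟨_, rfl⟩))
      (Submodule.span_le.mpr ?_)
    have hsub : z '' {j | j ≠ i} ⊆ Set.range fun j => z (i.succAbove j) := by
      rintro _ ⟨j, hj, rfl⟩
      obtain ⟨k, rfl⟩ := Fin.exists_succAbove_eq hj
      exact ⟨k, rfl⟩
    rintro _ ⟨j, rfl⟩
    by_cases hj : j = i
    · rw [hj]
      exact Submodule.span_mono hsub hmem
    · exact Submodule.subset_span (hsub ⟨j, hj, rfl⟩)
  · intro s hs k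
    rw [LinearMap.mem_ker, Fintype.linearCombination_apply] at hs ⊢
    exact hrel s hs k

end Graded

section GradedLifting

variable {T : Type} [CommRing T]

/-- The map of free modules induced by a ring homomorphism. -/
def piMap {R : Type} [CommRing R] (ρ : R →+* T) (ι : Type) : (ι → R) →+ (ι → T) where
  toFun s i := ρ (s i)
  map_zero' := by ext1; simp
  map_add' _ _ := by ext1; simp

theorem piMap_smul {R : Type} [CommRing R] (ρ : R →+* T) (r : R) (s : ι → R) :
    piMap ρ ι (r • s) = ρ r • piMap ρ ι s := by ext1; simp [piMap]

/-- The presentation over `T` obtained from one over `R` by reduction. -/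
theorem exists_reduced_presentation {R : Type} [CommRing R] {M N : Type} [AddCommGroup M]
    [Module R M] [AddCommGroup N] [Module T N] (ρ : R →+* T)
    (f : M →+ N) (hf : ∀ (r : R) (m : M), f (r • m) = ρ r • f m)
    (hsurj : Function.Surjective f) {r : ℕ} (π : (Fin r → R) →ₗ[R] M)
    (hπ : Function.Surjective π) :
    ∃ π' : (Fin r → T) →ₗ[T] N, Function.Surjective π' ∧
      ∀ s, π' (piMap ρ (Fin r) s) = f (π s) := by
  have key : ∀ s, Fintype.linearCombination T (fun j => f (π (Pi.single j 1)))
      (piMap ρ (Fin r) s) = f (π s) := by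
    intro s
    rw [Fintype.linearCombination_apply]
    conv_rhs => rw [← Finset.univ_sum_single s]
    rw [map_sum, map_sum]
    refine Finset.sum_congr rfl fun j _ => ?_
    change ρ (s j) • _ = _
    rw [← hf, ← map_smul]
    congr 2
    ext i
    by_cases h : i = j
    · subst h; simp
    · simp [h]
  refine ⟨_, fun n => ?_, key⟩
  obtain ⟨m, rfl⟩ := hsurj n
  obtain ⟨s, rfl⟩ := hπ m
  exact ⟨_, key s⟩

theorem eq_zero_of_forall_mem_pow {T : Type} [CommRing T] [IsDomain T] [IsNoetherianRing T]
    {I : Ideal T} (hI : I ≠ ⊤) {t : T} (h : ∀ k, t ∈ I ^ k) : t = 0 := by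
  have := Ideal.iInf_pow_eq_bot_of_isDomain I hI
  rw [← Ideal.mem_bot, ← this]
  exact (Submodule.mem_iInf _).mpr h

theorem ker_eq_bot_of_projective [IsDomain T] [IsNoetherianRing T] {N : Type} [AddCommGroup N]
    [Module T N] [Module.Projective T N] {I : Ideal T} (hI : I ≠ ⊤) {r : ℕ}
    (π : (Fin r → T) →ₗ[T] N) (hπ : Function.Surjective π)
    (hker : ∀ t, π t = 0 → ∀ j, t j ∈ I) (t : Fin r → T) (ht : π t = 0) : t = 0 := by
  obtain ⟨σ, hσ⟩ := Module.projective_lifting_property π LinearMap.id hπ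
  have hσ' : ∀ n, π (σ n) = n := fun n => LinearMap.congr_fun hσ n
  have hP : ∀ s : Fin r → T, π (s - σ (π s)) = 0 := fun s => by rw [map_sub, hσ', sub_self]
  have hmem : ∀ k, ∀ j, t j ∈ I ^ k := by
    intro k
    induction k with
    | zero => intro j; simp
    | succ k ih =>
      intro j
      have h1 : t = ∑ i, t i • (Pi.single i 1 - σ (π (Pi.single i 1))) := by
        simp only [smul_sub, Finset.sum_sub_distrib, ← map_smul, ← map_sum]
        have : ∑ i, t i • (Pi.single i 1 : Fin r → T) = t := by
          ext k
          simp [Finset.sum_apply, Pi.single_apply]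
        rw [this, ht, map_zero, sub_zero]
      rw [h1, Finset.sum_apply]
      refine Ideal.sum_mem _ fun i _ => ?_
      rw [pow_succ]
      exact Ideal.mul_mem_mul (ih i) (hker _ (hP _) j)
  ext1 j
  exact eq_zero_of_forall_mem_pow hI fun k => hmem k j

variable {ι : Type} [Fintype ι] [IsDomain T] [IsNoetherianRing T] {I : Ideal T} (hI : I ≠ ⊤) (ρ : PS K ℓ →+* T)
  (hρ : Function.Surjective ρ) (hρI : ∀ s, constantCoeff s = 0 → ρ s ∈ I)
  {x : PS K ℓ} (hx0 : x ≠ 0) (hxc : constantCoeff x = 0) (hx : ρ x = 0)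
  (hker : ∀ r, ρ r = 0 → ∃ s, r = x * s)

include hI hρ hρI hx0 hxc hx hker in
/-- A homogeneous submodule of a free module with projective reduction is free. -/
theorem exists_equiv_of_projective_reduction (d : ι → ℕ)
    (Z : Submodule (PS K ℓ) (ι → PS K ℓ)) (hZ : ∀ w ∈ Z, ∀ k, vecComp d k w ∈ Z)
    {N : Type} [AddCommGroup N] [Module T N] [Module.Projective T N]
    (f : Z →+ N) (hf : ∀ (r : PS K ℓ) (m : Z), f (r • m) = ρ r • f m)
    (hsurj : Function.Surjective f) (hfk : ∀ m, f m = 0 → ∃ m', m = x • m') :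
    ∃ r : ℕ, Nonempty ((Fin r → PS K ℓ) ≃ₗ[PS K ℓ] Z) := by
  obtain ⟨r, π, e, hr, hc, -⟩ := exists_minimal_generators d Z hZ
  subst hr
  have hπ : Function.Surjective π.rangeRestrict := π.surjective_rangeRestrict
  obtain ⟨π', hπ's, hπ'⟩ := exists_reduced_presentation ρ f hf hsurj π.rangeRestrict hπ
  have hsurjρ : ∀ t : Fin r → T, ∃ s, piMap ρ (Fin r) s = t := fun t => by
    choose s hs using fun j => hρ (t j)
    exact ⟨s, funext hs⟩
  have hk' : ∀ t, π' t = 0 → ∀ j, t j ∈ I := by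
    intro t ht j
    obtain ⟨s, rfl⟩ := hsurjρ t
    rw [hπ'] at ht
    obtain ⟨m', hm'⟩ := hfk _ ht
    obtain ⟨s', rfl⟩ := hπ m'
    have h0 : π (s - x • s') = 0 := by
      have := congrArg Subtype.val hm'
      rw [map_sub, map_smul, sub_eq_zero]
      exact this
    have := hρI _ (hc _ h0 j)
    simpa [piMap, hx] using this
  have hzero : ∀ k, ∀ w, π w = 0 → ∃ w', π w' = 0 ∧ w = x ^ k • w' := by
    intro k
    induction k with
    | zero => intro w hw; exact ⟨w, hw, by simp⟩
    | succ k ih =>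
      intro w hw
      obtain ⟨w', hw', rfl⟩ := ih w hw
      have h1 : piMap ρ (Fin r) w' = 0 := by
        refine ker_eq_bot_of_projective hI π' hπ's hk' _ ?_
        rw [hπ', show π.rangeRestrict w' = 0 from Subtype.ext hw', map_zero]
      choose s hs using fun j => hker (w' j) (congrFun h1 j)
      have h2 : w' = x • s := funext hs
      refine ⟨s, ?_, by rw [h2, smul_smul, pow_succ]⟩
      rw [h2, map_smul] at hw'
      exact (smul_eq_zero.mp hw').resolve_left hx0
  have hinj : Function.Injective π.rangeRestrict := by
    rw [← LinearMap.ker_eq_bot, LinearMap.ker_rangeRestrict, LinearMap.ker_eq_bot']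
    intro w hw
    ext1 j
    refine eq_zero_of_forall_mem_pow (I := RingHom.ker (constantCoeff (R := K) (σ := Fin ℓ)))
      (RingHom.ker_ne_top _) fun k => ?_
    obtain ⟨w', -, rfl⟩ := hzero k w hw
    exact Ideal.mul_mem_right _ _ (Ideal.pow_mem_pow hxc k)
  exact ⟨r, ⟨LinearEquiv.ofBijective _ ⟨hinj, hπ⟩⟩⟩

include hI hρ hρI hx0 hxc hx hker in
/-- A homogeneous submodule of a free module whose reduction has projective dimension at most one
has a free resolution of length one. -/
theorem exists_presentation_of_pdLE_reduction (d : ι → ℕ)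
    (Z : Submodule (PS K ℓ) (ι → PS K ℓ)) (hZ : ∀ w ∈ Z, ∀ k, vecComp d k w ∈ Z)
    {N : Type} [AddCommGroup N] [Module T N] (hN : pdLE T 1 N)
    (f : Z →+ N) (hf : ∀ (r : PS K ℓ) (m : Z), f (r • m) = ρ r • f m)
    (hsurj : Function.Surjective f) (hfk : ∀ m, f m = 0 → ∃ m', m = x • m') :
    ∃ (p r : ℕ) (π : (Fin p → PS K ℓ) →ₗ[PS K ℓ] (ι → PS K ℓ))
      (g : (Fin r → PS K ℓ) →ₗ[PS K ℓ] (Fin p → PS K ℓ)),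
      LinearMap.range π = Z ∧ Function.Injective g ∧ LinearMap.range g = LinearMap.ker π := by
  obtain ⟨p, π, e, hr, hc, hhom⟩ := exists_minimal_generators d Z hZ
  subst hr
  have hπ : Function.Surjective π.rangeRestrict := π.surjective_rangeRestrict
  obtain ⟨π', hπ's, hπ'⟩ := exists_reduced_presentation ρ f hf hsurj π.rangeRestrict hπ
  have hproj : Module.Projective T (LinearMap.ker π') :=
    pdLE_ker (n := 0) hπ's (pdLE_of_projective 0) hN
  let f' : LinearMap.ker π →+ LinearMap.ker π' :=
    { toFun := fun w => ⟨piMap ρ (Fin p) w, by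
        rw [LinearMap.mem_ker, hπ', show π.rangeRestrict w = 0 from Subtype.ext w.2, map_zero]⟩
      map_zero' := Subtype.ext (map_zero _)
      map_add' := fun a b => Subtype.ext (map_add (piMap ρ (Fin p)) a.1 b.1) }
  obtain ⟨r, ⟨g⟩⟩ := exists_equiv_of_projective_reduction hI ρ hρ hρI hx0 hxc hx hker e
    (LinearMap.ker π) hhom f' (fun s w => Subtype.ext (piMap_smul ρ s w.1)) (by
      rintro ⟨t, ht⟩
      choose s hs using fun j => hρ (t j)
      obtain rfl : piMap ρ (Fin p) s = t := funext hs
      rw [LinearMap.mem_ker, hπ'] at ht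
      obtain ⟨m', hm'⟩ := hfk _ ht
      obtain ⟨s', rfl⟩ := hπ m'
      refine ⟨⟨s - x • s', ?_⟩, Subtype.ext ?_⟩
      · have := congrArg Subtype.val hm'
        rw [LinearMap.mem_ker, map_sub, map_smul, sub_eq_zero]
        exact this
      · change piMap ρ (Fin p) (s - x • s') = _
        rw [map_sub, piMap_smul, hx, zero_smul, sub_zero]) (by
      rintro ⟨w, hw⟩ h
      have h1 : piMap ρ (Fin p) w = 0 := congrArg Subtype.val h
      choose s hs using fun j => hker (w j) (congrFun h1 j)
      have h2 : w = x • s := funext hs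
      refine ⟨⟨s, ?_⟩, Subtype.ext h2⟩
      rw [h2, LinearMap.mem_ker, map_smul] at hw
      exact (smul_eq_zero.mp hw).resolve_left hx0)
  refine ⟨p, r, π, (LinearMap.ker π).subtype ∘ₗ g.toLinearMap, rfl, ?_, ?_⟩
  · exact (Submodule.injective_subtype _).comp g.injective
  · rw [LinearMap.range_comp, LinearEquiv.range, Submodule.map_top, Submodule.range_subtype]

end GradedLifting
section Exterior

variable {R : Type} [CommRing R] {M : Type} [AddCommGroup M] [Module R M]

/-- Contraction of the exterior algebra with a linear form. -/
def extContr (d : Module.Dual R M) : ExteriorAlgebra R M →ₗ[R] ExteriorAlgebra R M :=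
  CliffordAlgebra.contractLeft d

theorem extContr_ι_mul (d : Module.Dual R M) (v : M) (x : ExteriorAlgebra R M) :
    extContr d (ExteriorAlgebra.ι R v * x) = d v • x - ExteriorAlgebra.ι R v * extContr d x :=
  CliffordAlgebra.contractLeft_ι_mul d v x

theorem extContr_algebraMap (d : Module.Dual R M) (r : R) :
    extContr d (algebraMap R (ExteriorAlgebra R M) r) = 0 :=
  CliffordAlgebra.contractLeft_algebraMap _ d r

theorem extContr_ι (d : Module.Dual R M) (v : M) :
    extContr d (ExteriorAlgebra.ι R v) = algebraMap R _ (d v) :=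
  CliffordAlgebra.contractLeft_ι _ d v

theorem extContr_mem_zero (d : Module.Dual R M) {x : ExteriorAlgebra R M} (hx : x ∈ ⋀[R]^0 M) :
    extContr d x = 0 := by
  rw [ExteriorAlgebra.exteriorPower, pow_zero, Submodule.mem_one] at hx
  obtain ⟨r, rfl⟩ := hx
  exact extContr_algebraMap d r

theorem ι_mul_mem {p : ℕ} (v : M) {x : ExteriorAlgebra R M} (hx : x ∈ ⋀[R]^p M) :
    ExteriorAlgebra.ι R v * x ∈ ⋀[R]^(p + 1) M := by
  rw [ExteriorAlgebra.exteriorPower, pow_succ']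
  exact Submodule.mul_mem_mul ⟨v, rfl⟩ hx

theorem exteriorPower_succ_induction {p : ℕ} {C : ExteriorAlgebra R M → Prop}
    (hmul : ∀ v, ∀ x ∈ ⋀[R]^p M, C (ExteriorAlgebra.ι R v * x))
    (hadd : ∀ x y, C x → C y → C (x + y)) {x : ExteriorAlgebra R M}
    (hx : x ∈ ⋀[R]^(p + 1) M) : C x := by
  rw [ExteriorAlgebra.exteriorPower, pow_succ'] at hx
  refine Submodule.mul_induction_on hx ?_ hadd
  rintro _ ⟨v, rfl⟩ y hy
  exact hmul v y hy

theorem extContr_mem (d : Module.Dual R M) {p : ℕ} {x : ExteriorAlgebra R M}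
    (hx : x ∈ ⋀[R]^(p + 1) M) : extContr d x ∈ ⋀[R]^p M := by
  induction p generalizing x with
  | zero =>
    refine exteriorPower_succ_induction (C := fun x => extContr d x ∈ ⋀[R]^0 M) (fun v x hx => ?_)
      (fun x y hx hy => by rw [map_add]; exact add_mem hx hy) hx
    rw [extContr_ι_mul, extContr_mem_zero d hx, mul_zero, sub_zero]
    exact Submodule.smul_mem _ _ hx
  | succ p ih =>
    refine exteriorPower_succ_induction (C := fun x => extContr d x ∈ ⋀[R]^(p + 1) M)
      (fun v x hx => ?_) (fun x y hx hy => by rw [map_add]; exact add_mem hx hy) hx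
    rw [extContr_ι_mul]
    exact sub_mem (Submodule.smul_mem _ _ hx) (ι_mul_mem v (ih hx))

/-- Contraction with `d` is a homotopy for the multiplication by a vector `v` with `d v = 1`. -/
theorem eq_ι_mul_add_extContr (d : Module.Dual R M) {v : M} (hv : d v = 1)
    (x : ExteriorAlgebra R M) :
    x = ExteriorAlgebra.ι R v * extContr d x + extContr d (ExteriorAlgebra.ι R v * x) := by
  rw [extContr_ι_mul, hv, one_smul, add_sub_cancel]

theorem ι_mul_ι_mul_self (v : M) (x : ExteriorAlgebra R M) :
    ExteriorAlgebra.ι R v * (ExteriorAlgebra.ι R v * x) = 0 := by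
  rw [← mul_assoc, ExteriorAlgebra.ι_sq_zero, zero_mul]

theorem ι_mul_ι_mul_comm (v w : M) (x : ExteriorAlgebra R M) :
    ExteriorAlgebra.ι R v * (ExteriorAlgebra.ι R w * x) =
      -(ExteriorAlgebra.ι R w * (ExteriorAlgebra.ι R v * x)) := by
  rw [← mul_assoc, ← mul_assoc, ← neg_mul, eq_neg_of_add_eq_zero_left
    (ExteriorAlgebra.ι_add_mul_swap v w)]

theorem exists_eq_algebraMap_of_mem_zero {x : ExteriorAlgebra R M} (hx : x ∈ ⋀[R]^0 M) :
    ∃ r, x = algebraMap R _ r := by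
  rw [ExteriorAlgebra.exteriorPower, pow_zero, Submodule.mem_one] at hx
  obtain ⟨r, rfl⟩ := hx
  exact ⟨r, rfl⟩

theorem map_mem_exteriorPower {N : Type} [AddCommGroup N] [Module R N] (f : M →ₗ[R] N) {p : ℕ}
    {x : ExteriorAlgebra R M} (hx : x ∈ ⋀[R]^p M) : ExteriorAlgebra.map f x ∈ ⋀[R]^p N := by
  induction p generalizing x with
  | zero =>
    obtain ⟨r, rfl⟩ := exists_eq_algebraMap_of_mem_zero hx
    rw [AlgHom.commutes, ExteriorAlgebra.exteriorPower, pow_zero]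
    exact Submodule.mem_one.mpr ⟨r, rfl⟩
  | succ p ih =>
    refine exteriorPower_succ_induction
      (C := fun x => ExteriorAlgebra.map f x ∈ ⋀[R]^(p + 1) N) (fun v x hx => ?_)
      (fun x y hx hy => by rw [map_add]; exact add_mem hx hy) hx
    rw [map_mul, ExteriorAlgebra.map_apply_ι]
    exact ι_mul_mem _ (ih hx)

instance (n : ℕ) : Module.Free R (ExteriorAlgebra R (Fin n → R)) :=
  Module.Free.of_basis (Pi.basisFun R (Fin n)).ExteriorAlgebra

theorem exists_smul_iff_dvd_repr {κ : Type} [Finite κ] (b : Module.Basis κ R M) (a : R) (x : M) :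
    (∃ y, x = a • y) ↔ ∀ i, a ∣ b.repr x i := by
  constructor
  · rintro ⟨y, rfl⟩ i
    exact ⟨b.repr y i, by simp⟩
  · intro h
    choose c hc using h
    have := Fintype.ofFinite κ
    refine ⟨∑ i, c i • b i, ?_⟩
    rw [← b.sum_repr x, Finset.smul_sum]
    refine Finset.sum_congr rfl fun i _ => ?_
    rw [hc, smul_smul]

variable [IsDomain R]

theorem extAlg_smul_eq_zero {n : ℕ} {a : R} (ha : a ≠ 0) {x : ExteriorAlgebra R (Fin n → R)}
    (h : a • x = 0) : x = 0 := (smul_eq_zero.mp h).resolve_left ha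

theorem mem_exteriorPower_of_smul_mem {n p : ℕ} {a : R} (ha : a ≠ 0)
    {x : ExteriorAlgebra R (Fin n → R)} (h : a • x ∈ ⋀[R]^p (Fin n → R)) :
    x ∈ ⋀[R]^p (Fin n → R) := by
  have h1 := DirectSum.decompose_of_mem_same (fun i : ℕ => ⋀[R]^i (Fin n → R)) h
  rw [DirectSum.decompose_smul] at h1
  have h2 : a • ((DirectSum.decompose (fun i : ℕ => ⋀[R]^i (Fin n → R)) x p :
      ExteriorAlgebra R (Fin n → R)) - x) = 0 := by
    rw [smul_sub, sub_eq_zero, ← h1]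
    rfl
  rw [← sub_eq_zero.mp (extAlg_smul_eq_zero ha h2)]
  exact Subtype.mem _

end Exterior

section ExteriorBaseChange

variable {R T : Type} [CommRing R] [CommRing T] (ρ : R →+* T) (n : ℕ)

/-- The ring homomorphism of exterior algebras induced by a homomorphism of base rings. -/
def extBC : ExteriorAlgebra R (Fin n → R) →+* ExteriorAlgebra T (Fin n → T) :=
  letI := ρ.toAlgebra
  (ExteriorAlgebra.lift R (M := Fin n → R) (A := ExteriorAlgebra T (Fin n → T))
    ⟨{ toFun := fun v => ExteriorAlgebra.ι T (piMap ρ (Fin n) v)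
       map_add' := fun v w => by rw [map_add, map_add]
       map_smul' := fun r v => by
         rw [piMap_smul, map_smul, RingHom.id_apply]
         exact algebraMap_smul T r _ },
     fun v => ExteriorAlgebra.ι_sq_zero _⟩).toRingHom

variable {ρ n}

theorem extBC_ι (v : Fin n → R) :
    extBC ρ n (ExteriorAlgebra.ι R v) = ExteriorAlgebra.ι T (piMap ρ (Fin n) v) := by
  let := ρ.toAlgebra
  exact ExteriorAlgebra.lift_ι_apply R _ _ v

theorem extBC_smul (r : R) (x : ExteriorAlgebra R (Fin n → R)) :
    extBC ρ n (r • x) = ρ r • extBC ρ n x := by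
  let := ρ.toAlgebra
  refine (map_smul (ExteriorAlgebra.lift R (M := Fin n → R)
    (A := ExteriorAlgebra T (Fin n → T)) _) r x).trans ?_
  exact (algebraMap_smul T r _).symm

theorem extBC_algebraMap (r : R) :
    extBC ρ n (algebraMap R _ r) = algebraMap T _ (ρ r) := by
  rw [Algebra.algebraMap_eq_smul_one, extBC_smul, map_one, Algebra.algebraMap_eq_smul_one]

theorem extBC_mem {p : ℕ} {x : ExteriorAlgebra R (Fin n → R)} (hx : x ∈ ⋀[R]^p (Fin n → R)) :
    extBC ρ n x ∈ ⋀[T]^p (Fin n → T) := by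
  induction p generalizing x with
  | zero =>
    obtain ⟨r, rfl⟩ := exists_eq_algebraMap_of_mem_zero hx
    rw [extBC_algebraMap, ExteriorAlgebra.exteriorPower, pow_zero]
    exact Submodule.mem_one.mpr ⟨_, rfl⟩
  | succ p ih =>
    refine exteriorPower_succ_induction
      (C := fun x => extBC ρ n x ∈ ⋀[T]^(p + 1) (Fin n → T)) (fun v x hx => ?_)
      (fun x y hx hy => by rw [map_add]; exact add_mem hx hy) hx
    rw [map_mul, extBC_ι]
    exact ι_mul_mem _ (ih hx)

theorem exists_extBC_eq (hρ : Function.Surjective ρ) {p : ℕ} {y : ExteriorAlgebra T (Fin n → T)}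
    (hy : y ∈ ⋀[T]^p (Fin n → T)) : ∃ x ∈ ⋀[R]^p (Fin n → R), extBC ρ n x = y := by
  induction p generalizing y with
  | zero =>
    obtain ⟨t, rfl⟩ := exists_eq_algebraMap_of_mem_zero hy
    obtain ⟨r, rfl⟩ := hρ t
    exact ⟨algebraMap R _ r, by rw [ExteriorAlgebra.exteriorPower, pow_zero]; exact Submodule.mem_one.mpr ⟨_, rfl⟩,
      extBC_algebraMap r⟩
  | succ p ih =>
    refine exteriorPower_succ_induction
      (C := fun y => ∃ x ∈ ⋀[R]^(p + 1) (Fin n → R), extBC ρ n x = y) (fun v y hy => ?_) ?_ hy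
    · obtain ⟨x, hx, rfl⟩ := ih hy
      choose w hw using fun i => hρ (v i)
      obtain rfl : piMap ρ (Fin n) w = v := funext hw
      exact ⟨ExteriorAlgebra.ι R w * x, ι_mul_mem w hx, by rw [map_mul, extBC_ι]⟩
    · rintro _ _ ⟨x, hx, rfl⟩ ⟨y, hy, rfl⟩
      exact ⟨x + y, add_mem hx hy, map_add _ _ _⟩

theorem extBC_basis (s : Finset (Fin n)) :
    extBC ρ n ((Pi.basisFun R (Fin n)).ExteriorAlgebra s) =
      (Pi.basisFun T (Fin n)).ExteriorAlgebra s := by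
  rw [ExteriorAlgebra.basis_apply_ofCard _ (rfl : s.card = s.card),
    ExteriorAlgebra.basis_apply_ofCard _ (rfl : s.card = s.card)]
  unfold ExteriorAlgebra.ιMulti_family
  rw [ExteriorAlgebra.ιMulti_apply, ExteriorAlgebra.ιMulti_apply,
    map_list_prod, List.map_ofFn]
  congr 2
  ext1 i
  simp only [Function.comp_apply, extBC_ι]
  congr 1
  ext j
  simp [piMap, Pi.single_apply, apply_ite ρ]

theorem repr_extBC (x : ExteriorAlgebra R (Fin n → R)) (s : Finset (Fin n)) :
    (Pi.basisFun T (Fin n)).ExteriorAlgebra.repr (extBC ρ n x) s =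
      ρ ((Pi.basisFun R (Fin n)).ExteriorAlgebra.repr x s) := by
  conv_lhs => rw [← (Pi.basisFun R (Fin n)).ExteriorAlgebra.sum_repr x]
  rw [map_sum]
  simp only [extBC_smul, extBC_basis]
  rw [Module.Basis.repr_sum_self]

theorem exists_eq_smul_of_extBC_eq_zero {a : R} (hker : ∀ r, ρ r = 0 → ∃ s, r = a * s)
    {x : ExteriorAlgebra R (Fin n → R)} (hx : extBC ρ n x = 0) : ∃ y, x = a • y := by
  rw [exists_smul_iff_dvd_repr (Pi.basisFun R (Fin n)).ExteriorAlgebra]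
  intro s
  refine hker _ ?_
  rw [← repr_extBC, hx]
  simp

theorem extBC_extContr (d : Module.Dual R (Fin n → R)) (d' : Module.Dual T (Fin n → T))
    (h : ∀ v, d' (piMap ρ (Fin n) v) = ρ (d v)) (x : ExteriorAlgebra R (Fin n → R)) :
    extBC ρ n (extContr d x) = extContr d' (extBC ρ n x) := by
  induction x using CliffordAlgebra.left_induction with
  | algebraMap r =>
    refine ((congrArg _ (extContr_algebraMap d r)).trans (map_zero _)).trans ?_
    refine Eq.trans ?_ (congrArg _ (extBC_algebraMap r).symm)
    exact (extContr_algebraMap _ _).symm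
  | add x y hx hy => simp only [map_add, hx, hy]
  | ι_mul x v hx =>
    change extBC ρ n (extContr d (ExteriorAlgebra.ι R v * x)) =
      extContr d' (extBC ρ n (ExteriorAlgebra.ι R v * x))
    rw [extContr_ι_mul, map_sub, extBC_smul, map_mul, hx, map_mul, extBC_ι, extContr_ι_mul, h]

end ExteriorBaseChange
section LogForms

variable {R : Type} [CommRing R]

/-- If a submodule is projective, then it contains every element multiplied into it by a set of
scalars without common factor. -/
theorem mem_of_projective {Z : Type} [AddCommGroup Z] [Module R Z] [IsDomain R]
    (I : Submodule R Z) [Module.Projective R I] {q : R} (hq : q ≠ 0)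
    (htf : ∀ z : Z, q • z = 0 → z = 0) {z : Z} (hqz : q • z ∈ I) (s : Set R)
    (hs : ∀ a ∈ s, a • z ∈ I) (hgcd : ∀ t, (∀ a ∈ s, q ∣ a * t) → q ∣ t) : z ∈ I := by
  obtain ⟨i, hi⟩ := (Module.projective_def (R := R) (P := I)).mp inferInstance
  have hdvd : ∀ j, q ∣ i ⟨q • z, hqz⟩ j := by
    refine fun j => hgcd _ fun a ha => ⟨i ⟨a • z, hs a ha⟩ j, ?_⟩
    rw [← smul_eq_mul, ← smul_eq_mul, ← Finsupp.smul_apply, ← Finsupp.smul_apply, ← map_smul,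
      ← map_smul]
    congr 2
    exact Subtype.ext (smul_comm a q z)
  choose c hc using hdvd
  obtain ⟨y, hy⟩ : ∃ y : I →₀ R, i ⟨q • z, hqz⟩ = q • y := by
    refine ⟨Finsupp.onFinset (i ⟨q • z, hqz⟩).support c fun j hj => ?_, Finsupp.ext hc⟩
    rw [Finsupp.mem_support_iff, hc]
    exact mul_ne_zero hq hj
  have h1 := hi ⟨q • z, hqz⟩
  rw [hy, map_smul] at h1
  have h2 : z - (Finsupp.linearCombination R id y : I) = 0 := by
    refine htf _ ?_
    rw [smul_sub, sub_eq_zero]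
    exact (congrArg Subtype.val h1).symm
  rw [sub_eq_zero.mp h2]
  exact Subtype.mem _

variable {n : ℕ} {J : Type}

/-- The forms `x` of degree `p` such that `β j ∧ x` is divisible by `a j` for all `j ∈ s`. -/
def logF (s : Finset J) (β : J → Fin n → R) (a : J → R) (p : ℕ) :
    Submodule R (ExteriorAlgebra R (Fin n → R)) where
  carrier := {x | x ∈ ⋀[R]^p (Fin n → R) ∧
    ∀ j ∈ s, ∃ y, ExteriorAlgebra.ι R (β j) * x = a j • y}
  zero_mem' := ⟨zero_mem _, fun j _ => ⟨0, by simp⟩⟩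
  add_mem' := by
    rintro x y ⟨hx, hx'⟩ ⟨hy, hy'⟩
    refine ⟨add_mem hx hy, fun j hj => ?_⟩
    obtain ⟨u, hu⟩ := hx' j hj
    obtain ⟨v, hv⟩ := hy' j hj
    exact ⟨u + v, by rw [mul_add, hu, hv, smul_add]⟩
  smul_mem' := by
    rintro r x ⟨hx, hx'⟩
    refine ⟨Submodule.smul_mem _ _ hx, fun j hj => ?_⟩
    obtain ⟨u, hu⟩ := hx' j hj
    exact ⟨r • u, by rw [mul_smul_comm, hu, smul_comm]⟩

variable {s t : Finset J} {β : J → Fin n → R} {a : J → R} {p : ℕ}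
  {x : ExteriorAlgebra R (Fin n → R)}

theorem mem_logF : x ∈ logF s β a p ↔ x ∈ ⋀[R]^p (Fin n → R) ∧
    ∀ j ∈ s, ∃ y, ExteriorAlgebra.ι R (β j) * x = a j • y := Iff.rfl

theorem logF_mono (h : s ⊆ t) : logF t β a p ≤ logF s β a p :=
  fun _ hx => ⟨hx.1, fun j hj => hx.2 j (h hj)⟩

theorem smul_mem_logF {q : R} (hq : ∀ j ∈ t, j ∉ s → a j ∣ q) (hx : x ∈ logF s β a p) :
    q • x ∈ logF t β a p := by
  refine ⟨Submodule.smul_mem _ _ hx.1, fun j hj => ?_⟩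
  by_cases hs : j ∈ s
  · obtain ⟨y, hy⟩ := hx.2 j hs
    exact ⟨q • y, by rw [mul_smul_comm, hy, smul_comm]⟩
  · obtain ⟨c, rfl⟩ := hq j hj hs
    exact ⟨c • (ExteriorAlgebra.ι R (β j) * x), by rw [mul_smul_comm, smul_smul]⟩

/-- The vectors `v` such that the minors of `(β j, v)` are divisible by `a j` for all `j ∈ s`. -/
def vecLog (s : Finset J) (β : J → Fin n → R) (a : J → R) : Submodule R (Fin n → R) where
  carrier := {v | ∀ c ∈ s, ∀ i j, a c ∣ β c i * v j - β c j * v i}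
  zero_mem' := fun c _ i j => by simp
  add_mem' := fun {v w} hv hw c hc i j => by
    have := dvd_add (hv c hc i j) (hw c hc i j)
    simp only [Pi.add_apply]
    convert this using 1
    ring
  smul_mem' := fun r v hv c hc i j => by
    have := (hv c hc i j).mul_left r
    simp only [Pi.smul_apply, smul_eq_mul]
    convert this using 1
    ring

theorem mem_vecLog {v : Fin n → R} :
    v ∈ vecLog s β a ↔ ∀ c ∈ s, ∀ i j, a c ∣ β c i * v j - β c j * v i := Iff.rfl

theorem smul_mem_vecLog {q : R} (hq : ∀ j ∈ t, j ∉ s → a j ∣ q) {v : Fin n → R}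
    (hv : v ∈ vecLog s β a) : q • v ∈ vecLog t β a := by
  intro c hc i j
  by_cases hs : c ∈ s
  · exact (vecLog s β a).smul_mem q hv c hs i j
  · refine (hq c hc hs).trans ⟨β c i * v j - β c j * v i, ?_⟩
    simp only [Pi.smul_apply, smul_eq_mul]
    ring

variable {d : J → Module.Dual R (Fin n → R)}

theorem vecLog_decomp (hd : ∀ c ∈ s, d c (β c) = 1) {v : Fin n → R} (hv : v ∈ vecLog s β a)
    {c : J} (hc : c ∈ s) : ∃ u, v = d c v • β c + a c • u := by
  choose m hm using hv c hc
  refine ⟨∑ i, d c (Pi.single i 1) • m i, ?_⟩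
  have hdc : ∀ w : Fin n → R, d c w = ∑ i, w i * d c (Pi.single i 1) := by
    intro w
    conv_lhs => rw [← Finset.univ_sum_single w]
    rw [map_sum]
    refine Finset.sum_congr rfl fun i _ => ?_
    rw [← smul_eq_mul, ← map_smul]
    congr 1
    ext k
    simp [Pi.single_apply]
  ext1 j
  simp only [Pi.add_apply, Pi.smul_apply, smul_eq_mul, Finset.sum_apply, Finset.mul_sum]
  have h1 : ∑ i, a c * (d c (Pi.single i 1) * m i j) =
      ∑ i, d c (Pi.single i 1) * (β c i * v j - β c j * v i) :=
    Finset.sum_congr rfl fun i _ => by rw [hm]; ring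
  rw [h1]
  have h2 : ∑ i, d c (Pi.single i 1) * (β c i * v j - β c j * v i) =
      d c (β c) * v j - β c j * d c v := by
    rw [hdc (β c), hdc v, Finset.sum_mul, Finset.mul_sum, ← Finset.sum_sub_distrib]
    exact Finset.sum_congr rfl fun i _ => by ring
  rw [h2, hd c hc]
  ring

theorem ι_mem_logF_iff (hd : ∀ c ∈ s, d c (β c) = 1) {v : Fin n → R} :
    ExteriorAlgebra.ι R v ∈ logF s β a 1 ↔ v ∈ vecLog s β a := by
  constructor
  · rintro ⟨-, h⟩ c hc i j
    obtain ⟨y, hy⟩ := h c hc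
    have h1 := congrArg (fun z => ExteriorAlgebra.ιInv (extContr (d c) z)) hy
    simp only [extContr_ι_mul, extContr_ι, hd c hc, one_smul, map_sub, map_smul] at h1
    rw [← Algebra.commutes, ← Algebra.smul_def, map_smul, ExteriorAlgebra.ι_leftInverse,
      ExteriorAlgebra.ι_leftInverse] at h1
    generalize ExteriorAlgebra.ιInv (extContr (d c) y) = u at h1
    refine ⟨β c i * u j - β c j * u i, ?_⟩
    have hi := congrFun h1 i
    have hj := congrFun h1 j
    simp only [Pi.sub_apply, Pi.smul_apply, smul_eq_mul] at hi hj
    linear_combination β c i * hj - β c j * hi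
  · intro hv
    refine ⟨by rw [ExteriorAlgebra.exteriorPower, pow_one]; exact ⟨v, rfl⟩, fun c hc => ?_⟩
    obtain ⟨u, hu⟩ := vecLog_decomp hd hv hc
    refine ⟨ExteriorAlgebra.ι R (β c) * ExteriorAlgebra.ι R u, ?_⟩
    conv_lhs => rw [hu]
    rw [map_add, mul_add, map_smul, mul_smul_comm, ExteriorAlgebra.ι_sq_zero, smul_zero, zero_add,
      map_smul, mul_smul_comm]

/-- Logarithmic one-forms as vectors. -/
def vecLogEquiv (hd : ∀ c ∈ s, d c (β c) = 1) : vecLog s β a ≃ₗ[R] logF s β a 1 :=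
  LinearEquiv.ofBijective
    ((ExteriorAlgebra.ι R).restrict fun _ hv => (ι_mem_logF_iff hd).mpr hv) (by
    constructor
    · intro v w h
      exact Subtype.ext ((ExteriorAlgebra.ι_inj R _ _).mp (congrArg Subtype.val h))
    · rintro ⟨x, hx⟩
      obtain ⟨v, rfl⟩ : ∃ v, ExteriorAlgebra.ι R v = x := by
        have := hx.1
        rwa [ExteriorAlgebra.exteriorPower, pow_one] at this
      exact ⟨⟨v, (ι_mem_logF_iff hd).mp hx⟩, rfl⟩)

theorem exists_smul_of_isRelPrime [DecompositionMonoid R] {b c : R} (hbc : IsRelPrime b c)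
    {y : ExteriorAlgebra R (Fin n → R)} (h : c • x = b • y) : ∃ z, x = b • z := by
  have h1 : ∃ y, c • x = b • y := ⟨y, h⟩
  rw [exists_smul_iff_dvd_repr (Pi.basisFun R (Fin n)).ExteriorAlgebra] at h1 ⊢
  intro i
  have := h1 i
  rw [map_smul, Finsupp.smul_apply, smul_eq_mul] at this
  exact hbc.dvd_of_dvd_mul_left this

theorem exists_prod_smul [DecompositionMonoid R] (s : Finset J) (b : J → R)
    (hb : ∀ i ∈ s, ∀ j ∈ s, i ≠ j → IsRelPrime (b i) (b j)) (h : ∀ j ∈ s, ∃ y, x = b j • y) :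
    ∃ y, x = (∏ j ∈ s, b j) • y := by
  rw [exists_smul_iff_dvd_repr (Pi.basisFun R (Fin n)).ExteriorAlgebra]
  intro i
  refine Finset.prod_dvd_of_isRelPrime (fun i hi j hj hij => hb i hi j hj hij) fun j hj => ?_
  exact (exists_smul_iff_dvd_repr _ _ _).mp (h j hj) i

variable [IsDomain R]

/-- Modules of logarithmic forms are second syzygies. -/
theorem pdLE_logF {k : ℕ} (hR : ∀ (N : Type) [AddCommGroup N] [Module R N], pdLE R (k + 2) N)
    (ha : ∀ j ∈ s, a j ≠ 0) : pdLE R k (logF s β a p) := by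
  let F := (⋀[R]^p (Fin n → R)) × (s → ⋀[R]^(p + 1) (Fin n → R))
  let g : F →ₗ[R] (s → ⋀[R]^(p + 1) (Fin n → R)) :=
    { toFun := fun w j => ⟨ExteriorAlgebra.ι R (β j) * w.1, ι_mul_mem _ w.1.2⟩ - a j • w.2 j
      map_add' := fun v w => by
        refine funext fun j => Subtype.ext ?_
        change ExteriorAlgebra.ι R (β j) * (v.1.1 + w.1.1) - a j • ((v.2 j).1 + (w.2 j).1) =
          (ExteriorAlgebra.ι R (β j) * v.1.1 - a j • (v.2 j).1) +
            (ExteriorAlgebra.ι R (β j) * w.1.1 - a j • (w.2 j).1)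
        rw [mul_add, smul_add]
        abel
      map_smul' := fun r w => by
        refine funext fun j => Subtype.ext ?_
        change ExteriorAlgebra.ι R (β j) * (r • w.1.1) - a j • (r • (w.2 j).1) =
          r • (ExteriorAlgebra.ι R (β j) * w.1.1 - a j • (w.2 j).1)
        rw [mul_smul_comm, smul_sub, smul_comm r (a j)] }
  have hg : ∀ w, w ∈ LinearMap.ker g ↔ ∀ j : s,
      ExteriorAlgebra.ι R (β j) * (w.1 : ExteriorAlgebra R (Fin n → R)) = a j • (w.2 j).1 := by
    intro w
    rw [LinearMap.mem_ker, _root_.funext_iff]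
    refine forall_congr' fun j => ?_
    rw [Pi.zero_apply, ← Subtype.coe_inj]
    exact sub_eq_zero
  refine pdLE_of_linearEquiv ?_ (pdLE_ker_of_forall_two hR g)
  refine LinearEquiv.ofBijective
    { toFun := fun w => ⟨w.1.1, w.1.1.2, fun j hj => ⟨_, (hg w.1).mp w.2 ⟨j, hj⟩⟩⟩
      map_add' := fun v w => rfl
      map_smul' := fun r w => rfl } ⟨?_, ?_⟩
  · rintro ⟨⟨v, v'⟩, hv⟩ ⟨⟨w, w'⟩, hw⟩ h
    have h1 : v = w := Subtype.ext (congrArg (fun z : logF s β a p => z.1) h)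
    subst h1
    refine Subtype.ext (Prod.ext rfl (funext fun j => Subtype.ext ?_))
    have h2 := ((hg _).mp hv j).symm.trans ((hg _).mp hw j)
    rw [← sub_eq_zero, ← smul_sub] at h2
    exact sub_eq_zero.mp (extAlg_smul_eq_zero (ha j j.2) h2)
  · rintro ⟨x, hx, hx'⟩
    choose y hy using fun j : s => hx' j j.2
    refine ⟨⟨(⟨x, hx⟩, fun j => ⟨y j, mem_exteriorPower_of_smul_mem (ha j j.2) ?_⟩), ?_⟩, rfl⟩
    · rw [← hy]
      exact ι_mul_mem _ hx
    · exact (hg _).mpr hy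

theorem pdLE_logF_zero [DecompositionMonoid R] (ha : ∀ j ∈ s, a j ≠ 0)
    (hco : ∀ i ∈ s, ∀ j ∈ s, i ≠ j → IsRelPrime (a i) (a j))
    (hd : ∀ c ∈ s, d c (β c) = 1) (k : ℕ) : pdLE R k (logF s β a 0) := by
  have hQ : ∏ j ∈ s, a j ≠ 0 := Finset.prod_ne_zero_iff.mpr ha
  have hmem : ∀ r : R, algebraMap R (ExteriorAlgebra R (Fin n → R)) r ∈ ⋀[R]^0 (Fin n → R) := by
    intro r
    rw [ExteriorAlgebra.exteriorPower, pow_zero]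
    exact Submodule.mem_one.mpr ⟨r, rfl⟩
  have hm : ∀ r : R, algebraMap R (ExteriorAlgebra R (Fin n → R)) ((∏ j ∈ s, a j) * r) ∈
      logF s β a 0 := by
    refine fun r => ⟨hmem _, fun j hj => ?_⟩
    rw [← Finset.mul_prod_erase s a hj, mul_assoc, map_mul, ← Algebra.smul_def, mul_smul_comm]
    exact ⟨_, rfl⟩
  let f : R →ₗ[R] logF s β a 0 :=
    { toFun := fun r => ⟨_, hm r⟩
      map_add' := fun v w => Subtype.ext
        ((congrArg (algebraMap R _) (mul_add _ v w)).trans (map_add _ _ _))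
      map_smul' := fun r w => Subtype.ext
        (((congrArg (algebraMap R _) (mul_left_comm _ r w)).trans (map_mul _ _ _)).trans
          (Algebra.smul_def _ _).symm) }
  refine pdLE_of_linearEquiv (M₁ := R) (LinearEquiv.ofBijective f ⟨?_, ?_⟩) (pdLE_of_projective k)
  · intro r r' h
    exact mul_left_cancel₀ hQ ((ExteriorAlgebra.algebraMap_inj _ _ _).mp
      (congrArg (fun z : logF s β a 0 => z.1) h))
  · rintro ⟨x, hx, hx'⟩
    obtain ⟨y, rfl⟩ := exists_prod_smul (x := x) s a hco fun j hj => by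
      obtain ⟨y, hy⟩ := hx' j hj
      refine ⟨extContr (d j) y, ?_⟩
      rw [← map_smul, ← hy, extContr_ι_mul, extContr_mem_zero _ hx, mul_zero, sub_zero, hd j hj,
        one_smul]
    obtain ⟨r, rfl⟩ := exists_eq_algebraMap_of_mem_zero (mem_exteriorPower_of_smul_mem hQ hx)
    exact ⟨r, Subtype.ext ((map_mul _ _ _).trans (Algebra.smul_def _ _).symm)⟩

end LogForms
section ExteriorPowers

variable {R : Type} [CommRing R] {n : ℕ} {J : Type} {s : Finset J} {β : J → Fin n → R} {a : J → R}
  {d : J → Module.Dual R (Fin n → R)} {p : ℕ}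

/-- The submodule spanned by the products of `p` logarithmic one-forms. -/
def wedgeLog (s : Finset J) (β : J → Fin n → R) (a : J → R) (p : ℕ) :
    Submodule R (ExteriorAlgebra R (Fin n → R)) :=
  (vecLog s β a).map (ExteriorAlgebra.ι R) ^ p

theorem ι_mul_mem_wedgeLog {v : Fin n → R} (hv : v ∈ vecLog s β a)
    {x : ExteriorAlgebra R (Fin n → R)} (hx : x ∈ wedgeLog s β a p) :
    ExteriorAlgebra.ι R v * x ∈ wedgeLog s β a (p + 1) := by
  rw [wedgeLog, pow_succ']
  exact Submodule.mul_mem_mul ⟨v, hv, rfl⟩ hx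

theorem wedgeLog_mono {s' : Finset J} (h : vecLog s β a ≤ vecLog s' β a) :
    wedgeLog s β a p ≤ wedgeLog s' β a p :=
  pow_le_pow_left' (Submodule.map_mono h) p

theorem wedgeLog_succ_induction {C : ExteriorAlgebra R (Fin n → R) → Prop}
    (hmul : ∀ v ∈ vecLog s β a, ∀ x ∈ wedgeLog s β a p, C (ExteriorAlgebra.ι R v * x))
    (hadd : ∀ x y, C x → C y → C (x + y)) {x : ExteriorAlgebra R (Fin n → R)}
    (hx : x ∈ wedgeLog s β a (p + 1)) : C x := by
  rw [wedgeLog, pow_succ'] at hx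
  refine Submodule.mul_induction_on hx ?_ fun x y => hadd x y
  rintro _ ⟨v, hv, rfl⟩ x hx
  exact hmul v hv x hx

theorem pow_smul_mem_wedgeLog {t : Finset J} {q : R}
    (hq : ∀ v ∈ vecLog s β a, q • v ∈ vecLog t β a) {x : ExteriorAlgebra R (Fin n → R)}
    (hx : x ∈ wedgeLog s β a p) : q ^ p • x ∈ wedgeLog t β a p := by
  induction p generalizing x with
  | zero => simpa [wedgeLog] using hx
  | succ p ih =>
    refine wedgeLog_succ_induction (C := fun x => q ^ (p + 1) • x ∈ wedgeLog t β a (p + 1))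
      (fun v hv x hx => ?_) (fun x y hx hy => ?_) hx
    · have := ι_mul_mem_wedgeLog (hq v hv) (ih hx)
      rwa [map_smul, mul_smul_comm, smul_mul_assoc, smul_smul, ← pow_succ] at this
    · rw [smul_add]
      exact add_mem hx hy

theorem wedgeLog_empty : wedgeLog ∅ β a p = ⋀[R]^p (Fin n → R) := by
  have : vecLog ∅ β a = ⊤ := eq_top_iff.mpr fun v _ c hc => absurd hc (Finset.notMem_empty c)
  rw [wedgeLog, this, Submodule.map_top]

theorem wedgeLog_decomp (hd : ∀ c ∈ s, d c (β c) = 1) {c : J} (hc : c ∈ s)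
    {x : ExteriorAlgebra R (Fin n → R)} (hx : x ∈ wedgeLog s β a (p + 1)) :
    ∃ ζ ξ, x = a c ^ p • (ExteriorAlgebra.ι R (β c) * ζ + a c • ξ) := by
  induction p generalizing x with
  | zero =>
    refine wedgeLog_succ_induction (C := fun x => ∃ ζ ξ, x = a c ^ 0 •
      (ExteriorAlgebra.ι R (β c) * ζ + a c • ξ)) (fun v hv x hx => ?_) ?_ hx
    · obtain ⟨u, hu⟩ := vecLog_decomp hd hv hc
      refine ⟨d c v • x, ExteriorAlgebra.ι R u * x, ?_⟩
      conv_lhs => rw [hu]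
      rw [pow_zero, one_smul, map_add, map_smul, map_smul, add_mul, mul_smul_comm, smul_mul_assoc,
        smul_mul_assoc]
    · rintro _ _ ⟨ζ, ξ, rfl⟩ ⟨ζ', ξ', rfl⟩
      exact ⟨ζ + ζ', ξ + ξ', by rw [← smul_add, mul_add, smul_add (a c)]; congr 1; abel⟩
  | succ p ih =>
    refine wedgeLog_succ_induction (C := fun x => ∃ ζ ξ, x = a c ^ (p + 1) •
      (ExteriorAlgebra.ι R (β c) * ζ + a c • ξ)) (fun v hv x hx => ?_) ?_ hx
    · obtain ⟨u, hu⟩ := vecLog_decomp hd hv hc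
      obtain ⟨ζ, ξ, rfl⟩ := ih hx
      refine ⟨d c v • ξ - ExteriorAlgebra.ι R u * ζ, ExteriorAlgebra.ι R u * ξ, ?_⟩
      have h1 : ExteriorAlgebra.ι R v * (ExteriorAlgebra.ι R (β c) * ζ + a c • ξ) =
          a c • (ExteriorAlgebra.ι R (β c) * (d c v • ξ - ExteriorAlgebra.ι R u * ζ) +
            a c • (ExteriorAlgebra.ι R u * ξ)) := by
        conv_lhs => rw [hu]
        rw [map_add, map_smul, map_smul, add_mul, mul_add, mul_add, smul_mul_assoc, smul_mul_assoc,
          smul_mul_assoc, smul_mul_assoc, ι_mul_ι_mul_self, ι_mul_ι_mul_comm u, mul_sub, smul_add,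
          smul_sub]
        simp only [mul_smul_comm, smul_neg, smul_zero, zero_add, smul_smul, mul_comm]
        abel
      rw [mul_smul_comm, h1, smul_smul, ← pow_succ]
    · rintro _ _ ⟨ζ, ξ, rfl⟩ ⟨ζ', ξ', rfl⟩
      exact ⟨ζ + ζ', ξ + ξ', by rw [← smul_add, mul_add, smul_add (a c)]; congr 1; abel⟩

theorem exists_logF_of_mem_wedgeLog [IsDomain R] [DecompositionMonoid R]
    (ha : ∀ j ∈ s, a j ≠ 0) (hco : ∀ i ∈ s, ∀ j ∈ s, i ≠ j → IsRelPrime (a i) (a j))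
    (hd : ∀ c ∈ s, d c (β c) = 1) {x : ExteriorAlgebra R (Fin n → R)}
    (hx : x ∈ wedgeLog s β a (p + 1)) :
    ∃ η ∈ logF s β a (p + 1), x = (∏ j ∈ s, a j) ^ p • η := by
  have hQ : (∏ j ∈ s, a j) ^ p ≠ 0 := pow_ne_zero _ (Finset.prod_ne_zero_iff.mpr ha)
  have hxd : x ∈ ⋀[R]^(p + 1) (Fin n → R) := by
    have h1 : wedgeLog s β a (p + 1) ≤ wedgeLog ∅ β a (p + 1) :=
      wedgeLog_mono fun v _ c hc => absurd hc (Finset.notMem_empty c)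
    rw [wedgeLog_empty] at h1
    exact h1 hx
  obtain ⟨y, hy⟩ := exists_prod_smul (x := x) s (fun j => a j ^ p)
    (fun i hi j hj hij => (hco i hi j hj hij).pow) fun j hj => by
      obtain ⟨ζ, ξ, h⟩ := wedgeLog_decomp hd hj hx
      exact ⟨_, h⟩
  rw [Finset.prod_pow] at hy
  refine ⟨y, ⟨mem_exteriorPower_of_smul_mem hQ (hy ▸ hxd), fun c hc => ?_⟩, hy⟩
  obtain ⟨ζ, ξ, h⟩ := wedgeLog_decomp hd hc hx
  have h1 : a c ^ p • ((∏ j ∈ s.erase c, a j) ^ p • (ExteriorAlgebra.ι R (β c) * y) -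
      a c • (ExteriorAlgebra.ι R (β c) * ξ)) = 0 := by
    rw [smul_sub, smul_smul, ← mul_pow, Finset.mul_prod_erase s a hc, ← mul_smul_comm, ← hy, h,
      mul_smul_comm, mul_add, ι_mul_ι_mul_self, zero_add, mul_smul_comm, sub_self]
  have h2 := sub_eq_zero.mp (extAlg_smul_eq_zero (pow_ne_zero p (ha c hc)) h1)
  refine exists_smul_of_isRelPrime (IsRelPrime.pow_right (IsRelPrime.prod_right fun j hj => ?_)) h2
  exact hco c hc j (Finset.mem_of_mem_erase hj) (Finset.ne_of_mem_erase hj).symm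

theorem prod_smul_mem_vecLog (v : Fin n → R) : (∏ j ∈ s, a j) • v ∈ vecLog s β a :=
  smul_mem_vecLog (s := ∅) (fun _ hj _ => Finset.dvd_prod_of_mem a hj)
    fun c hc => absurd hc (Finset.notMem_empty c)

theorem prod_pow_smul_mem_wedgeLog {x : ExteriorAlgebra R (Fin n → R)}
    (hx : x ∈ ⋀[R]^p (Fin n → R)) : (∏ j ∈ s, a j) ^ p • x ∈ wedgeLog s β a p :=
  pow_smul_mem_wedgeLog (s := ∅) (fun v _ => prod_smul_mem_vecLog v)
    ((wedgeLog_empty (β := β) (a := a)).symm ▸ hx)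

theorem prod_erase_smul_mem_wedgeLog [IsDomain R] (ha : ∀ j ∈ s, a j ≠ 0)
    (hd : ∀ c ∈ s, d c (β c) = 1) {c : J} (hc : c ∈ s) {x : ExteriorAlgebra R (Fin n → R)}
    (hx : x ∈ logF s β a (p + 1)) :
    (∏ j ∈ s.erase c, a j) • ((∏ j ∈ s, a j) ^ p • x) ∈ wedgeLog s β a (p + 1) := by
  obtain ⟨y, hy⟩ := hx.2 c hc
  have h1 := eq_ι_mul_add_extContr (d c) (hd c hc) x
  have h2 : a c • extContr (d c) y ∈ ⋀[R]^(p + 1) (Fin n → R) := by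
    rw [← map_smul, ← hy]
    exact extContr_mem _ (ι_mul_mem _ hx.1)
  have h3 : (∏ j ∈ s.erase c, a j) • β c ∈ vecLog s β a := by
    intro j hj i k
    by_cases hjc : j = c
    · subst hjc
      simp [mul_comm, mul_left_comm]
    · refine (Finset.dvd_prod_of_mem a (Finset.mem_erase.mpr ⟨hjc, hj⟩)).trans
        ⟨β j i * β c k - β j k * β c i, ?_⟩
      simp only [Pi.smul_apply, smul_eq_mul]
      ring
  have h4 := ι_mul_mem_wedgeLog h3 (prod_pow_smul_mem_wedgeLog (extContr_mem (d c) hx.1))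
  have h5 := prod_pow_smul_mem_wedgeLog (s := s) (β := β) (a := a)
    (mem_exteriorPower_of_smul_mem (ha c hc) h2)
  convert add_mem h4 h5 using 1
  conv_lhs => rw [h1, hy, map_smul]
  rw [smul_add, smul_add, map_smul, mul_smul_comm, smul_mul_assoc, smul_comm (_ ^ p),
    smul_comm (∏ j ∈ s.erase c, a j) (_ ^ p), smul_smul _ (a c), mul_comm _ (a c), Finset.mul_prod_erase s a hc,
    smul_smul _ (_ ^ p), ← pow_succ']

theorem map_smul_id_apply (q : R) {x : ExteriorAlgebra R (Fin n → R)}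
    (hx : x ∈ ⋀[R]^p (Fin n → R)) :
    ExteriorAlgebra.map (q • (LinearMap.id : (Fin n → R) →ₗ[R] (Fin n → R))) x = q ^ p • x := by
  induction p generalizing x with
  | zero =>
    obtain ⟨r, rfl⟩ := exists_eq_algebraMap_of_mem_zero hx
    rw [AlgHom.commutes, pow_zero, one_smul]
  | succ p ih =>
    refine exteriorPower_succ_induction (C := fun x => ExteriorAlgebra.map
      (q • (LinearMap.id : (Fin n → R) →ₗ[R] (Fin n → R))) x = q ^ (p + 1) • x)
      (fun v x hx => ?_) (fun x y hx hy => ?_) hx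
    · rw [map_mul, ih hx, ExteriorAlgebra.map_apply_ι, LinearMap.smul_apply, LinearMap.id_apply,
        map_smul, smul_mul_assoc, mul_smul_comm, smul_smul, pow_succ']
    · rw [map_add, hx, hy, smul_add]

theorem exists_comp_eq_smul_id {M : Type} [AddCommGroup M] [Module R M]
    (π : M →ₗ[R] (Fin n → R)) {q : R} (hq : ∀ v, q • v ∈ LinearMap.range π) :
    ∃ σ : (Fin n → R) →ₗ[R] M, π ∘ₗ σ = q • LinearMap.id := by
  obtain ⟨σ, hσ⟩ := Module.projective_lifting_property π.rangeRestrict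
    ((q • LinearMap.id).codRestrict (LinearMap.range π) hq) π.surjective_rangeRestrict
  refine ⟨σ, ?_⟩
  ext1 i
  have := congrArg (fun f => (LinearMap.range π).subtype ∘ₗ f) hσ
  rw [← LinearMap.comp_assoc] at this
  exact congrArg (fun f => f ∘ₗ LinearMap.single R (fun _ => R) i) this

theorem map_exteriorPower_eq_wedgeLog {N : ℕ} {π : (Fin N → R) →ₗ[R] (Fin n → R)}
    (hπ : LinearMap.range π = vecLog s β a) :
    (⋀[R]^p (Fin N → R)).map (ExteriorAlgebra.map π).toLinearMap = wedgeLog s β a p := by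
  rw [ExteriorAlgebra.exteriorPower, Submodule.map_pow, wedgeLog, ← hπ]
  congr 1
  rw [← LinearMap.range_comp, ← LinearMap.range_comp]
  congr 1
  ext1 v
  ext
  simp

variable [IsDomain R] [DecompositionMonoid R]

/-- If products of `p + 1` one-forms exhaust a multiple of the logarithmic `(p + 1)`-forms, then
the two modules are isomorphic. -/
def logFEquivWedgeLog (ha : ∀ j ∈ s, a j ≠ 0)
    (hco : ∀ i ∈ s, ∀ j ∈ s, i ≠ j → IsRelPrime (a i) (a j)) (hd : ∀ c ∈ s, d c (β c) = 1)
    (h : ∀ x ∈ logF s β a (p + 1), (∏ j ∈ s, a j) ^ p • x ∈ wedgeLog s β a (p + 1)) :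
    logF s β a (p + 1) ≃ₗ[R] wedgeLog s β a (p + 1) :=
  LinearEquiv.ofBijective
    ((LinearMap.lsmul R _ ((∏ j ∈ s, a j) ^ p)).restrict h) (by
    have hQ : (∏ j ∈ s, a j) ^ p ≠ 0 := pow_ne_zero _ (Finset.prod_ne_zero_iff.mpr ha)
    constructor
    · rw [injective_iff_map_eq_zero]
      intro v hv
      exact Subtype.ext (extAlg_smul_eq_zero hQ
        (congrArg (fun z : wedgeLog s β a (p + 1) => z.1) hv))
    · rintro ⟨x, hx⟩
      obtain ⟨η, hη, rfl⟩ := exists_logF_of_mem_wedgeLog ha hco hd hx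
      exact ⟨⟨η, hη⟩, rfl⟩)

/-- If the logarithmic one-forms are a free module, then all modules of logarithmic forms are
projective, and they are generated by products of one-forms up to scaling. -/
theorem smul_mem_wedgeLog_of_free (ha : ∀ j ∈ s, a j ≠ 0)
    (hco : ∀ i ∈ s, ∀ j ∈ s, i ≠ j → IsRelPrime (a i) (a j)) (hd : ∀ c ∈ s, d c (β c) = 1)
    {N : ℕ} (π : (Fin N → R) →ₗ[R] (Fin n → R)) (hπi : Function.Injective π)
    (hπ : LinearMap.range π = vecLog s β a) :
    Module.Projective R (wedgeLog s β a p) ∧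
      ∀ x ∈ logF s β a (p + 1), (∏ j ∈ s, a j) ^ p • x ∈ wedgeLog s β a (p + 1) := by
  have hQ : ∏ j ∈ s, a j ≠ 0 := Finset.prod_ne_zero_iff.mpr ha
  have hproj : ∀ p, Module.Projective R (wedgeLog s β a p) := by
    intro p
    obtain ⟨σ, hσ⟩ := exists_comp_eq_smul_id π (q := ∏ j ∈ s, a j) fun v => by
      rw [hπ]
      exact prod_smul_mem_vecLog v
    have hσ' : σ ∘ₗ π = (∏ j ∈ s, a j) • LinearMap.id := by
      refine LinearMap.ext fun w => hπi ?_
      exact (LinearMap.congr_fun hσ (π w)).trans (map_smul π _ _).symm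
    have hinj : Function.Injective ((ExteriorAlgebra.map π).toLinearMap ∘ₗ
        (⋀[R]^p (Fin N → R)).subtype) := by
      rw [injective_iff_map_eq_zero]
      intro w hw
      refine Subtype.ext (extAlg_smul_eq_zero (pow_ne_zero p hQ) ?_)
      rw [← map_smul_id_apply _ w.2, ← hσ', ← ExteriorAlgebra.map_comp_map]
      change ExteriorAlgebra.map σ (ExteriorAlgebra.map π w.1) = 0
      have : ExteriorAlgebra.map π w.1 = 0 := hw
      rw [this, map_zero]
    rw [← map_exteriorPower_eq_wedgeLog hπ]
    have e := LinearEquiv.ofInjective _ hinj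
    rw [LinearMap.range_comp, Submodule.range_subtype] at e
    exact Module.Projective.of_equiv e
  refine ⟨hproj p, fun x hx => ?_⟩
  have := hproj (p + 1)
  refine mem_of_projective (wedgeLog s β a (p + 1)) hQ (fun z => extAlg_smul_eq_zero hQ) ?_
    {q | ∃ c ∈ s, q = ∏ j ∈ s.erase c, a j} ?_ ?_
  · rw [smul_smul, ← pow_succ']
    exact prod_pow_smul_mem_wedgeLog hx.1
  · rintro _ ⟨c, hc, rfl⟩
    exact prod_erase_smul_mem_wedgeLog ha hd hc hx
  · intro t ht
    refine Finset.prod_dvd_of_isRelPrime (fun i hi j hj hij => hco i hi j hj hij) fun c hc => ?_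
    have := ht _ ⟨c, hc, rfl⟩
    rw [← Finset.mul_prod_erase s a hc, mul_comm] at this
    refine (mul_dvd_mul_iff_left ?_).mp this
    exact Finset.prod_ne_zero_iff.mpr fun j hj => ha j (Finset.mem_of_mem_erase hj)

theorem projective_logF_of_free (ha : ∀ j ∈ s, a j ≠ 0)
    (hco : ∀ i ∈ s, ∀ j ∈ s, i ≠ j → IsRelPrime (a i) (a j)) (hd : ∀ c ∈ s, d c (β c) = 1)
    {N : ℕ} (π : (Fin N → R) →ₗ[R] (Fin n → R)) (hπi : Function.Injective π)
    (hπ : LinearMap.range π = vecLog s β a) (p : ℕ) : Module.Projective R (logF s β a p) := by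
  cases p with
  | zero => exact pdLE_logF_zero ha hco hd 0
  | succ p =>
    have := (smul_mem_wedgeLog_of_free (p := p + 1) ha hco hd π hπi hπ).1
    exact Module.Projective.of_equiv (logFEquivWedgeLog ha hco hd
      (smul_mem_wedgeLog_of_free ha hco hd π hπi hπ).2).symm

end ExteriorPowers
section Syzygies

variable {R : Type} [CommRing R] {N : ℕ}

/-- The `d`-forms annihilated by the first `j` members of a sequence of vectors. -/
def extAnn (e : ℕ → Fin N → R) (j d : ℕ) : Submodule R (ExteriorAlgebra R (Fin N → R)) where
  carrier := {x | x ∈ ⋀[R]^d (Fin N → R) ∧ ∀ i < j, ExteriorAlgebra.ι R (e i) * x = 0}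
  zero_mem' := ⟨zero_mem _, fun _ _ => mul_zero _⟩
  add_mem' := fun hx hy => ⟨add_mem hx.1 hy.1, fun i hi => by
    rw [mul_add, hx.2 i hi, hy.2 i hi, add_zero]⟩
  smul_mem' := fun c _ hx => ⟨Submodule.smul_mem _ _ hx.1, fun i hi => by
    rw [mul_smul_comm, hx.2 i hi, smul_zero]⟩

/-- The product of the first `j` members of a sequence of vectors. -/
def wedgeSeq (e : ℕ → Fin N → R) : ℕ → ExteriorAlgebra R (Fin N → R)
  | 0 => 1
  | j + 1 => ExteriorAlgebra.ι R (e j) * wedgeSeq e j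

variable {e : ℕ → Fin N → R} {r j d p : ℕ} {τ : ℕ → Module.Dual R (Fin N → R)} {c : R}
  {x : ExteriorAlgebra R (Fin N → R)}

theorem extAnn_zero : extAnn e 0 d = ⋀[R]^d (Fin N → R) :=
  Submodule.ext fun _ => ⟨fun h => h.1, fun h => ⟨h, fun i hi => absurd hi (Nat.not_lt_zero i)⟩⟩

theorem extAnn_succ_le : extAnn e (j + 1) d ≤ extAnn e j d :=
  fun _ hx => ⟨hx.1, fun i hi => hx.2 i (hi.trans j.lt_succ_self)⟩

theorem ι_mul_mem_extAnn (hx : x ∈ extAnn e j d) :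
    ExteriorAlgebra.ι R (e j) * x ∈ extAnn e (j + 1) (d + 1) := by
  refine ⟨ι_mul_mem _ hx.1, fun i hi => ?_⟩
  rcases Nat.lt_succ_iff_lt_or_eq.mp hi with h | rfl
  · rw [ι_mul_ι_mul_comm, hx.2 i h, mul_zero, neg_zero]
  · exact ι_mul_ι_mul_self _ _

theorem ι_mul_wedgeSeq_mul (i : ℕ) (hi : i < j) (y : ExteriorAlgebra R (Fin N → R)) :
    ExteriorAlgebra.ι R (e i) * (wedgeSeq e j * y) = 0 := by
  induction j with
  | zero => exact absurd hi (Nat.not_lt_zero i)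
  | succ j ih =>
    rw [wedgeSeq, mul_assoc]
    rcases Nat.lt_succ_iff_lt_or_eq.mp hi with h | rfl
    · rw [ι_mul_ι_mul_comm, ih h, mul_zero, neg_zero]
    · exact ι_mul_ι_mul_self _ _

theorem wedgeSeq_mul_mem (hx : x ∈ ⋀[R]^p (Fin N → R)) :
    wedgeSeq e j * x ∈ extAnn e j (j + p) := by
  induction j with
  | zero => simpa [wedgeSeq, extAnn_zero] using hx
  | succ j ih =>
    rw [wedgeSeq, mul_assoc, Nat.succ_add]
    exact ι_mul_mem_extAnn ih

theorem wedgeSeq_mul_ι_mul (u : Fin N → R) (y : ExteriorAlgebra R (Fin N → R)) :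
    wedgeSeq e j * (ExteriorAlgebra.ι R u * y) =
      (-1 : R) ^ j • (ExteriorAlgebra.ι R u * (wedgeSeq e j * y)) := by
  induction j with
  | zero => simp [wedgeSeq]
  | succ j ih =>
    rw [wedgeSeq, mul_assoc, ih, mul_smul_comm, ι_mul_ι_mul_comm, mul_assoc, pow_succ, mul_smul,
      neg_one_smul]

theorem extContr_mem_extAnn (hτ : ∀ i < r, ∀ k < r, τ k (e i) = if i = k then c else 0)
    (hj : j < r) (hx : x ∈ extAnn e j (d + 1)) : extContr (τ j) x ∈ extAnn e j d := by
  refine ⟨extContr_mem _ hx.1, fun i hi => ?_⟩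
  have := extContr_ι_mul (τ j) (e i) x
  rw [hx.2 i hi, map_zero, hτ i (hi.trans hj) j hj, if_neg hi.ne, zero_smul, zero_sub] at this
  exact neg_eq_zero.mp this.symm

theorem smul_eq_ι_mul_extContr (hτ : ∀ i < r, ∀ k < r, τ k (e i) = if i = k then c else 0)
    (hj : j < r) (hx : ExteriorAlgebra.ι R (e j) * x = 0) :
    c • x = ExteriorAlgebra.ι R (e j) * extContr (τ j) x := by
  have := extContr_ι_mul (τ j) (e j) x
  rw [hx, map_zero, hτ j hj j hj, if_pos rfl] at this
  exact sub_eq_zero.mp this.symm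

theorem ι_mul_extContr_wedgeSeq_mul
    (hτ : ∀ i < r, ∀ k < r, τ k (e i) = if i = k then c else 0) {k : ℕ} (hjk : j ≤ k) (hk : k < r)
    (y : ExteriorAlgebra R (Fin N → R)) :
    ExteriorAlgebra.ι R (e k) * extContr (τ k) (wedgeSeq e j * y) =
      wedgeSeq e j * (ExteriorAlgebra.ι R (e k) * extContr (τ k) y) := by
  induction j with
  | zero => simp [wedgeSeq]
  | succ j ih =>
    rw [wedgeSeq, mul_assoc, mul_assoc, extContr_ι_mul, hτ j (by omega) k hk, if_neg (by omega),
      zero_smul, zero_sub, mul_neg, ι_mul_ι_mul_comm, neg_neg, ih (by omega)]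

theorem mem_ker_submoduleMap_iff (x : extAnn e j d) :
    x ∈ LinearMap.ker
      ((LinearMap.mulLeft R (ExteriorAlgebra.ι R (e j))).submoduleMap (extAnn e j d)) ↔
      x.1 ∈ extAnn e (j + 1) d := by
  rw [LinearMap.mem_ker, ← Subtype.coe_inj]
  constructor
  · intro h
    refine ⟨x.2.1, fun i hi => ?_⟩
    rcases Nat.lt_succ_iff_lt_or_eq.mp hi with h' | rfl
    · exact x.2.2 i h'
    · exact h
  · exact fun h => h.2 j j.lt_succ_self

theorem pdLE_map_mul {k : ℕ} (h₁ : pdLE R k (extAnn e (j + 1) d))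
    (h₂ : pdLE R (k + 1) (extAnn e j d)) :
    pdLE R (k + 1) ((extAnn e j d).map (LinearMap.mulLeft R (ExteriorAlgebra.ι R (e j)))) := by
  refine pdLE_of_pdLE_ker (LinearMap.submoduleMap_surjective _ _) ?_ h₂
  refine pdLE_of_linearEquiv ?_ h₁
  exact LinearEquiv.ofBijective
    ((Submodule.inclusion extAnn_succ_le).codRestrict _ fun y =>
      (mem_ker_submoduleMap_iff _).mpr y.2)
    ⟨fun y z h => Subtype.ext (congrArg (fun w => w.1.1) h), fun y =>
      ⟨⟨y.1.1, (mem_ker_submoduleMap_iff _).mp y.2⟩, rfl⟩⟩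

theorem pdLE_map_mul_of_eq_bot {k : ℕ} (h₁ : extAnn e (j + 1) d = ⊥)
    (h₂ : pdLE R k (extAnn e j d)) :
    pdLE R k ((extAnn e j d).map (LinearMap.mulLeft R (ExteriorAlgebra.ι R (e j)))) := by
  refine pdLE_of_linearEquiv (LinearEquiv.ofBijective _ ⟨?_, LinearMap.submoduleMap_surjective
    (LinearMap.mulLeft R (ExteriorAlgebra.ι R (e j))) (extAnn e j d)⟩) h₂
  rw [← LinearMap.ker_eq_bot, eq_bot_iff]
  intro x hx
  have := (mem_ker_submoduleMap_iff _).mp hx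
  rw [h₁] at this
  exact Subtype.ext this

variable [IsDomain R]

theorem extAnn_eq_bot (hτ : ∀ i < r, ∀ k < r, τ k (e i) = if i = k then c else 0) (hc : c ≠ 0)
    (hj : j ≤ r) (hd : d < j) : extAnn e j d = ⊥ := by
  rw [eq_bot_iff]
  induction j generalizing d with
  | zero => exact absurd hd (Nat.not_lt_zero d)
  | succ j ih =>
    intro x hx
    have h1 : extContr (τ j) x = 0 := by
      cases d with
      | zero => exact extContr_mem_zero _ hx.1
      | succ d =>
        exact ih (by omega) (by omega) (extContr_mem_extAnn hτ (by omega) (extAnn_succ_le hx))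
    have h2 := smul_eq_ι_mul_extContr hτ (by omega) (hx.2 j j.lt_succ_self)
    rw [h1, mul_zero] at h2
    exact extAlg_smul_eq_zero hc h2

theorem map_mul_eq_extAnn {rs : List R} (hrs : RingTheory.Sequence.IsWeaklyRegular R rs)
    (hH : ∀ c ∈ rs, ∃ τ : ℕ → Module.Dual R (Fin N → R),
      ∀ i < r, ∀ k < r, τ k (e i) = if i = k then c else 0)
    (h0 : ∃ c ∈ rs, c ≠ 0) (hp : p + 2 ≤ rs.length) (hj : j < r)
    (hI : pdLE R p ((extAnn e j d).map (LinearMap.mulLeft R (ExteriorAlgebra.ι R (e j))))) :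
    (extAnn e j d).map (LinearMap.mulLeft R (ExteriorAlgebra.ι R (e j))) =
      extAnn e (j + 1) (d + 1) := by
  refine eq_of_pdLE ?_ rs hrs ?_ ?_ hp hI
  · rintro _ ⟨x, hx, rfl⟩
    exact ι_mul_mem_extAnn hx
  · intro c hc x hx
    obtain ⟨τ, hτ⟩ := hH c hc
    rw [smul_eq_ι_mul_extContr hτ hj (hx.2 j j.lt_succ_self)]
    exact ⟨_, extContr_mem_extAnn hτ hj (extAnn_succ_le hx), rfl⟩
  · obtain ⟨c, hc, hc0⟩ := h0
    exact fun x _ hx => extAlg_smul_eq_zero hc0 (hx c hc)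

theorem pdLE_extAnn {rs : List R} (hrs : RingTheory.Sequence.IsWeaklyRegular R rs)
    (hH : ∀ c ∈ rs, ∃ τ : ℕ → Module.Dual R (Fin N → R),
      ∀ i < r, ∀ k < r, τ k (e i) = if i = k then c else 0)
    (h0 : ∃ c ∈ rs, c ≠ 0) (hp : p + 2 ≤ rs.length) (hj : j ≤ r) :
    pdLE R p (extAnn e j (j + p)) ∧ ∀ x ∈ extAnn e j (j + p),
      ∃ y ∈ ⋀[R]^p (Fin N → R), wedgeSeq e j * y = x := by
  induction p generalizing j with
  | zero =>
    induction j with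
    | zero =>
      rw [extAnn_zero]
      exact ⟨pdLE_of_projective _, fun x hx => ⟨x, by simpa using hx, by simp [wedgeSeq]⟩⟩
    | succ j ih =>
      obtain ⟨c, hc, hc0⟩ := h0
      obtain ⟨τ, hτ⟩ := hH c hc
      have h1 := pdLE_map_mul_of_eq_bot
        (extAnn_eq_bot (d := j + 0) hτ hc0 hj (Nat.lt_succ_self j)) (ih (by omega)).1
      have h2 := map_mul_eq_extAnn hrs hH ⟨c, hc, hc0⟩ hp hj h1
      change pdLE R 0 (extAnn e (j + 1) (j + 0 + 1)) ∧ ∀ x ∈ extAnn e (j + 1) (j + 0 + 1), _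
      rw [← h2]
      refine ⟨h1, ?_⟩
      rintro _ ⟨x, hx, rfl⟩
      obtain ⟨y, hy, rfl⟩ := (ih (by omega)).2 x hx
      exact ⟨y, hy, mul_assoc _ _ _⟩
  | succ p ihp =>
    induction j with
    | zero =>
      rw [extAnn_zero]
      exact ⟨pdLE_of_projective _, fun x hx => ⟨x, by simpa using hx, by simp [wedgeSeq]⟩⟩
    | succ j ih =>
      have h3 := (ihp (by omega) hj).1
      rw [Nat.succ_add, ← Nat.add_succ] at h3
      have h1 := pdLE_map_mul h3 (ih (by omega)).1
      have h2 := map_mul_eq_extAnn hrs hH h0 hp hj h1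
      rw [Nat.succ_add, ← h2]
      refine ⟨h1, ?_⟩
      rintro _ ⟨x, hx, rfl⟩
      obtain ⟨y, hy, rfl⟩ := (ih (by omega)).2 x hx
      exact ⟨y, hy, mul_assoc _ _ _⟩

variable {n : ℕ} {π : (Fin N → R) →ₗ[R] (Fin n → R)}

theorem map_eq_zero_of_wedgeSeq_mul (hc : c ≠ 0)
    (hτ : ∀ i < r, ∀ k < r, τ k (e i) = if i = k then c else 0)
    (hπ : ∀ i < r, π (e i) = 0) (hj : j ≤ r) (h : wedgeSeq e j * x = 0) :
    ExteriorAlgebra.map π x = 0 := by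
  induction j generalizing x with
  | zero =>
    rw [wedgeSeq, one_mul] at h
    rw [h, map_zero]
  | succ j ih =>
    have h1 := smul_eq_ι_mul_extContr hτ hj (by rwa [wedgeSeq, mul_assoc] at h)
    rw [ι_mul_extContr_wedgeSeq_mul hτ le_rfl hj, ← mul_smul_comm, ← sub_eq_zero, ← mul_sub] at h1
    have h2 := ih (by omega) h1
    rw [map_sub, map_mul, ExteriorAlgebra.map_apply_ι, hπ j hj, map_zero, zero_mul, sub_zero,
      map_smul] at h2
    exact extAlg_smul_eq_zero hc h2

theorem wedgeSeq_mul_eq_zero_of_map (hker : ∀ u, π u = 0 → ∃ w : ℕ → R,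
      u = ∑ i ∈ Finset.range r, w i • e i) {q : R} (hq : q ≠ 0)
    {σ : (Fin n → R) →ₗ[R] (Fin N → R)} (hσ : π ∘ₗ σ = q • LinearMap.id)
    (hx : x ∈ ⋀[R]^p (Fin N → R)) (h : ExteriorAlgebra.map π x = 0) : wedgeSeq e r * x = 0 := by
  have key : ∀ {p : ℕ} {x}, x ∈ ⋀[R]^p (Fin N → R) →
      wedgeSeq e r * ExteriorAlgebra.map (σ ∘ₗ π) x = q ^ p • (wedgeSeq e r * x) := by
    intro p
    induction p with
    | zero =>
      intro x hx
      obtain ⟨t, rfl⟩ := exists_eq_algebraMap_of_mem_zero hx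
      rw [AlgHom.commutes, pow_zero, one_smul]
    | succ p ih =>
      intro x hx
      refine exteriorPower_succ_induction (C := fun x => wedgeSeq e r *
        ExteriorAlgebra.map (σ ∘ₗ π) x = q ^ (p + 1) • (wedgeSeq e r * x))
        (fun u y hy => ?_) (fun y z hy hz => ?_) hx
      · obtain ⟨w, hw⟩ := hker (σ (π u) - q • u) (by
          rw [map_sub, map_smul, sub_eq_zero]
          exact LinearMap.congr_fun hσ (π u))
        rw [map_mul, ExteriorAlgebra.map_apply_ι, LinearMap.comp_apply, eq_add_of_sub_eq hw,
          wedgeSeq_mul_ι_mul, ih hy, map_add, map_sum, add_mul, Finset.sum_mul,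
          Finset.sum_eq_zero, zero_add, map_smul, wedgeSeq_mul_ι_mul, smul_mul_assoc,
          mul_smul_comm, smul_smul q, ← pow_succ', smul_comm]
        intro i hi
        rw [map_smul, smul_mul_assoc, mul_smul_comm,
          ι_mul_wedgeSeq_mul i (Finset.mem_range.mp hi), smul_zero, smul_zero]
      · rw [map_add, mul_add, hy, hz, mul_add, smul_add]
  have h1 := key hx
  rw [← ExteriorAlgebra.map_comp_map] at h1
  have h2 : ((ExteriorAlgebra.map σ).comp (ExteriorAlgebra.map π)) x = 0 := by
    rw [AlgHom.comp_apply, h, map_zero]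
  rw [h2, mul_zero] at h1
  exact extAlg_smul_eq_zero (pow_ne_zero p hq) h1.symm

/-- The scalars `c` such that `c` times the identity factors through `g`. -/
def splitIdeal {M M' : Type} [AddCommGroup M] [Module R M] [AddCommGroup M'] [Module R M']
    (g : M →ₗ[R] M') : Ideal R where
  carrier := {c | ∃ τ : M' →ₗ[R] M, τ ∘ₗ g = c • LinearMap.id}
  zero_mem' := ⟨0, by simp⟩
  add_mem' := by
    rintro c c' ⟨τ, h⟩ ⟨τ', h'⟩
    exact ⟨τ + τ', by rw [LinearMap.add_comp, h, h', add_smul]⟩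
  smul_mem' := by
    rintro c c' ⟨τ, h⟩
    exact ⟨c • τ, by rw [LinearMap.smul_comp, h, smul_smul, smul_eq_mul]⟩

omit [IsDomain R] in
theorem mem_splitIdeal {M M' M'' : Type} [AddCommGroup M] [Module R M] [AddCommGroup M']
    [Module R M'] [AddCommGroup M''] [Module R M''] {g : M →ₗ[R] M'} {π : M' →ₗ[R] M''}
    (hg : Function.Injective g) (hgπ : LinearMap.range g = LinearMap.ker π)
    (L : Submodule R M'') [Module.Projective R L] (hL : LinearMap.range π ≤ L)
    {q : R} (hq : ∀ v ∈ L, q • v ∈ LinearMap.range π) : q ∈ splitIdeal g := by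
  obtain ⟨σ, hσ⟩ := Module.projective_lifting_property π.rangeRestrict
    ((q • L.subtype).codRestrict (LinearMap.range π) fun v => hq v v.2) π.surjective_rangeRestrict
  have hσ' : ∀ v : L, π (σ v) = q • v.1 := fun v =>
    congrArg (fun z : LinearMap.range π => z.1) (LinearMap.congr_fun hσ v)
  let π' : M' →ₗ[R] L := π.codRestrict L fun v => hL ⟨v, rfl⟩
  let δ : M' →ₗ[R] LinearMap.range g := (q • LinearMap.id - σ ∘ₗ π').codRestrict _ fun v => by
    rw [hgπ, LinearMap.mem_ker, LinearMap.sub_apply, map_sub, sub_eq_zero]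
    exact (map_smul π q v).trans (hσ' (π' v)).symm
  refine ⟨(LinearEquiv.ofInjective g hg).symm.toLinearMap ∘ₗ δ, LinearMap.ext fun v => ?_⟩
  rw [LinearMap.comp_apply, LinearMap.comp_apply, LinearEquiv.coe_coe, LinearEquiv.symm_apply_eq]
  refine Subtype.ext ?_
  change q • g v - σ (π' (g v)) = g (q • v)
  have : π' (g v) = 0 := Subtype.ext (LinearMap.mem_ker.mp (hgπ ▸ ⟨v, rfl⟩ : g v ∈ _))
  rw [this, map_zero, sub_zero, map_smul]

/-- The image of the `p`-th exterior power under a map with free kernel which splits up to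
scalars. -/
theorem pdLE_map_exteriorPower {r : ℕ} {g : (Fin r → R) →ₗ[R] (Fin N → R)}
    (hgπ : LinearMap.range g = LinearMap.ker π) {q : R} (hq : q ≠ 0)
    (hqπ : ∀ v, q • v ∈ LinearMap.range π) {rs : List R}
    (hrs : RingTheory.Sequence.IsWeaklyRegular R rs) (hH : ∀ c ∈ rs, c ∈ splitIdeal g)
    (h0 : ∃ c ∈ rs, c ≠ 0) (hp : p + 2 ≤ rs.length) :
    pdLE R p ((⋀[R]^p (Fin N → R)).map (ExteriorAlgebra.map π).toLinearMap) := by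
  let e : ℕ → Fin N → R := fun i => if h : i < r then g (Pi.single ⟨i, h⟩ 1) else 0
  have hee : ∀ i (h : i < r), e i = g (Pi.single ⟨i, h⟩ 1) := fun i h => dif_pos h
  have hH' : ∀ c ∈ rs, ∃ τ : ℕ → Module.Dual R (Fin N → R),
      ∀ i < r, ∀ k < r, τ k (e i) = if i = k then c else 0 := by
    intro c hc
    obtain ⟨τ, hτ⟩ := hH c hc
    refine ⟨fun k => if h : k < r then LinearMap.proj ⟨k, h⟩ ∘ₗ τ else 0, fun i hi k hk => ?_⟩
    have := congrFun (LinearMap.congr_fun hτ (Pi.single ⟨i, hi⟩ 1)) ⟨k, hk⟩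
    simp only [dif_pos hk, hee i hi]
    refine this.trans ?_
    simp [Pi.single_apply, eq_comm]
  have hπe : ∀ i < r, π (e i) = 0 := by
    intro i hi
    rw [hee i hi, ← LinearMap.mem_ker, ← hgπ]
    exact ⟨_, rfl⟩
  have hker : ∀ u, π u = 0 → ∃ w : ℕ → R, u = ∑ i ∈ Finset.range r, w i • e i := by
    intro u hu
    rw [← LinearMap.mem_ker, ← hgπ] at hu
    obtain ⟨w, rfl⟩ := hu
    refine ⟨fun i => if h : i < r then w ⟨i, h⟩ else 0, ?_⟩
    rw [Finset.sum_range]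
    conv_lhs => rw [← Finset.univ_sum_single w, map_sum]
    refine Finset.sum_congr rfl fun i _ => ?_
    rw [hee i i.2]
    dsimp only
    rw [dif_pos i.2, ← map_smul]
    congr 1
    ext k
    simp [Pi.single_apply]
  obtain ⟨σ, hσ⟩ := exists_comp_eq_smul_id π hqπ
  obtain ⟨c, hc, hc0⟩ := h0
  obtain ⟨τ, hτ⟩ := hH' c hc
  obtain ⟨h1, h2⟩ := pdLE_extAnn (j := r) hrs hH' ⟨c, hc, hc0⟩ hp le_rfl
  let f₁ : ⋀[R]^p (Fin N → R) →ₗ[R] extAnn e r (r + p) :=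
    (LinearMap.mulLeft R (wedgeSeq e r)).restrict fun x hx => wedgeSeq_mul_mem hx
  let f₂ := (ExteriorAlgebra.map π).toLinearMap.submoduleMap (⋀[R]^p (Fin N → R))
  have hf₁ : Function.Surjective f₁ := by
    rintro ⟨x, hx⟩
    obtain ⟨y, hy, rfl⟩ := h2 x hx
    exact ⟨⟨y, hy⟩, rfl⟩
  have hf₂ : Function.Surjective f₂ := LinearMap.submoduleMap_surjective _ _
  have hk : LinearMap.ker f₁ = LinearMap.ker f₂ := by
    ext x
    rw [LinearMap.mem_ker, LinearMap.mem_ker, ← Subtype.coe_inj, ← Subtype.coe_inj]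
    exact ⟨map_eq_zero_of_wedgeSeq_mul hc0 hτ hπe le_rfl,
      wedgeSeq_mul_eq_zero_of_map hker hq hσ x.2⟩
  exact pdLE_of_linearEquiv ((f₁.quotKerEquivOfSurjective hf₁).symm.trans
    ((Submodule.quotEquivOfEq _ _ hk).trans (f₂.quotKerEquivOfSurjective hf₂))) h1

end Syzygies
section LogPresentation

variable {R : Type} [CommRing R] [IsDomain R]

theorem exists_mem_ne_zero_of_isWeaklyRegular {rs : List R}
    (hrs : RingTheory.Sequence.IsWeaklyRegular R rs) (h : 0 < rs.length) : ∃ c ∈ rs, c ≠ 0 := by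
  cases rs with
  | nil => exact absurd h (lt_irrefl _)
  | cons c rs =>
    refine ⟨c, List.mem_cons_self, ?_⟩
    rintro rfl
    have := ((RingTheory.Sequence.isWeaklyRegular_cons_iff R 0 rs).mp hrs).1
    exact one_ne_zero (this (by simp : (0 : R) • (1 : R) = (0 : R) • 0))

variable [DecompositionMonoid R] {n : ℕ} {J : Type} {s : Finset J} {β : J → Fin n → R} {a : J → R}
  {d : J → Module.Dual R (Fin n → R)} {p : ℕ}

theorem prod_sdiff_smul_mem_wedgeLog (ha : ∀ j ∈ s, a j ≠ 0)
    (hco : ∀ i ∈ s, ∀ j ∈ s, i ≠ j → IsRelPrime (a i) (a j)) (hd : ∀ c ∈ s, d c (β c) = 1)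
    {t : Finset J} (hts : t ⊆ s) {N : ℕ} (π : (Fin N → R) →ₗ[R] (Fin n → R))
    (hπi : Function.Injective π) (hπ : LinearMap.range π = vecLog t β a)
    {x : ExteriorAlgebra R (Fin n → R)} (hx : x ∈ logF s β a (p + 1)) :
    (∏ j ∈ s \ t, a j) • ((∏ j ∈ s, a j) ^ p • x) ∈ wedgeLog s β a (p + 1) := by
  have h1 := (smul_mem_wedgeLog_of_free (p := p) (fun j hj => ha j (hts hj))
    (fun i hi j hj => hco i (hts hi) j (hts hj)) (fun c hc => hd c (hts hc)) π hπi hπ).2 x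
    (logF_mono hts hx)
  have h2 := pow_smul_mem_wedgeLog (t := s) (q := ∏ j ∈ s \ t, a j) (fun v hv =>
    smul_mem_vecLog (fun j hj hjt => Finset.dvd_prod_of_mem a (Finset.mem_sdiff.mpr ⟨hj, hjt⟩)) hv) h1
  rwa [smul_smul, pow_succ', mul_assoc, ← mul_pow, Finset.prod_sdiff hts, mul_smul] at h2

/-- Bounds for the projective dimensions of the modules of logarithmic forms from a free
presentation of the logarithmic one-forms and freeness of many subarrangements. -/
theorem pdLE_logF_of_presentation (ha : ∀ j ∈ s, a j ≠ 0)
    (hco : ∀ i ∈ s, ∀ j ∈ s, i ≠ j → IsRelPrime (a i) (a j)) (hd : ∀ c ∈ s, d c (β c) = 1)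
    {N r : ℕ} (π : (Fin N → R) →ₗ[R] (Fin n → R)) (g : (Fin r → R) →ₗ[R] (Fin N → R))
    (hπ : LinearMap.range π = vecLog s β a) (hgi : Function.Injective g)
    (hg : LinearMap.range g = LinearMap.ker π) (X : Set (Finset J))
    (hX : ∀ t ∈ X, t ⊆ s ∧ ∃ (N' : ℕ) (π' : (Fin N' → R) →ₗ[R] (Fin n → R)),
      Function.Injective π' ∧ LinearMap.range π' = vecLog t β a)
    {rs : List R} (hrs : RingTheory.Sequence.IsWeaklyRegular R rs)
    (hmem : ∀ c ∈ rs, c ∈ Ideal.span {q | ∃ t ∈ X, q = ∏ j ∈ s \ t, a j})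
    (hp : p + 2 ≤ rs.length) : pdLE R p (logF s β a p) := by
  have hQ : ∏ j ∈ s, a j ≠ 0 := Finset.prod_ne_zero_iff.mpr ha
  have h0 := exists_mem_ne_zero_of_isWeaklyRegular hrs (by omega)
  have hW : pdLE R p (wedgeLog s β a p) := by
    rw [← map_exteriorPower_eq_wedgeLog hπ]
    refine pdLE_map_exteriorPower hg hQ (fun v => hπ ▸ prod_smul_mem_vecLog v) hrs
      (fun c hc => ?_) h0 hp
    refine (Ideal.span_le (I := splitIdeal g)).mpr ?_ (hmem c hc)
    rintro _ ⟨t, ht, rfl⟩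
    obtain ⟨hts, N', π', hπ'i, hπ'⟩ := hX t ht
    have := Module.Projective.of_equiv (LinearEquiv.ofInjective π' hπ'i)
    refine mem_splitIdeal hgi hg (LinearMap.range π') ?_ fun v hv => ?_
    · rw [hπ, hπ']
      exact fun v hv c hc => hv c (hts hc)
    · rw [hπ]
      rw [hπ'] at hv
      exact smul_mem_vecLog
        (fun j hj hjt => Finset.dvd_prod_of_mem a (Finset.mem_sdiff.mpr ⟨hj, hjt⟩)) hv
  cases p with
  | zero => exact pdLE_logF_zero ha hco hd 0
  | succ p =>
    have hle : wedgeLog s β a (p + 1) =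
        (logF s β a (p + 1)).map (LinearMap.lsmul R _ ((∏ j ∈ s, a j) ^ p)) := by
      refine eq_of_pdLE (fun x hx => ?_) rs hrs ?_ ?_ hp hW
      · obtain ⟨η, hη, rfl⟩ := exists_logF_of_mem_wedgeLog ha hco hd hx
        exact ⟨η, hη, rfl⟩
      · rintro c hc _ ⟨x, hx, rfl⟩
        have key : Ideal.span {q | ∃ t ∈ X, q = ∏ j ∈ s \ t, a j} ≤
            (wedgeLog s β a (p + 1)).comap (LinearMap.toSpanSingleton R _
              ((∏ j ∈ s, a j) ^ p • x)) := by
          rw [Ideal.span_le]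
          rintro _ ⟨t, ht, rfl⟩
          obtain ⟨hts, N', π', hπ'i, hπ'⟩ := hX t ht
          exact prod_sdiff_smul_mem_wedgeLog ha hco hd hts π' hπ'i hπ' hx
        exact key (hmem c hc)
      · obtain ⟨c, hc, hc0⟩ := h0
        exact fun x _ hx => extAlg_smul_eq_zero hc0 (hx c hc)
    exact pdLE_of_linearEquiv (logFEquivWedgeLog ha hco hd fun x hx => by
      rw [hle]
      exact ⟨x, hx, rfl⟩).symm hW

end LogPresentation
section HyperplaneSplitting

/-- A splitting of the dual of `K^ℓ` adapted to the hyperplane `ker c0 = range e`. -/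
structure HypSplit (c0 : Fin ℓ → K) (e : (Fin (ℓ - 1) → K) →ₗ[K] (Fin ℓ → K)) where
  v1 : Fin ℓ → K
  row : Fin (ℓ - 1) → Fin ℓ → K
  dot_v1 : dotProduct c0 v1 = 1
  restrict_row : ∀ i, restrictForm e (row i) = Pi.single i 1
  row_v1 : ∀ i, dotProduct (row i) v1 = 0
  restrict_self : restrictForm e c0 = 0
  decomp : ∀ c, c = ∑ i, restrictForm e c i • row i + dotProduct c v1 • c0

theorem dotLin_apply (c x : Fin ℓ → K) : dotLin c x = dotProduct c x := by
  simp [dotLin, dotProduct]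

theorem restrictForm_apply (e : (Fin (ℓ - 1) → K) →ₗ[K] (Fin ℓ → K)) (c : Fin ℓ → K) (i) :
    restrictForm e c i = dotProduct c (e (Pi.single i 1)) := rfl

theorem dotProduct_map (e : (Fin (ℓ - 1) → K) →ₗ[K] (Fin ℓ → K)) (c : Fin ℓ → K)
    (y : Fin (ℓ - 1) → K) : dotProduct c (e y) = ∑ i, restrictForm e c i * y i := by
  have hy : y = ∑ i, y i • (Pi.single i 1 : Fin (ℓ - 1) → K) := by
    simpa [Pi.single_apply] using pi_eq_sum_univ' y
  conv_lhs => rw [hy]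
  simp [map_sum, dotProduct_sum, dotProduct_smul, restrictForm_apply, mul_comm]

theorem exists_hypSplit {c0 : Fin ℓ → K} (hc : c0 ≠ 0)
    {e : (Fin (ℓ - 1) → K) →ₗ[K] (Fin ℓ → K)} (he : IsHypEmbedding c0 e) :
    Nonempty (HypSplit c0 e) := by
  obtain ⟨j, hj⟩ := Function.ne_iff.1 hc
  obtain ⟨hinj, hr⟩ := he
  have he0 : ∀ y, dotProduct c0 (e y) = 0 := fun y => by
    rw [← dotLin_apply]
    exact LinearMap.mem_ker.1 (hr ▸ LinearMap.mem_range_self e y)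
  let v1 : Fin ℓ → K := Pi.single j (c0 j)⁻¹
  have hv1 : dotProduct c0 v1 = 1 := by simp [v1, mul_inv_cancel₀ hj]
  let pr : (Fin ℓ → K) →ₗ[K] LinearMap.range e :=
    LinearMap.codRestrict _ (LinearMap.id - (dotLin c0).smulRight v1) (fun x => by
      rw [hr, LinearMap.mem_ker]
      simp only [LinearMap.sub_apply, LinearMap.id_apply, LinearMap.smulRight_apply, map_sub,
        map_smul, dotLin_apply, hv1]
      simp)
  let r : (Fin ℓ → K) →ₗ[K] (Fin (ℓ - 1) → K) :=
    (LinearEquiv.ofInjective e hinj).symm.toLinearMap.comp pr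
  have her : ∀ x, e (r x) = x - dotProduct c0 x • v1 := fun x => by
    change e ((LinearEquiv.ofInjective e hinj).symm (pr x)) = _
    rw [LinearEquiv.ofInjective_symm_apply]
    change x - (dotLin c0 x) • v1 = _
    rw [dotLin_apply]
  have hre : ∀ y, r (e y) = y := fun y => hinj (by rw [her, he0, zero_smul, sub_zero])
  have hrv : r v1 = 0 := hinj (by rw [her, hv1, one_smul, sub_self, map_zero])
  have hrow : ∀ (i) (x : Fin ℓ → K),
      dotProduct (fun j => r (Pi.single j 1) i) x = r x i := fun i x => by
    have hx : x = ∑ k, x k • (Pi.single k 1 : Fin ℓ → K) := by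
      simpa [Pi.single_apply] using pi_eq_sum_univ' x
    conv_rhs => rw [hx]
    simp [map_sum, dotProduct, mul_comm]
  refine ⟨⟨v1, fun i j => r (Pi.single j 1) i, hv1, fun i => ?_, fun i => ?_, ?_, fun c => ?_⟩⟩
  · funext k
    rw [restrictForm_apply, hrow, hre, Pi.single_comm]
  · rw [hrow, hrv]; rfl
  · funext k; exact he0 _
  · funext k
    have h1 : dotProduct c (Pi.single k 1) = c k := by simp
    have h2 : (Pi.single k 1 : Fin ℓ → K) = e (r (Pi.single k 1)) + c0 k • v1 := by
      rw [her]; simp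
    rw [← h1, h2, dotProduct_add, dotProduct_map]
    simp [Finset.sum_apply, dotProduct_smul, mul_comm]

theorem exists_hypEmbedding {c0 : Fin ℓ → K} (hc : c0 ≠ 0) :
    ∃ e : (Fin (ℓ - 1) → K) →ₗ[K] (Fin ℓ → K), IsHypEmbedding c0 e := by
  have hd : dotLin c0 ≠ 0 := fun h => hc (by
    funext j
    have := LinearMap.congr_fun h (Pi.single j 1)
    rw [dotLin_apply] at this
    simpa using this)
  have hf : Module.finrank K (LinearMap.ker (dotLin c0)) = ℓ - 1 := by
    have := Module.Dual.finrank_ker_add_one_of_ne_zero (f := dotLin c0) hd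
    simp at this
    omega
  have e' : (Fin (ℓ - 1) → K) ≃ₗ[K] LinearMap.ker (dotLin c0) :=
    LinearEquiv.ofFinrankEq _ _ (by simp [hf])
  refine ⟨(Submodule.subtype _).comp e'.toLinearMap, ?_, ?_⟩
  · exact Subtype.val_injective.comp e'.injective
  · rw [LinearMap.range_comp, LinearEquiv.range, Submodule.map_top, Submodule.range_subtype]

end HyperplaneSplitting
section LinearForms

theorem linP_add (c c' : Fin ℓ → K) : linP (c + c') = linP c + linP c' := by
  simp [linP, add_mul, Finset.sum_add_distrib]

theorem linP_smul (t : K) (c : Fin ℓ → K) : linP (t • c) = C t * linP c := by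
  simp [linP, Finset.mul_sum, mul_assoc]

/-- `linP` as a linear map. -/
def linPHom (K : Type) [Field K] (ℓ : ℕ) : (Fin ℓ → K) →ₗ[K] PS K ℓ where
  toFun := linP
  map_add' := linP_add
  map_smul' t c := by rw [linP_smul, RingHom.id_apply, MvPolynomial.smul_eq_C_mul]

theorem linP_zero : linP (0 : Fin ℓ → K) = 0 := map_zero (linPHom K ℓ)

theorem linP_sum {ι : Type} (s : Finset ι) (f : ι → Fin ℓ → K) :
    linP (∑ i ∈ s, f i) = ∑ i ∈ s, linP (f i) := map_sum (linPHom K ℓ) f s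

theorem linP_single (j : Fin ℓ) : linP (Pi.single j (1 : K)) = X j := by
  rw [linP, Finset.sum_eq_single j]
  · simp
  · intro b _ hb; simp [Pi.single_eq_of_ne hb]
  · simp

theorem constantCoeff_linP (c : Fin ℓ → K) : constantCoeff (linP c) = 0 := by
  simp [linP]

theorem coeff_linP (c : Fin ℓ → K) (j : Fin ℓ) :
    coeff (Finsupp.single j 1) (linP c) = c j := by
  simp [linP, coeff_sum, coeff_C_mul, coeff_X, Finsupp.single_left_inj]

theorem linP_ne_zero {c : Fin ℓ → K} (hc : c ≠ 0) : linP c ≠ 0 := fun h => hc (by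
  funext j; rw [← coeff_linP c, h]; simp)

theorem isHomogeneous_linP (c : Fin ℓ → K) : (linP c).IsHomogeneous 1 :=
  IsHomogeneous.sum _ _ _ fun i _ => by
    simpa using (isHomogeneous_C (Fin ℓ) (c i)).mul (isHomogeneous_X K i)

/-- Restriction of polynomials to the hyperplane `range e`. -/
def resH (e : (Fin (ℓ - 1) → K) →ₗ[K] (Fin ℓ → K)) : PS K ℓ →+* PS K (ℓ - 1) :=
  eval₂Hom C fun j => linP fun i => e (Pi.single i 1) j

theorem resH_C (e : (Fin (ℓ - 1) → K) →ₗ[K] (Fin ℓ → K)) (t : K) : resH e (C t) = C t := by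
  simp [resH]

theorem resH_linP (e : (Fin (ℓ - 1) → K) →ₗ[K] (Fin ℓ → K)) (c : Fin ℓ → K) :
    resH e (linP c) = linP (restrictForm e c) := by
  have h : restrictForm e c = ∑ j, c j • fun i => e (Pi.single i 1) j := by
    funext i; simp [restrictForm]
  rw [h, linP_sum]
  conv_lhs => rw [linP, map_sum]
  refine Finset.sum_congr rfl fun j _ => ?_
  rw [map_mul, resH_C, linP_smul]
  simp [resH]

variable {c0 : Fin ℓ → K} {e : (Fin (ℓ - 1) → K) →ₗ[K] (Fin ℓ → K)} (h : HypSplit c0 e)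

include h in
theorem HypSplit.ne_zero : c0 ≠ 0 := by
  rintro rfl
  simpa using h.dot_v1

theorem HypSplit.resH_row (i) : resH e (linP (h.row i)) = X i := by
  rw [resH_linP, h.restrict_row, linP_single]

include h in
theorem HypSplit.resH_self : resH e (linP c0) = 0 := by
  rw [resH_linP, h.restrict_self, linP_zero]

/-- The section of `resH e` given by the splitting. -/
def HypSplit.lift : PS K (ℓ - 1) →+* PS K ℓ := eval₂Hom C fun i => linP (h.row i)

theorem HypSplit.resH_lift (y) : resH e (h.lift y) = y := by
  have : (resH e).comp h.lift = RingHom.id _ := by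
    apply MvPolynomial.ringHom_ext
    · intro r; simp [HypSplit.lift, resH_C]
    · intro i; simp [HypSplit.lift, h.resH_row]
  exact RingHom.congr_fun this y

include h in
theorem HypSplit.resH_surjective : Function.Surjective (resH e) :=
  fun y => ⟨_, h.resH_lift y⟩

theorem HypSplit.lift_linP (c : Fin (ℓ - 1) → K) :
    h.lift (linP c) = linP (∑ i, c i • h.row i) := by
  rw [linP_sum, linP, map_sum]
  refine Finset.sum_congr rfl fun i _ => ?_
  rw [linP_smul, map_mul]
  simp [HypSplit.lift]

theorem HypSplit.linP_eq (c : Fin ℓ → K) :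
    linP c = h.lift (resH e (linP c)) + C (dotProduct c h.v1) * linP c0 := by
  rw [resH_linP, h.lift_linP, ← linP_smul, ← linP_add, ← h.decomp]

theorem HypSplit.dvd_sub_lift (s : PS K ℓ) : linP c0 ∣ s - h.lift (resH e s) := by
  induction s using MvPolynomial.induction_on with
  | C a => simp [resH_C, HypSplit.lift]
  | add p q hp hq =>
    rw [map_add, map_add, add_sub_add_comm]
    exact dvd_add hp hq
  | mul_X p j hp =>
    have h1 : linP c0 ∣ X j - h.lift (resH e (X j)) := by
      rw [← linP_single]
      exact ⟨C (dotProduct (Pi.single j 1) h.v1),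
        sub_eq_of_eq_add' ((h.linP_eq (Pi.single j 1)).trans (by rw [mul_comm]))⟩
    have h2 : p * X j - h.lift (resH e (p * X j))
        = (p - h.lift (resH e p)) * X j + h.lift (resH e p) * (X j - h.lift (resH e (X j))) := by
      rw [map_mul, map_mul]; ring
    rw [h2]
    exact dvd_add (hp.mul_right _) (h1.mul_left _)

include h in
theorem HypSplit.exists_of_resH_eq_zero {r : PS K ℓ} (hr : resH e r = 0) :
    ∃ s, r = linP c0 * s := by
  have := h.dvd_sub_lift r
  rwa [hr, map_zero, sub_zero] at this

theorem prime_linP {c : Fin ℓ → K} (hc : c ≠ 0) : Prime (linP c) := by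
  obtain ⟨e, he⟩ := exists_hypEmbedding hc
  obtain ⟨h⟩ := exists_hypSplit hc he
  have hk : RingHom.ker (resH e) = Ideal.span {linP c} := by
    ext r
    rw [RingHom.mem_ker, Ideal.mem_span_singleton]
    refine ⟨fun hr => h.exists_of_resH_eq_zero hr, ?_⟩
    rintro ⟨s, rfl⟩
    rw [map_mul, h.resH_self, zero_mul]
  rw [← Ideal.span_singleton_prime (linP_ne_zero hc), ← hk]
  exact RingHom.ker_isPrime _

theorem linP_dvd_linP {c c' : Fin ℓ → K} (hc : c ≠ 0) (hd : linP c ∣ linP c') :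
    ∃ t : K, c' = t • c := by
  obtain ⟨e, he⟩ := exists_hypEmbedding hc
  obtain ⟨h⟩ := exists_hypSplit hc he
  obtain ⟨s, hs⟩ := hd
  have h0 : linP (restrictForm e c') = 0 := by
    rw [← resH_linP, hs, map_mul, h.resH_self, zero_mul]
  have h1 : restrictForm e c' = 0 := by
    by_contra hne; exact linP_ne_zero hne h0
  refine ⟨dotProduct c' h.v1, ?_⟩
  conv_lhs => rw [h.decomp c', h1]
  simp

theorem isRelPrime_linP {c c' : Fin ℓ → K} (hc : c ≠ 0) (hn : ∀ t : K, c' ≠ t • c) :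
    IsRelPrime (linP c) (linP c') :=
  (prime_linP hc).irreducible.isRelPrime_iff_not_dvd.2 fun hd =>
    let ⟨t, ht⟩ := linP_dvd_linP hc hd
    hn t ht

/-- The splitting identifies `K[x₁, …, x_ℓ]` with polynomials in the `linP (h.row i)` over
`K[linP c0]`. -/
def HypSplit.ringEquiv : PS K ℓ ≃+* MvPolynomial (Fin (ℓ - 1)) (Polynomial K) :=
  RingEquiv.ofRingHom
    (eval₂Hom (C.comp Polynomial.C) fun j =>
      ∑ i, C (Polynomial.C (e (Pi.single i 1) j)) * X i
        + C (Polynomial.C (h.v1 j) * Polynomial.X))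
    (eval₂Hom (Polynomial.eval₂RingHom C (linP c0)) fun i => linP (h.row i))
    (by
      have key : ∀ c : Fin ℓ → K, (eval₂Hom (C.comp Polynomial.C) fun j =>
          ∑ i, C (Polynomial.C (e (Pi.single i 1) j)) * X i
          + C (Polynomial.C (h.v1 j) * Polynomial.X)) (linP c)
          = ∑ i, C (Polynomial.C (restrictForm e c i)) * X i
            + C (Polynomial.C (dotProduct c h.v1) * Polynomial.X) := fun c => by
        simp only [linP, map_sum, map_mul, eval₂Hom_C, eval₂Hom_X', RingHom.comp_apply, mul_add,
          Finset.sum_add_distrib, Finset.mul_sum, restrictForm, dotProduct, Finset.sum_mul]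
        rw [Finset.sum_comm]
        simp only [mul_assoc]
      apply MvPolynomial.ringHom_ext
      · intro p
        simp only [RingHom.comp_apply, eval₂Hom_C, RingHom.id_apply]
        induction p using Polynomial.induction_on' with
        | add p q hp hq => simp only [map_add, hp, hq]
        | monomial n a =>
          rw [Polynomial.coe_eval₂RingHom, Polynomial.eval₂_monomial, map_mul, map_pow, key,
            h.restrict_self, h.dot_v1]
          simp [← Polynomial.C_mul_X_pow_eq_monomial]
      · intro i
        simp only [RingHom.comp_apply, eval₂Hom_X', RingHom.id_apply, key, h.restrict_row,
          h.row_v1]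
        simp only [map_zero, zero_mul, add_zero]
        rw [Finset.sum_eq_single i]
        · simp
        · intro b _ hb; simp [Pi.single_eq_of_ne hb]
        · simp)
    (by
      apply MvPolynomial.ringHom_ext
      · intro r; simp
      · intro j
        have := h.decomp (Pi.single j 1)
        conv_rhs => rw [RingHom.id_apply, ← linP_single, this, linP_add, linP_sum, linP_smul]
        have hr : ∀ i, restrictForm e (Pi.single j 1) i = e (Pi.single i 1) j := fun i => by
          simp [restrictForm_apply]
        simp [linP_smul, hr])

theorem HypSplit.ringEquiv_symm_X (i) : h.ringEquiv.symm (X i) = linP (h.row i) :=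
  eval₂Hom_X' _ _ i

theorem HypSplit.ringEquiv_symm_C_X : h.ringEquiv.symm (C Polynomial.X) = linP c0 :=
  (eval₂Hom_C _ _ _).trans (Polynomial.eval₂_X _ _)

theorem HypSplit.ringEquiv_row (i) : h.ringEquiv (linP (h.row i)) = X i := by
  rw [← h.ringEquiv_symm_X, RingEquiv.apply_symm_apply]

theorem HypSplit.ringEquiv_self : h.ringEquiv (linP c0) = C Polynomial.X := by
  rw [← h.ringEquiv_symm_C_X, RingEquiv.apply_symm_apply]

theorem HypSplit.ringEquiv_C (t : K) : h.ringEquiv (C t) = C (Polynomial.C t) :=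
  eval₂Hom_C _ _ t

end LinearForms
section RegularSequence

open RingTheory.Sequence

/-- The sets of forms in `s` vanishing at a nonzero point of the hyperplane `c0 = 0`. -/
def pointFlats (s : Finset (Fin ℓ → K)) (c0 : Fin ℓ → K) : Set (Finset (Fin ℓ → K)) :=
  {t | ∃ x : Fin ℓ → K, x ≠ 0 ∧ dotProduct c0 x = 0 ∧ t = s.filter fun c => dotProduct c x = 0}

/-- The ideal generated by the products of the forms in `s` not vanishing at a point of
`c0 = 0`. -/
def pointIdeal (s : Finset (Fin ℓ → K)) (c0 : Fin ℓ → K) : Ideal (PS K ℓ) :=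
  Ideal.span {q | ∃ t ∈ pointFlats s c0, q = ∏ c ∈ s \ t, linP c}

theorem exists_sub_smul_mem_span {s : Finset (Fin ℓ → K)} {c0 : Fin ℓ → K} {P : Ideal (PS K ℓ)}
    [hP : P.IsPrime] (hle : pointIdeal s c0 ≤ P) (r : Fin ℓ → K) :
    ∃ l : K, r - l • c0 ∈ Submodule.span K ((s.filter fun c => linP c ∈ P : Finset _) :
      Set (Fin ℓ → K)) := by
  set U := Submodule.span K ((s.filter fun c => linP c ∈ P : Finset _) : Set (Fin ℓ → K))
  have htop : U ⊔ Submodule.span K {c0} = ⊤ := by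
    by_contra hne
    obtain ⟨f, hf0, hf⟩ := Submodule.exists_le_ker_of_lt_top _ (lt_top_iff_ne_top.2 hne)
    have hfx : ∀ c, f c = dotProduct c fun j => f (Pi.single j 1) := fun c => by
      have hc : c = ∑ k, c k • (Pi.single k 1 : Fin ℓ → K) := by
        simpa [Pi.single_apply] using pi_eq_sum_univ' c
      conv_lhs => rw [hc]
      simp [map_sum, dotProduct]
    have hx0 : (fun j => f (Pi.single j 1)) ≠ 0 := fun h0 => hf0 (by
      ext j; simpa using congrFun h0 j)
    have hc0 : dotProduct c0 (fun j => f (Pi.single j 1)) = 0 := by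
      rw [← hfx]
      exact hf (Submodule.mem_sup_right (Submodule.mem_span_singleton_self c0))
    have hmem := hle (Ideal.subset_span ⟨_, ⟨_, hx0, hc0, rfl⟩, rfl⟩)
    obtain ⟨c, hc, hcP⟩ := hP.prod_mem_iff.1 hmem
    rw [Finset.mem_sdiff, Finset.mem_filter] at hc
    refine hc.2 ⟨hc.1, ?_⟩
    rw [← hfx]
    exact hf (Submodule.mem_sup_left (Submodule.subset_span (by simp [hc.1, hcP])))
  have hr : r ∈ U ⊔ Submodule.span K {c0} := htop ▸ Submodule.mem_top
  obtain ⟨u, hu, v, hv, rfl⟩ := Submodule.mem_sup.1 hr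
  obtain ⟨l, rfl⟩ := Submodule.mem_span_singleton.1 hv
  exact ⟨l, by simpa using hu⟩

theorem linP_mem_of_mem_span {P : Ideal (PS K ℓ)} {t : Set (Fin ℓ → K)}
    (ht : ∀ c ∈ t, linP c ∈ P) {c : Fin ℓ → K} (hc : c ∈ Submodule.span K t) : linP c ∈ P := by
  induction hc using Submodule.span_induction with
  | mem x hx => exact ht x hx
  | zero => rw [linP_zero]; exact P.zero_mem
  | add x y _ _ hx hy => rw [linP_add]; exact P.add_mem hx hy
  | smul a x _ hx => rw [linP_smul]; exact P.mul_mem_left _ hx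

theorem isWeaklyRegular_X_pow (n : ℕ) (k : Fin n → ℕ) :
    IsWeaklyRegular (PS K n) (List.ofFn fun i => (X i : PS K n) ^ k i) := by
  simpa using isWeaklyRegular_monic (D := K) n (fun i => Polynomial.X ^ k i)
    fun i => Polynomial.monic_X_pow _

variable {c0 : Fin ℓ → K} {e : (Fin (ℓ - 1) → K) →ₗ[K] (Fin ℓ → K)}

theorem HypSplit.exists_regular_sequence (h : HypSplit c0 e) (s : Finset (Fin ℓ → K)) :
    ∃ (F : Fin (ℓ - 1) → PS K ℓ) (k : Fin (ℓ - 1) → ℕ), (∀ i, F i ∈ pointIdeal s c0) ∧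
      IsWeaklyRegular (PS K ℓ) (List.ofFn F) ∧ ∀ i, resH e (F i) = X i ^ k i := by
  let lam : Finset (Fin ℓ → K) → Fin (ℓ - 1) → K := fun t i =>
    if hl : ∃ l : K, h.row i - l • c0 ∈ Submodule.span K (t : Set (Fin ℓ → K))
    then hl.choose else 0
  let f : Fin (ℓ - 1) → PS K ℓ := fun i =>
    ∏ t ∈ s.powerset, (linP (h.row i) - C (lam t i) * linP c0)
  have hf : ∀ i, f i ∈ (pointIdeal s c0).radical := fun i => by
    rw [Ideal.radical_eq_sInf, Submodule.mem_sInf]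
    rintro P ⟨hle, hP⟩
    refine hP.prod_mem_iff.2 ⟨s.filter fun c => linP c ∈ P, by simp, ?_⟩
    have hex := exists_sub_smul_mem_span hle (h.row i)
    have hm : h.row i - lam (s.filter fun c => linP c ∈ P) i • c0 ∈ Submodule.span K
        ((s.filter fun c => linP c ∈ P : Finset _) : Set (Fin ℓ → K)) := by
      simp only [lam, dif_pos hex]
      exact hex.choose_spec
    have := linP_mem_of_mem_span (P := P) (fun c hc => by simpa using (by simpa using hc :
      c ∈ s ∧ linP c ∈ P).2) hm
    rwa [sub_eq_add_neg, ← neg_smul, linP_add, linP_smul, map_neg, neg_mul,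
      ← sub_eq_add_neg] at this
  choose k hk using hf
  refine ⟨fun i => f i ^ k i, fun i => s.powerset.card * k i, hk, ?_, fun i => ?_⟩
  · refine isWeaklyRegular_ringEquiv h.ringEquiv _ ?_
    have := isWeaklyRegular_monic (D := Polynomial K) (ℓ - 1) (fun i =>
      (∏ t ∈ s.powerset, (Polynomial.X - Polynomial.C (Polynomial.C (lam t i) * Polynomial.X)))
        ^ k i) fun i => (Polynomial.monic_prod_of_monic _ _ fun t _ =>
          Polynomial.monic_X_sub_C _).pow _
    rw [List.map_ofFn]
    refine (congrArg (fun l => IsWeaklyRegular _ (List.ofFn l)) (funext fun i => ?_)).mpr this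
    simp only [Function.comp_apply, f, map_pow, map_prod, map_sub, map_mul, h.ringEquiv_row,
      h.ringEquiv_self, h.ringEquiv_C, Polynomial.aeval_X, Polynomial.aeval_C]
    simp [MvPolynomial.algebraMap_eq]
  · simp only [f, map_pow, map_prod, map_sub, map_mul, h.resH_row, h.resH_self, mul_zero,
      sub_zero, Finset.prod_const, pow_mul]

end RegularSequence
section SplitForms

variable {R : Type} [CommRing R] {m n : ℕ}

/-- Data splitting off a vector `c0` from a free module. -/
structure VecSplit (R : Type) [CommRing R] (m n : ℕ) where
  p : (Fin n → R) →ₗ[R] (Fin m → R)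
  q : (Fin m → R) →ₗ[R] (Fin n → R)
  c0 : Fin m → R
  v0 : Module.Dual R (Fin m → R)
  q_p : ∀ v, q (p v) = v
  q_c0 : q c0 = 0
  v0_c0 : v0 c0 = 1
  v0_p : ∀ v, v0 (p v) = 0
  decomp : ∀ v, v = p (q v) + v0 v • c0

namespace VecSplit

variable (σ : VecSplit R m n)

/-- The map on exterior algebras induced by the inclusion. -/
def P : ExteriorAlgebra R (Fin n → R) →ₐ[R] ExteriorAlgebra R (Fin m → R) :=
  ExteriorAlgebra.map σ.p

/-- The map on exterior algebras induced by the projection. -/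
def E : ExteriorAlgebra R (Fin m → R) →ₐ[R] ExteriorAlgebra R (Fin n → R) :=
  ExteriorAlgebra.map σ.q

theorem P_ι (v) : σ.P (ExteriorAlgebra.ι R v) = ExteriorAlgebra.ι R (σ.p v) :=
  ExteriorAlgebra.map_apply_ι _ _

theorem E_ι (v) : σ.E (ExteriorAlgebra.ι R v) = ExteriorAlgebra.ι R (σ.q v) :=
  ExteriorAlgebra.map_apply_ι _ _

theorem E_P (x) : σ.E (σ.P x) = x := by
  have h : σ.E.comp σ.P = AlgHom.id R _ := by
    apply ExteriorAlgebra.hom_ext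
    ext v
    simp [P_ι, E_ι, σ.q_p]
  exact AlgHom.congr_fun h x

theorem extContr_P (x) : extContr σ.v0 (σ.P x) = 0 := by
  induction x using CliffordAlgebra.left_induction with
  | algebraMap r => rw [AlgHom.commutes]; exact extContr_algebraMap _ _
  | add x y hx hy => rw [map_add, map_add, hx, hy, add_zero]
  | ι_mul x v hx =>
    change extContr σ.v0 (σ.P (ExteriorAlgebra.ι R v * x)) = 0
    rw [map_mul, P_ι, extContr_ι_mul, hx, σ.v0_p, zero_smul, mul_zero, sub_zero]

/-- The second component of a form with respect to the splitting. -/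
def E' : ExteriorAlgebra R (Fin m → R) →ₗ[R] ExteriorAlgebra R (Fin n → R) :=
  σ.E.toLinearMap.comp (extContr σ.v0)

theorem E'_apply (x) : σ.E' x = σ.E (extContr σ.v0 x) := rfl

theorem E_ι_mul (c x) : σ.E (ExteriorAlgebra.ι R c * x) = ExteriorAlgebra.ι R (σ.q c) * σ.E x := by
  rw [map_mul, E_ι]

theorem E'_ι_mul (c x) : σ.E' (ExteriorAlgebra.ι R c * x)
    = σ.v0 c • σ.E x - ExteriorAlgebra.ι R (σ.q c) * σ.E' x := by
  rw [E'_apply, extContr_ι_mul, map_sub, map_smul, E_ι_mul, E'_apply]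

theorem E_c0 (x) : σ.E (ExteriorAlgebra.ι R σ.c0 * x) = 0 := by
  rw [E_ι_mul, σ.q_c0, map_zero, zero_mul]

theorem E'_c0 (x) : σ.E' (ExteriorAlgebra.ι R σ.c0 * x) = σ.E x := by
  rw [E'_ι_mul, σ.q_c0, map_zero, zero_mul, σ.v0_c0, one_smul, sub_zero]

theorem E'_P (x) : σ.E' (σ.P x) = 0 := by rw [E'_apply, extContr_P, map_zero]

theorem eq_add (x) : x = σ.P (σ.E x) + ExteriorAlgebra.ι R σ.c0 * σ.P (σ.E' x) := by
  induction x using CliffordAlgebra.left_induction with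
  | algebraMap r =>
    have : σ.E' (algebraMap R _ r) = 0 := by rw [E'_apply, extContr_algebraMap, map_zero]
    erw [this, AlgHom.commutes, AlgHom.commutes, map_zero, mul_zero, add_zero]
  | add x y hx hy =>
    conv_lhs => rw [hx, hy]
    simp only [map_add, mul_add]
    abel
  | ι_mul x v hx =>
    change ExteriorAlgebra.ι R v * x = σ.P (σ.E (ExteriorAlgebra.ι R v * x))
      + ExteriorAlgebra.ι R σ.c0 * σ.P (σ.E' (ExteriorAlgebra.ι R v * x))
    rw [E_ι_mul, E'_ι_mul, map_mul, map_sub, map_smul, map_mul, P_ι, mul_sub, mul_smul_comm,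
      ι_mul_ι_mul_comm σ.c0 (σ.p (σ.q v))]
    conv_lhs => rw [σ.decomp v, hx]
    rw [map_add, map_smul, add_mul, mul_add, mul_add, smul_mul_assoc, smul_mul_assoc,
      ι_mul_ι_mul_self, smul_zero]
    abel

theorem E_mem {k : ℕ} {x} (hx : x ∈ ⋀[R]^k (Fin m → R)) : σ.E x ∈ ⋀[R]^k (Fin n → R) :=
  map_mem_exteriorPower _ hx

theorem P_mem {k : ℕ} {x} (hx : x ∈ ⋀[R]^k (Fin n → R)) : σ.P x ∈ ⋀[R]^k (Fin m → R) :=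
  map_mem_exteriorPower _ hx

variable {J : Type} {s : Finset J} {β : J → Fin m → R} {a : J → R} {j0 : J}
  (ε : Module.Dual R (Fin n → R))

/-- The form with components determined by `x` and `y`. -/
def comb (α : R) : (ExteriorAlgebra R (Fin n → R) × ExteriorAlgebra R (Fin n → R)) →ₗ[R]
    ExteriorAlgebra R (Fin m → R) :=
  LinearMap.coprod (α • σ.P.toLinearMap - (LinearMap.mulLeft R (ExteriorAlgebra.ι R σ.c0)).comp
    (σ.P.toLinearMap.comp (extContr ε)))
    ((LinearMap.mulLeft R (ExteriorAlgebra.ι R σ.c0)).comp σ.P.toLinearMap)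

theorem comb_apply (α : R) (x y) : σ.comb ε α (x, y)
    = α • σ.P x + ExteriorAlgebra.ι R σ.c0 * σ.P (y - extContr ε x) := by
  rw [map_sub, mul_sub]
  simp only [comb, LinearMap.coprod_apply, LinearMap.sub_apply, LinearMap.smul_apply,
    LinearMap.comp_apply, LinearMap.mulLeft_apply, AlgHom.toLinearMap_apply]
  abel

theorem E_comb (α : R) (x y) : σ.E (σ.comb ε α (x, y)) = α • x := by
  rw [comb_apply, map_add, map_smul, E_P, E_c0, add_zero]

theorem E'_comb (α : R) (x y) : σ.E' (σ.comb ε α (x, y)) = y - extContr ε x := by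
  rw [comb_apply, map_add, map_smul, E'_P, smul_zero, zero_add, E'_c0, E_P]

theorem exists_smul_iff {b : R} {x : ExteriorAlgebra R (Fin m → R)} :
    (∃ y, x = b • y) ↔ (∃ y, σ.E x = b • y) ∧ ∃ y, σ.E' x = b • y := by
  constructor
  · rintro ⟨y, rfl⟩
    exact ⟨⟨_, map_smul _ _ _⟩, ⟨_, map_smul _ _ _⟩⟩
  · rintro ⟨⟨y, hy⟩, z, hz⟩
    refine ⟨σ.P y + ExteriorAlgebra.ι R σ.c0 * σ.P z, ?_⟩
    rw [σ.eq_add x, hy, hz, map_smul, map_smul, mul_smul_comm, smul_add]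

variable [DecompositionMonoid R]

theorem comb_cond_iff (hε : ∀ j ∈ s, ε (σ.q (β j)) = a j - σ.v0 (β j) * a j0)
    (hco : ∀ j ∈ s, IsRelPrime (a j) (a j0)) {j : J} (hj : j ∈ s) (x y) :
    (∃ z, ExteriorAlgebra.ι R (β j) * σ.comb ε (a j0) (x, y) = a j • z) ↔
      (∃ z, ExteriorAlgebra.ι R (σ.q (β j)) * x = a j • z) ∧
      ∃ z, ExteriorAlgebra.ι R (σ.q (β j)) * y = a j • z := by
  rw [σ.exists_smul_iff, E_ι_mul, E'_ι_mul, E_comb, E'_comb]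
  have key : σ.v0 (β j) • a j0 • x - ExteriorAlgebra.ι R (σ.q (β j)) * (y - extContr ε x)
      = a j • x - ExteriorAlgebra.ι R (σ.q (β j)) * y
        - extContr ε (ExteriorAlgebra.ι R (σ.q (β j)) * x) := by
    rw [extContr_ι_mul, hε j hj, sub_smul, mul_smul, mul_sub]
    abel
  rw [key]
  have h1 : (∃ z, ExteriorAlgebra.ι R (σ.q (β j)) * a j0 • x = a j • z) ↔
      ∃ z, ExteriorAlgebra.ι R (σ.q (β j)) * x = a j • z := by
    rw [mul_smul_comm]
    constructor
    · rintro ⟨z, hz⟩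
      exact exists_smul_of_isRelPrime (hco j hj) hz
    · rintro ⟨z, hz⟩
      exact ⟨a j0 • z, by rw [hz, smul_comm]⟩
  rw [h1]
  refine and_congr_right ?_
  rintro ⟨z, hz⟩
  rw [hz, map_smul]
  constructor
  · rintro ⟨w, hw⟩
    refine ⟨x - extContr ε z - w, ?_⟩
    rw [smul_sub, smul_sub, ← hw]; abel
  · rintro ⟨w, hw⟩
    exact ⟨x - w - extContr ε z, by rw [smul_sub, smul_sub, ← hw]⟩

variable [DecidableEq J]

theorem comb_mem {k : ℕ} (hj0 : β j0 = σ.c0)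
    (hε : ∀ j ∈ s, ε (σ.q (β j)) = a j - σ.v0 (β j) * a j0)
    (hco : ∀ j ∈ s, IsRelPrime (a j) (a j0)) {x y}
    (hx : x ∈ logF s (fun j => σ.q (β j)) a (k + 1)) (hy : y ∈ logF s (fun j => σ.q (β j)) a k) :
    σ.comb ε (a j0) (x, y) ∈ logF (insert j0 s) β a (k + 1) := by
  rw [mem_logF] at hx hy ⊢
  refine ⟨?_, fun j hj => ?_⟩
  · rw [comb_apply]
    exact Submodule.add_mem _ (Submodule.smul_mem _ _ (σ.P_mem hx.1))
      (ι_mul_mem _ (σ.P_mem (Submodule.sub_mem _ hy.1 (extContr_mem _ hx.1))))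
  · rcases Finset.mem_insert.1 hj with rfl | hj
    · refine ⟨ExteriorAlgebra.ι R σ.c0 * σ.P x, ?_⟩
      rw [comb_apply, hj0, mul_add, ι_mul_ι_mul_self, add_zero, mul_smul_comm]
    · exact (σ.comb_cond_iff ε hε hco hj x y).2 ⟨hx.2 j hj, hy.2 j hj⟩

variable [IsDomain R]

/-- Logarithmic forms of an arrangement containing `c0` split into pairs of forms in one
variable less. -/
def logFEquiv {k : ℕ} (hj0 : β j0 = σ.c0) (ha : a j0 ≠ 0)
    (hε : ∀ j ∈ s, ε (σ.q (β j)) = a j - σ.v0 (β j) * a j0)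
    (hco : ∀ j ∈ s, IsRelPrime (a j) (a j0)) :
    (logF s (fun j => σ.q (β j)) a (k + 1) × logF s (fun j => σ.q (β j)) a k) ≃ₗ[R]
      logF (insert j0 s) β a (k + 1) :=
  LinearEquiv.ofBijective
    (LinearMap.codRestrict _ ((σ.comb ε (a j0)).comp
      (LinearMap.prodMap (Submodule.subtype _) (Submodule.subtype _)))
      fun x => σ.comb_mem ε hj0 hε hco x.1.2 x.2.2)
    (by
      constructor
      · rw [← LinearMap.ker_eq_bot, LinearMap.ker_eq_bot']
        rintro ⟨⟨x, hx⟩, ⟨y, hy⟩⟩ h0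
        have h0' : σ.comb ε (a j0) (x, y) = 0 := congrArg Subtype.val h0
        have hx0 : x = 0 := extAlg_smul_eq_zero ha (by rw [← σ.E_comb ε, h0', map_zero])
        subst hx0
        have hy0 : y = 0 := by
          have h1 := σ.E'_comb ε (a j0) 0 y
          rw [h0', map_zero, map_zero, sub_zero] at h1
          exact h1.symm
        subst hy0
        rfl
      · rintro ⟨η, hη⟩
        have hη' := mem_logF.1 hη
        obtain ⟨z, hz⟩ := hη'.2 j0 (Finset.mem_insert_self _ _)
        have hx : σ.E η = a j0 • σ.E' z := by
          rw [← map_smul, ← hz, hj0, E'_c0]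
        have heq : σ.comb ε (a j0) (σ.E' z, σ.E' η + extContr ε (σ.E' z)) = η := by
          rw [comb_apply, add_sub_cancel_right, ← map_smul, ← hx, ← σ.eq_add]
        have hzm : σ.E' z ∈ ⋀[R]^(k + 1) (Fin n → R) :=
          mem_exteriorPower_of_smul_mem ha (hx ▸ σ.E_mem hη'.1)
        have hc : ∀ j ∈ s, _ := fun j hj => (σ.comb_cond_iff ε hε hco hj _ _).1
          (heq.symm ▸ hη'.2 j (Finset.mem_insert_of_mem hj))
        refine ⟨⟨⟨_, mem_logF.2 ⟨hzm, fun j hj => (hc j hj).1⟩⟩,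
          ⟨_, mem_logF.2 ⟨Submodule.add_mem _ (σ.E_mem (extContr_mem _ hη'.1))
            (extContr_mem _ hzm), fun j hj => (hc j hj).2⟩⟩⟩, Subtype.ext heq⟩)

end VecSplit

end SplitForms
section RestrictedForms

/-- The vector of constant polynomials with the given values. -/
def cvec (N : ℕ) {m : ℕ} (c : Fin m → K) : Fin m → PS K N := fun i => C (c i)

theorem cvec_smul (N : ℕ) {m : ℕ} (t : K) (c : Fin m → K) :
    cvec N (t • c) = (C t : PS K N) • cvec N c := by
  funext i; simp [cvec]

/-- A constant functional taking the value `1` at the constant vector of `r ≠ 0`. -/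
def constDual (N : ℕ) {m : ℕ} (r : Fin m → K) : Module.Dual (PS K N) (Fin m → PS K N) :=
  if h : ∃ i, r i ≠ 0 then (C (r h.choose)⁻¹ : PS K N) • LinearMap.proj h.choose else 0

theorem constDual_cvec (N : ℕ) {m : ℕ} {r : Fin m → K} (hr : r ≠ 0) :
    constDual N r (cvec N r) = 1 := by
  have h : ∃ i, r i ≠ 0 := Function.ne_iff.1 hr
  rw [constDual, dif_pos h, LinearMap.smul_apply, LinearMap.proj_apply, cvec, smul_eq_mul, ← C_mul,
    inv_mul_cancel₀ h.choose_spec, C_1]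

theorem Omega_eq_logF (A : Arrangement K ℓ) (m : (Fin ℓ → K) → ℕ) (p : ℕ) :
    Omega A m p = logF A.hyps (cvec ℓ) (fun c => linP c ^ m c) p := by
  ext x
  simp only [Omega, mem_logF, Submodule.mem_inf, Submodule.mem_iInf, Submodule.mem_comap,
    Submodule.mem_map]
  refine and_congr_right fun hx => forall₂_congr fun c hc => ?_
  constructor
  · rintro ⟨y, -, hy⟩
    exact ⟨y, hy.symm⟩
  · rintro ⟨y, hy⟩
    exact ⟨y, mem_exteriorPower_of_smul_mem (pow_ne_zero _ (linP_ne_zero (A.ne_zero c hc)))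
      (hy ▸ ι_mul_mem _ hx), hy.symm⟩

/-- A finite set of pairwise independent forms, none of which is proportional to `c0`. -/
structure OffForms (c0 : Fin ℓ → K) (s : Finset (Fin ℓ → K)) : Prop where
  off : ∀ c ∈ s, ∀ t : K, c ≠ t • c0
  nonprop : ∀ c ∈ s, ∀ c' ∈ s, c ≠ c' → ∀ t : K, c ≠ t • c'

namespace OffForms

variable {c0 : Fin ℓ → K} {s t : Finset (Fin ℓ → K)}

theorem mono (hs : OffForms c0 s) (hts : t ⊆ s) : OffForms c0 t :=
  ⟨fun c hc => hs.off c (hts hc), fun c hc c' hc' => hs.nonprop c (hts hc) c' (hts hc')⟩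

theorem ne_zero (hs : OffForms c0 s) {c} (hc : c ∈ s) : c ≠ 0 := by
  have := hs.off c hc 0
  rwa [zero_smul] at this

theorem linP_ne_zero (hs : OffForms c0 s) : ∀ c ∈ s, linP c ≠ 0 := fun _ hc =>
  _root_.linP_ne_zero (hs.ne_zero hc)

theorem isRelPrime (hs : OffForms c0 s) : ∀ c ∈ s, ∀ c' ∈ s, c ≠ c' →
    IsRelPrime (linP c) (linP c') := fun c hc c' hc' hne =>
  isRelPrime_linP (hs.ne_zero hc) (hs.nonprop c' hc' c hc hne.symm)

theorem isRelPrime_self (hs : OffForms c0 s) (h0 : c0 ≠ 0) : ∀ c ∈ s,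
    IsRelPrime (linP c) (linP c0) := fun c hc => (isRelPrime_linP h0 (hs.off c hc)).symm

theorem erase {A : Arrangement K ℓ} (hc0 : c0 ∈ A.hyps) : OffForms c0 (A.hyps.erase c0) where
  off c hc := A.nonprop c (Finset.mem_of_mem_erase hc) c0 hc0 (Finset.ne_of_mem_erase hc)
  nonprop c hc c' hc' := A.nonprop c (Finset.mem_of_mem_erase hc) c' (Finset.mem_of_mem_erase hc')

theorem restrictForm_ne_zero (hs : OffForms c0 s) {e : (Fin (ℓ - 1) → K) →ₗ[K] (Fin ℓ → K)}
    (h : HypSplit c0 e) {c} (hc : c ∈ s) : restrictForm e c ≠ 0 := fun h0 =>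
  hs.off c hc (dotProduct c h.v1) (by conv_lhs => rw [h.decomp c, h0]; simp)

theorem constDual_cvec (hs : OffForms c0 s) {e : (Fin (ℓ - 1) → K) →ₗ[K] (Fin ℓ → K)}
    (h : HypSplit c0 e) (N : ℕ) : ∀ c ∈ s,
    constDual N (restrictForm e c) (cvec N (restrictForm e c)) = 1 := fun _ hc =>
  _root_.constDual_cvec N (hs.restrictForm_ne_zero h hc)

end OffForms

/-- Forms in one variable less, logarithmic along the forms in `s` with constant directions
restricted along `e`. -/
abbrev MF (e : (Fin (ℓ - 1) → K) →ₗ[K] (Fin ℓ → K)) (s : Finset (Fin ℓ → K)) (p : ℕ) :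
    Submodule (PS K ℓ) (ExteriorAlgebra (PS K ℓ) (Fin (ℓ - 1) → PS K ℓ)) :=
  logF s (fun c => cvec ℓ (restrictForm e c)) linP p

variable {c0 : Fin ℓ → K} {e : (Fin (ℓ - 1) → K) →ₗ[K] (Fin ℓ → K)} (h : HypSplit c0 e)

/-- The splitting of constant one-forms extended to polynomial one-forms. -/
def HypSplit.vecSplit : VecSplit (PS K ℓ) ℓ (ℓ - 1) where
  p := Matrix.vecMulLinear (Matrix.of fun i => cvec ℓ (h.row i))
  q := Matrix.vecMulLinear (Matrix.of fun j => cvec ℓ fun i => e (Pi.single i 1) j)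
  c0 := cvec ℓ c0
  v0 := ∑ j, (C (h.v1 j) : PS K ℓ) • LinearMap.proj j
  q_p v := by
    have hm : (Matrix.of fun i => cvec ℓ (h.row i)) *
        (Matrix.of fun j => cvec ℓ fun i => e (Pi.single i 1) j) = (1 : Matrix _ _ (PS K ℓ)) := by
      ext1 i k
      have := congrFun (h.restrict_row i) k
      rw [Matrix.mul_apply, Matrix.one_apply]
      simp only [Matrix.of_apply, cvec, ← C_mul, ← map_sum]
      change C (restrictForm e (h.row i) k) = _
      rw [this, Pi.single_apply]
      by_cases hik : i = k
      · rw [if_pos hik, if_pos hik.symm, C_1]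
      · rw [if_neg hik, if_neg (Ne.symm hik), C_0]
    simp only [Matrix.vecMulLinear_apply, Matrix.vecMul_vecMul, hm, Matrix.vecMul_one]
  q_c0 := by
    funext i
    have := congrFun h.restrict_self i
    simp only [Matrix.vecMulLinear_apply, Matrix.vecMul, dotProduct, Matrix.of_apply, cvec,
      ← C_mul, ← map_sum]
    exact (congrArg C this).trans C_0
  v0_c0 := by
    simp only [LinearMap.sum_apply, LinearMap.smul_apply, LinearMap.proj_apply, cvec, smul_eq_mul,
      ← C_mul, ← map_sum]
    rw [← C_1, ← h.dot_v1, dotProduct]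
    simp only [mul_comm]
  v0_p v := by
    simp only [LinearMap.sum_apply, LinearMap.smul_apply, LinearMap.proj_apply, smul_eq_mul,
      Matrix.vecMulLinear_apply, Matrix.vecMul, dotProduct, Matrix.of_apply, cvec, Finset.mul_sum]
    rw [Finset.sum_comm]
    refine Finset.sum_eq_zero fun i _ => ?_
    have := h.row_v1 i
    rw [← mul_zero (v i), ← C_0, ← this, dotProduct, map_sum, Finset.mul_sum]
    refine Finset.sum_congr rfl fun j _ => ?_
    rw [C_mul]; ring
  decomp v := by
    funext k
    have hk : ∀ j, (Pi.single j (1 : K) : Fin ℓ → K) k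
        = ∑ i, e (Pi.single i 1) j * h.row i k + h.v1 j * c0 k := fun j => by
      have := congrFun (h.decomp (Pi.single j 1)) k
      simpa [restrictForm_apply] using this
    have hv : v k = ∑ j, v j * C ((Pi.single j (1 : K) : Fin ℓ → K) k) := by
      rw [Finset.sum_eq_single k]
      · simp
      · intro b _ hb; simp [Pi.single_eq_of_ne hb.symm]
      · simp
    rw [hv]
    simp only [hk, Pi.add_apply, Pi.smul_apply, LinearMap.sum_apply, LinearMap.smul_apply,
      LinearMap.proj_apply, smul_eq_mul, Matrix.vecMulLinear_apply, Matrix.vecMul, dotProduct,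
      Matrix.of_apply, cvec, map_add, map_sum, C_mul, mul_add, Finset.sum_add_distrib,
      Finset.mul_sum, Finset.sum_mul]
    congr 1
    · rw [Finset.sum_comm]
      simp only [mul_assoc]
    · exact Finset.sum_congr rfl fun j _ => by ring

theorem HypSplit.vecSplit_q (c : Fin ℓ → K) :
    h.vecSplit.q (cvec ℓ c) = cvec ℓ (restrictForm e c) := by
  funext i
  simp [HypSplit.vecSplit, Matrix.vecMul, dotProduct, cvec, restrictForm]

theorem HypSplit.vecSplit_v0 (c : Fin ℓ → K) :
    h.vecSplit.v0 (cvec ℓ c) = C (dotProduct c h.v1) := by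
  simp [HypSplit.vecSplit, dotProduct, cvec, mul_comm]

/-- The functional given by the Euler field of the hyperplane. -/
def HypSplit.euler : Module.Dual (PS K ℓ) (Fin (ℓ - 1) → PS K ℓ) :=
  ∑ i, linP (h.row i) • LinearMap.proj i

theorem HypSplit.euler_cvec (c : Fin ℓ → K) : h.euler (cvec ℓ (restrictForm e c))
    = linP c - C (dotProduct c h.v1) * linP c0 := by
  rw [eq_sub_iff_add_eq]
  conv_rhs => rw [h.decomp c, linP_add, linP_smul, linP_sum]
  simp [HypSplit.euler, linP_smul, cvec, mul_comm]

include h in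
theorem nonempty_equiv_Omega {A : Arrangement K ℓ} (hc0 : c0 ∈ A.hyps) (k : ℕ) :
    Nonempty ((MF e (A.hyps.erase c0) (k + 1) × MF e (A.hyps.erase c0) k) ≃ₗ[PS K ℓ]
      Omega A (fun _ => 1) (k + 1)) := by
  have hs := OffForms.erase hc0
  have E := h.vecSplit.logFEquiv (s := A.hyps.erase c0) (β := cvec ℓ) (a := linP) (j0 := c0) (k := k)
    h.euler rfl (linP_ne_zero h.ne_zero)
    (fun c _ => by rw [h.vecSplit_q, h.euler_cvec, h.vecSplit_v0])
    (hs.isRelPrime_self h.ne_zero)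
  have hO : Omega A (fun _ => 1) (k + 1) = logF (insert c0 (A.hyps.erase c0)) (cvec ℓ) linP (k + 1) := by
    rw [Omega_eq_logF, Finset.insert_erase hc0]
    simp only [pow_one]
  rw [hO]
  have hq : (fun c => h.vecSplit.q (cvec ℓ c)) = fun c => cvec ℓ (restrictForm e c) :=
    funext h.vecSplit_q
  rw [hq] at E
  exact ⟨E⟩

end RestrictedForms
section Reduction

theorem piMap_cvec (e : (Fin (ℓ - 1) → K) →ₗ[K] (Fin ℓ → K)) {m : ℕ} (r : Fin m → K) :
    piMap (resH e) (Fin m) (cvec ℓ r) = cvec (ℓ - 1) r := by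
  funext i
  exact resH_C e (r i)

/-- Two forms restrict to proportional forms. -/
def Par (e : (Fin (ℓ - 1) → K) →ₗ[K] (Fin ℓ → K)) (c c' : Fin ℓ → K) : Prop :=
  ∃ t : K, t ≠ 0 ∧ restrictForm e c = t • restrictForm e c'

namespace Par

variable {e : (Fin (ℓ - 1) → K) →ₗ[K] (Fin ℓ → K)} {c c' c'' : Fin ℓ → K}

theorem refl (c : Fin ℓ → K) : Par e c c := ⟨1, one_ne_zero, (one_smul _ _).symm⟩

theorem symm (h : Par e c c') : Par e c' c := by
  obtain ⟨t, ht, h⟩ := h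
  exact ⟨t⁻¹, inv_ne_zero ht, by rw [h, smul_smul, inv_mul_cancel₀ ht, one_smul]⟩

theorem trans (h : Par e c c') (h' : Par e c' c'') : Par e c c'' := by
  obtain ⟨t, ht, h⟩ := h
  obtain ⟨u, hu, h'⟩ := h'
  exact ⟨t * u, mul_ne_zero ht hu, by rw [h, h', smul_smul]⟩

end Par

/-- The forms in `s` with restriction proportional to that of `c`. -/
def parClass (e : (Fin (ℓ - 1) → K) →ₗ[K] (Fin ℓ → K)) (s : Finset (Fin ℓ → K)) (c : Fin ℓ → K) :
    Finset (Fin ℓ → K) := s.filter fun c' => Par e c' c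

theorem mem_parClass {e : (Fin (ℓ - 1) → K) →ₗ[K] (Fin ℓ → K)} {s : Finset (Fin ℓ → K)}
    {c c' : Fin ℓ → K} : c' ∈ parClass e s c ↔ c' ∈ s ∧ Par e c' c := Finset.mem_filter

/-- The product of the restrictions of the forms in `parClass e s c`. -/
def parProd (e : (Fin (ℓ - 1) → K) →ₗ[K] (Fin ℓ → K)) (s : Finset (Fin ℓ → K)) (c : Fin ℓ → K) :
    PS K (ℓ - 1) := ∏ c' ∈ parClass e s c, linP (restrictForm e c')

/-- The logarithmic forms of the Ziegler restriction. -/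
abbrev NF (e : (Fin (ℓ - 1) → K) →ₗ[K] (Fin ℓ → K)) (s : Finset (Fin ℓ → K)) (p : ℕ) :
    Submodule (PS K (ℓ - 1)) (ExteriorAlgebra (PS K (ℓ - 1)) (Fin (ℓ - 1) → PS K (ℓ - 1))) :=
  logF s (fun c => cvec (ℓ - 1) (restrictForm e c)) (parProd e s) p

variable {c0 : Fin ℓ → K} {e : (Fin (ℓ - 1) → K) →ₗ[K] (Fin ℓ → K)} {s : Finset (Fin ℓ → K)} {p : ℕ}

theorem exists_parClass_smul (hs : OffForms c0 s)
    {x : ExteriorAlgebra (PS K ℓ) (Fin (ℓ - 1) → PS K ℓ)} (hx : x ∈ MF e s p) (c : Fin ℓ → K) :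
    ∃ y, ExteriorAlgebra.ι _ (cvec ℓ (restrictForm e c)) * x = (∏ j ∈ parClass e s c, linP j) • y := by
  refine exists_prod_smul (parClass e s c) linP
    (hs.mono (Finset.filter_subset _ _)).isRelPrime fun c' hc' => ?_
  rw [mem_parClass] at hc'
  obtain ⟨y, hy⟩ := (mem_logF.1 hx).2 c' hc'.1
  obtain ⟨t, -, ht⟩ := hc'.2.symm
  refine ⟨(C t : PS K ℓ) • y, ?_⟩
  rw [ht, cvec_smul, map_smul, smul_mul_assoc, hy, smul_comm]

theorem extBC_mem_NF (hs : OffForms c0 s)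
    {x : ExteriorAlgebra (PS K ℓ) (Fin (ℓ - 1) → PS K ℓ)} (hx : x ∈ MF e s p) :
    extBC (resH e) (ℓ - 1) x ∈ NF e s p := by
  refine mem_logF.2 ⟨extBC_mem (mem_logF.1 hx).1, fun c hc => ?_⟩
  obtain ⟨y, hy⟩ := exists_parClass_smul hs hx c
  refine ⟨extBC (resH e) (ℓ - 1) y, ?_⟩
  rw [← piMap_cvec, ← extBC_ι, ← map_mul, hy, extBC_smul, map_prod]
  simp only [resH_linP, parProd]

variable (h : HypSplit c0 e)

/-- The image of `MF e s p` under restriction to the hyperplane. -/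
def HypSplit.MFbar (s : Finset (Fin ℓ → K)) (p : ℕ) :
    Submodule (PS K (ℓ - 1)) (ExteriorAlgebra (PS K (ℓ - 1)) (Fin (ℓ - 1) → PS K (ℓ - 1))) where
  carrier := extBC (resH e) (ℓ - 1) '' (MF e s p : Set _)
  add_mem' := by
    rintro _ _ ⟨x, hx, rfl⟩ ⟨y, hy, rfl⟩
    exact ⟨x + y, Submodule.add_mem _ hx hy, map_add _ _ _⟩
  zero_mem' := ⟨0, Submodule.zero_mem _, map_zero _⟩
  smul_mem' := by
    rintro r _ ⟨x, hx, rfl⟩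
    obtain ⟨r, rfl⟩ := h.resH_surjective r
    exact ⟨r • x, Submodule.smul_mem _ _ hx, extBC_smul _ _⟩

theorem HypSplit.mem_MFbar {y} : y ∈ h.MFbar s p ↔ ∃ x ∈ MF e s p, extBC (resH e) (ℓ - 1) x = y :=
  Iff.rfl

theorem HypSplit.MFbar_le (hs : OffForms c0 s) : h.MFbar s p ≤ NF e s p := by
  rintro _ ⟨x, hx, rfl⟩
  exact extBC_mem_NF hs hx

/-- The reduction map. -/
def HypSplit.redHom (s : Finset (Fin ℓ → K)) (p : ℕ) : MF e s p →+ h.MFbar s p where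
  toFun x := ⟨_, x, x.2, rfl⟩
  map_zero' := Subtype.ext (map_zero _)
  map_add' _ _ := Subtype.ext (map_add _ _ _)

theorem HypSplit.redHom_smul (r : PS K ℓ) (x : MF e s p) :
    h.redHom s p (r • x) = resH e r • h.redHom s p x :=
  Subtype.ext (extBC_smul _ _)

theorem HypSplit.redHom_surjective : Function.Surjective (h.redHom s p) := by
  rintro ⟨_, x, hx, rfl⟩
  exact ⟨⟨x, hx⟩, rfl⟩

theorem HypSplit.exists_of_redHom_eq_zero (hs : OffForms c0 s) (x : MF e s p)
    (hx : h.redHom s p x = 0) : ∃ y, x = linP c0 • y := by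
  obtain ⟨y, hy⟩ := exists_eq_smul_of_extBC_eq_zero (a := linP c0)
    (fun _ => h.exists_of_resH_eq_zero) (congrArg Subtype.val hx)
  have hx' := mem_logF.1 x.2
  refine ⟨⟨y, mem_logF.2 ⟨mem_exteriorPower_of_smul_mem (linP_ne_zero h.ne_zero) (hy ▸ hx'.1),
    fun c hc => ?_⟩⟩, Subtype.ext hy⟩
  obtain ⟨z, hz⟩ := hx'.2 c hc
  rw [hy, mul_smul_comm] at hz
  exact exists_smul_of_isRelPrime (hs.isRelPrime_self h.ne_zero c hc) hz

theorem HypSplit.pdLE_MFbar (hs : OffForms c0 s) {k : ℕ} (hk : pdLE (PS K ℓ) k (MF e s p)) :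
    pdLE (PS K (ℓ - 1)) k (h.MFbar s p) := by
  refine pdLE_reduction (resH e) h.resH_surjective (linP c0) h.resH_self
    (fun _ => h.exists_of_resH_eq_zero) ?_ k _ _ (h.redHom s p) h.redHom_smul h.redHom_surjective
    (h.exists_of_redHom_eq_zero hs) ?_ hk
  · exact (IsRegular.of_ne_zero (linP_ne_zero h.ne_zero)).left.isSMulRegular
  · intro x y hxy
    refine sub_eq_zero.1 (Subtype.ext (extAlg_smul_eq_zero (linP_ne_zero h.ne_zero) ?_))
    exact congrArg Subtype.val ((smul_sub _ _ _).trans (sub_eq_zero.2 hxy))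

theorem linP_dvd_homogeneousComponent {c : Fin ℓ → K} {w : PS K ℓ} (hw : linP c ∣ w) (k : ℕ) :
    linP c ∣ homogeneousComponent k w := by
  obtain ⟨y, rfl⟩ := hw
  rw [mul_comm, homogeneousComponent_mul_of_isHomogeneous (isHomogeneous_linP c)]
  exact dvd_mul_left _ _

theorem vecComp_mem_vecLog (w) (hw : w ∈ vecLog s (fun c => cvec ℓ (restrictForm e c)) linP) (k : ℕ) :
    vecComp 0 k w ∈ vecLog s (fun c => cvec ℓ (restrictForm e c)) linP := by
  rw [mem_vecLog] at hw ⊢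
  intro c hc i j
  have := linP_dvd_homogeneousComponent (hw c hc i j) k
  simpa [vecComp, cvec, homogeneousComponent_C_mul] using this

/-- The reduction map on vectors. -/
def HypSplit.vecRedHom (hs : OffForms c0 s) :
    vecLog s (fun c => cvec ℓ (restrictForm e c)) linP →+ h.MFbar s 1 :=
  (h.redHom s 1).comp (vecLogEquiv (hs.constDual_cvec h ℓ)).toLinearMap.toAddMonoidHom

theorem HypSplit.vecRedHom_smul (hs : OffForms c0 s) (r : PS K ℓ)
    (x : vecLog s (fun c => cvec ℓ (restrictForm e c)) linP) :
    h.vecRedHom hs (r • x) = resH e r • h.vecRedHom hs x :=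
  (congrArg (h.redHom s 1) (map_smul (vecLogEquiv (hs.constDual_cvec h ℓ)) r x)).trans
    (h.redHom_smul _ _)

theorem HypSplit.vecRedHom_surjective (hs : OffForms c0 s) :
    Function.Surjective (h.vecRedHom hs) :=
  h.redHom_surjective.comp (vecLogEquiv (hs.constDual_cvec h ℓ)).surjective

theorem HypSplit.exists_of_vecRedHom_eq_zero (hs : OffForms c0 s)
    (x : vecLog s (fun c => cvec ℓ (restrictForm e c)) linP) (hx : h.vecRedHom hs x = 0) :
    ∃ y, x = linP c0 • y := by
  obtain ⟨y, hy⟩ := h.exists_of_redHom_eq_zero hs _ hx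
  refine ⟨(vecLogEquiv (hs.constDual_cvec h ℓ)).symm y, ?_⟩
  rw [← map_smul, ← hy]
  exact ((vecLogEquiv (hs.constDual_cvec h ℓ)).symm_apply_apply x).symm

theorem constantCoeff_resH (r : PS K ℓ) (hr : constantCoeff r = 0) :
    resH e r ∈ RingHom.ker (constantCoeff (R := K) (σ := Fin (ℓ - 1))) := by
  have : (constantCoeff (R := K) (σ := Fin (ℓ - 1))).comp (resH e) = constantCoeff := by
    apply MvPolynomial.ringHom_ext
    · intro r; simp [resH]
    · intro i; simp [resH, constantCoeff_linP]
  rw [RingHom.mem_ker, ← hr]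
  exact RingHom.congr_fun this r

include h in
/-- A subarrangement whose logarithmic one-forms restrict to a projective module is free. -/
theorem HypSplit.exists_basis (hs : OffForms c0 s) (hN : pdLE (PS K (ℓ - 1)) 0 (h.MFbar s 1)) :
    ∃ (N : ℕ) (π : (Fin N → PS K ℓ) →ₗ[PS K ℓ] (Fin (ℓ - 1) → PS K ℓ)), Function.Injective π ∧
      LinearMap.range π = vecLog s (fun c => cvec ℓ (restrictForm e c)) linP := by
  have : Module.Projective (PS K (ℓ - 1)) (h.MFbar s 1) := hN
  obtain ⟨r, ⟨E⟩⟩ := exists_equiv_of_projective_reduction (RingHom.ker_ne_top _) (resH e)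
    h.resH_surjective constantCoeff_resH (linP_ne_zero h.ne_zero) (constantCoeff_linP c0)
    h.resH_self (fun _ => h.exists_of_resH_eq_zero) 0 _ vecComp_mem_vecLog (h.vecRedHom hs)
    (h.vecRedHom_smul hs) (h.vecRedHom_surjective hs) (h.exists_of_vecRedHom_eq_zero hs)
  refine ⟨r, (Submodule.subtype _).comp E.toLinearMap, ?_, ?_⟩
  · exact Subtype.val_injective.comp E.injective
  · rw [LinearMap.range_comp, LinearEquiv.range, Submodule.map_top, Submodule.range_subtype]

include h in
theorem HypSplit.exists_presentation (hs : OffForms c0 s)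
    (hN : pdLE (PS K (ℓ - 1)) 1 (h.MFbar s 1)) :
    ∃ (N r : ℕ) (π : (Fin N → PS K ℓ) →ₗ[PS K ℓ] (Fin (ℓ - 1) → PS K ℓ))
      (g : (Fin r → PS K ℓ) →ₗ[PS K ℓ] (Fin N → PS K ℓ)),
      LinearMap.range π = vecLog s (fun c => cvec ℓ (restrictForm e c)) linP ∧
      Function.Injective g ∧ LinearMap.range g = LinearMap.ker π :=
  exists_presentation_of_pdLE_reduction (RingHom.ker_ne_top _) (resH e)
    h.resH_surjective constantCoeff_resH (linP_ne_zero h.ne_zero) (constantCoeff_linP c0)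
    h.resH_self (fun _ => h.exists_of_resH_eq_zero) 0 _ vecComp_mem_vecLog hN (h.vecRedHom hs)
    (h.vecRedHom_smul hs) (h.vecRedHom_surjective hs) (h.exists_of_vecRedHom_eq_zero hs)

end Reduction
section LocalSurjectivity

variable {c0 : Fin ℓ → K} {e : (Fin (ℓ - 1) → K) →ₗ[K] (Fin ℓ → K)} {s : Finset (Fin ℓ → K)} {p : ℕ}

theorem constDual_piMap {m : ℕ} (r : Fin m → K) (v : Fin m → PS K ℓ) :
    constDual (ℓ - 1) r (piMap (resH e) (Fin m) v) = resH e (constDual ℓ r v) := by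
  unfold constDual
  split_ifs with hr
  · simp only [LinearMap.smul_apply, LinearMap.proj_apply, smul_eq_mul, map_mul, resH_C]
    rfl
  · simp only [LinearMap.zero_apply, map_zero]

theorem parProd_ne_zero (h : HypSplit c0 e) (hs : OffForms c0 s) (c : Fin ℓ → K) :
    parProd e s c ≠ 0 :=
  Finset.prod_ne_zero_iff.2 fun _ hc =>
    linP_ne_zero (hs.restrictForm_ne_zero h (mem_parClass.1 hc).1)

theorem parClass_eq_iff {c c' : Fin ℓ → K} (hc' : c' ∈ s) :
    parClass e s c' = parClass e s c ↔ Par e c' c := by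
  constructor
  · intro hcc
    exact (mem_parClass.1 (hcc ▸ mem_parClass.2 ⟨hc', Par.refl c'⟩)).2
  · intro hcc
    ext d
    rw [mem_parClass, mem_parClass]
    exact and_congr_right fun _ => ⟨fun hd => hd.trans hcc, fun hd => hd.trans hcc.symm⟩

theorem isRelPrime_parProd (h : HypSplit c0 e) (hs : OffForms c0 s) {c c' : Fin ℓ → K}
    (hn : ¬ Par e c c') : IsRelPrime (parProd e s c) (parProd e s c') := by
  refine IsRelPrime.prod_left fun d hd => IsRelPrime.prod_right fun d' hd' => ?_
  rw [mem_parClass] at hd hd'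
  have hd0 := hs.restrictForm_ne_zero h hd.1
  have hd0' := hs.restrictForm_ne_zero h hd'.1
  refine isRelPrime_linP hd0 fun t ht => hn ?_
  have ht0 : t ≠ 0 := by
    rintro rfl
    exact hd0' (by rw [ht, zero_smul])
  exact (hd.2.symm.trans (Par.symm ⟨t, ht0, ht⟩)).trans hd'.2

theorem prod_dvd_of_parProd_dvd (h : HypSplit c0 e) (hs : OffForms c0 s) {t : PS K (ℓ - 1)}
    (ht : ∀ c ∈ s, parProd e s c ∣ t) : ∏ c ∈ s, linP (restrictForm e c) ∣ t := by
  have hfib := Finset.prod_fiberwise_of_maps_to (s := s) (t := s.image (parClass e s))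
    (g := parClass e s) (fun c hc => Finset.mem_image_of_mem _ hc)
    (fun c => linP (restrictForm e c))
  rw [← hfib]
  have hP : ∀ c ∈ s, ∏ c' ∈ s with parClass e s c' = parClass e s c, linP (restrictForm e c')
      = parProd e s c := fun c _ => by
    refine Finset.prod_congr (Finset.ext fun d => ?_) fun _ _ => rfl
    rw [mem_parClass, Finset.mem_filter]
    exact and_congr_right fun hd => parClass_eq_iff hd
  refine Finset.prod_dvd_of_isRelPrime ?_ ?_
  · intro y hy y' hy' hne
    obtain ⟨c, hc, rfl⟩ := Finset.mem_image.1 hy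
    obtain ⟨c', hc', rfl⟩ := Finset.mem_image.1 hy'
    change IsRelPrime (∏ _ ∈ _, _) (∏ _ ∈ _, _)
    rw [hP c hc, hP c' hc']
    exact isRelPrime_parProd h hs fun hcc => hne ((parClass_eq_iff hc).2 hcc)
  · intro y hy
    obtain ⟨c, hc, rfl⟩ := Finset.mem_image.1 hy
    rw [hP c hc]
    exact ht c hc

/-- The product of the forms in `s` whose restriction is not proportional to that of `c`. -/
def coProd (e : (Fin (ℓ - 1) → K) →ₗ[K] (Fin ℓ → K)) (s : Finset (Fin ℓ → K)) (c : Fin ℓ → K) :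
    PS K ℓ := ∏ c' ∈ s \ parClass e s c, linP c'

theorem resH_coProd_mul_parProd (c : Fin ℓ → K) :
    resH e (coProd e s c) * parProd e s c = ∏ c ∈ s, linP (restrictForm e c) := by
  rw [coProd, map_prod, parProd]
  simp only [resH_linP]
  exact Finset.prod_sdiff (Finset.filter_subset _ _)

theorem HypSplit.coProd_smul_mem (h : HypSplit c0 e) (hs : OffForms c0 s) {c : Fin ℓ → K}
    (hc : c ∈ s) {z} (hz : z ∈ NF e s p) : resH e (coProd e s c) • z ∈ h.MFbar s p := by
  obtain ⟨hz, hz'⟩ := mem_logF.1 hz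
  obtain ⟨ξ, hξ⟩ := hz' c hc
  set β := cvec ℓ (restrictForm e c) with hβ
  set v := constDual ℓ (restrictForm e c) with hv
  have hvβ : v β = 1 := hs.constDual_cvec h ℓ c hc
  obtain ⟨n, hn, rfl⟩ := exists_extBC_eq h.resH_surjective hz
  have hξm : ξ ∈ ⋀[PS K (ℓ - 1)]^(p + 1) (Fin (ℓ - 1) → PS K (ℓ - 1)) :=
    mem_exteriorPower_of_smul_mem (parProd_ne_zero h hs c) (hξ ▸ ι_mul_mem _ hz)
  obtain ⟨η, hη, hηe⟩ := exists_extBC_eq h.resH_surjective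
    (extContr_mem (constDual (ℓ - 1) (restrictForm e c)) hξm)
  have hw := eq_ι_mul_add_extContr v hvβ n
  refine h.mem_MFbar.2 ⟨coProd e s c • (ExteriorAlgebra.ι _ β * extContr v n +
    (∏ c' ∈ parClass e s c, linP c') • η), mem_logF.2 ⟨?_, fun d hd => ?_⟩, ?_⟩
  · rw [eq_sub_of_add_eq hw.symm]
    exact Submodule.smul_mem _ _ (add_mem (sub_mem hn (extContr_mem v (ι_mul_mem β hn)))
      (Submodule.smul_mem _ _ hη))
  · by_cases hdc : d ∈ parClass e s c
    · obtain ⟨t, -, ht⟩ := (mem_parClass.1 hdc).2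
      obtain ⟨q, hq⟩ := Finset.dvd_prod_of_mem (fun c => linP c) hdc
      refine ⟨(coProd e s c * (C t * q)) • (ExteriorAlgebra.ι _ β * η), ?_⟩
      rw [ht, cvec_smul, map_smul, ← hβ, mul_smul_comm, mul_add, smul_mul_assoc,
        ι_mul_ι_mul_self, smul_zero, zero_add, smul_mul_assoc, mul_smul_comm, hq]
      simp only [smul_smul]
      congr 1
      ring
    · obtain ⟨q, hq⟩ := Finset.dvd_prod_of_mem (fun c => linP c) (Finset.mem_sdiff.2 ⟨hd, hdc⟩)
      refine ⟨q • (ExteriorAlgebra.ι _ (cvec ℓ (restrictForm e d)) *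
        (ExteriorAlgebra.ι _ β * extContr v n + (∏ c' ∈ parClass e s c, linP c') • η)), ?_⟩
      rw [mul_smul_comm, smul_smul, coProd, hq]
  · rw [extBC_smul, eq_sub_of_add_eq hw.symm, map_add, map_sub, extBC_smul, hηe,
      extBC_extContr v _ (constDual_piMap _), map_mul, extBC_ι, hβ, piMap_cvec, hξ, map_smul,
      map_prod]
    simp only [resH_linP]
    rw [← parProd, sub_add_cancel]

theorem HypSplit.MFbar_eq_of_projective (h : HypSplit c0 e) (hs : OffForms c0 s)
    (hp : Module.Projective (PS K (ℓ - 1)) (h.MFbar s p)) : h.MFbar s p = NF e s p := by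
  refine le_antisymm (h.MFbar_le hs) fun z hz => ?_
  have hq : ∏ c ∈ s, linP (restrictForm e c) ≠ 0 :=
    Finset.prod_ne_zero_iff.2 fun c hc => linP_ne_zero (hs.restrictForm_ne_zero h hc)
  refine mem_of_projective (h.MFbar s p) hq (fun z => extAlg_smul_eq_zero hq) ?_
    {a | ∃ c ∈ s, a = resH e (coProd e s c)} ?_ ?_
  · obtain ⟨n, hn, rfl⟩ := exists_extBC_eq h.resH_surjective (mem_logF.1 hz).1
    refine h.mem_MFbar.2 ⟨(∏ c ∈ s, linP c) • n, smul_mem_logF (s := ∅)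
      (fun c hc _ => Finset.dvd_prod_of_mem (fun c => linP c) hc)
      (mem_logF.2 ⟨hn, fun c hc => absurd hc (Finset.notMem_empty c)⟩), ?_⟩
    rw [extBC_smul, map_prod]
    simp only [resH_linP]
  · rintro _ ⟨c, hc, rfl⟩
    exact h.coProd_smul_mem hs hc hz
  · intro t ht
    refine prod_dvd_of_parProd_dvd h hs fun c hc => ?_
    have hd := ht _ ⟨c, hc, rfl⟩
    rw [← resH_coProd_mul_parProd (e := e) (s := s) c] at hd hq
    exact (mul_dvd_mul_iff_left (left_ne_zero_of_mul hq)).1 hd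

theorem pdLE_MF_one_of_Omega (h : HypSplit c0 e) {A : Arrangement K ℓ} (hc0 : c0 ∈ A.hyps) {k : ℕ}
    (hk : pdLE (PS K ℓ) k (Omega A (fun _ => 1) 1)) :
    pdLE (PS K ℓ) k (MF e (A.hyps.erase c0) 1) := by
  obtain ⟨E⟩ := nonempty_equiv_Omega h hc0 0
  exact pdLE_of_retract (E.toLinearMap.comp (LinearMap.inl _ _ _))
    ((LinearMap.fst _ _ _).comp E.symm.toLinearMap)
    (fun x => congrArg Prod.fst (E.symm_apply_apply (x, 0))) hk

theorem pdLE_MF_one_of_mem_pointFlats (h : HypSplit c0 e) {A : Arrangement K ℓ}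
    (hc0 : c0 ∈ A.hyps) (hlf : LocallyFreeAlong A (fun _ => 1) c0) {t : Finset (Fin ℓ → K)}
    (ht : t ∈ pointFlats (A.hyps.erase c0) c0) : pdLE (PS K ℓ) 0 (MF e t 1) := by
  obtain ⟨x, hx0, hx, rfl⟩ := ht
  have hfree : Module.Free _ _ := hlf x hx0 hx
  have := pdLE_MF_one_of_Omega h (A := locArr A x) (k := 0) (Finset.mem_filter.2 ⟨hc0, hx⟩)
    (Module.Projective.of_free (P := Omega (locArr A x) (fun _ => 1) 1))
  have hE : (locArr A x).hyps.erase c0 = (A.hyps.erase c0).filter fun c => dotProduct c x = 0 :=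
    (Finset.filter_erase _ _ _).symm
  rwa [hE] at this

theorem subset_of_mem_pointFlats {t : Finset (Fin ℓ → K)} (ht : t ∈ pointFlats s c0) : t ⊆ s := by
  obtain ⟨x, -, -, rfl⟩ := ht
  exact Finset.filter_subset _ _

theorem HypSplit.exists_basis_of_mem_pointFlats (h : HypSplit c0 e) {A : Arrangement K ℓ}
    (hc0 : c0 ∈ A.hyps) (hlf : LocallyFreeAlong A (fun _ => 1) c0) {t : Finset (Fin ℓ → K)}
    (ht : t ∈ pointFlats (A.hyps.erase c0) c0) :
    ∃ (N : ℕ) (π : (Fin N → PS K ℓ) →ₗ[PS K ℓ] (Fin (ℓ - 1) → PS K ℓ)), Function.Injective π ∧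
      LinearMap.range π = vecLog t (fun c => cvec ℓ (restrictForm e c)) linP := by
  have hs := (OffForms.erase hc0).mono (subset_of_mem_pointFlats ht)
  exact h.exists_basis hs (h.pdLE_MFbar hs (pdLE_MF_one_of_mem_pointFlats h hc0 hlf ht))

theorem HypSplit.MFbar_eq_of_mem_pointFlats (h : HypSplit c0 e) {A : Arrangement K ℓ}
    (hc0 : c0 ∈ A.hyps) (hlf : LocallyFreeAlong A (fun _ => 1) c0) {t : Finset (Fin ℓ → K)}
    (ht : t ∈ pointFlats (A.hyps.erase c0) c0) (p : ℕ) : h.MFbar t p = NF e t p := by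
  have hs := (OffForms.erase hc0).mono (subset_of_mem_pointFlats ht)
  obtain ⟨N, π, hπi, hπ⟩ := h.exists_basis_of_mem_pointFlats hc0 hlf ht
  exact h.MFbar_eq_of_projective hs (h.pdLE_MFbar (k := 0) hs (projective_logF_of_free
    hs.linP_ne_zero hs.isRelPrime (hs.constDual_cvec h ℓ) π hπi hπ p))

theorem NF_mono {t : Finset (Fin ℓ → K)} (hts : t ⊆ s) : NF e s p ≤ NF e t p := fun z hz => by
  refine mem_logF.2 ⟨(mem_logF.1 hz).1, fun c hc => ?_⟩
  obtain ⟨y, hy⟩ := (mem_logF.1 hz).2 c (hts hc)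
  obtain ⟨q, hq⟩ : parProd e t c ∣ parProd e s c :=
    Finset.prod_dvd_prod_of_subset _ _ _ (Finset.filter_subset_filter _ hts)
  exact ⟨q • y, by rw [hy, hq, mul_smul]⟩

/-- The reduction map to the logarithmic forms of the Ziegler restriction is surjective up to
the ideal of nonzero points. -/
theorem HypSplit.smul_mem_MFbar (h : HypSplit c0 e) {A : Arrangement K ℓ}
    (hc0 : c0 ∈ A.hyps) (hlf : LocallyFreeAlong A (fun _ => 1) c0) {f : PS K ℓ}
    (hf : f ∈ pointIdeal (A.hyps.erase c0) c0) {z} (hz : z ∈ NF e (A.hyps.erase c0) p) :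
    resH e f • z ∈ h.MFbar (A.hyps.erase c0) p := by
  refine Submodule.span_induction (p := fun f _ => resH e f • z ∈ h.MFbar (A.hyps.erase c0) p)
    ?_ ?_ ?_ ?_ hf
  · rintro _ ⟨t, ht, rfl⟩
    have hz' := NF_mono (subset_of_mem_pointFlats ht) hz
    rw [← h.MFbar_eq_of_mem_pointFlats hc0 hlf ht p] at hz'
    obtain ⟨x, hx, rfl⟩ := hz'
    exact ⟨_, smul_mem_logF (fun c hc hct => Finset.dvd_prod_of_mem (fun c => linP c)
      (Finset.mem_sdiff.2 ⟨hc, hct⟩)) hx, extBC_smul _ _⟩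
  · rw [map_zero, zero_smul]
    exact zero_mem _
  · intro x y _ _ hx hy
    rw [map_add, add_smul]
    exact add_mem hx hy
  · intro a x _ hx
    rw [smul_eq_mul, map_mul, mul_smul]
    exact Submodule.smul_mem _ _ hx

end LocalSurjectivity
section ZieglerRestriction

variable {c0 : Fin ℓ → K} {e : (Fin (ℓ - 1) → K) →ₗ[K] (Fin ℓ → K)} {p : ℕ}

theorem associated_linP_smul {m : ℕ} {t : K} (ht : t ≠ 0) (c : Fin m → K) :
    Associated (linP (t • c)) (linP c) := by
  rw [linP_smul]
  exact associated_unit_mul_left _ _ ((isUnit_iff_ne_zero.2 ht).map C)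

theorem exists_smul_congr {R M : Type} [CommRing R] [AddCommGroup M] [Module R M] {a b : R}
    (hab : Associated a b) {w : M} : (∃ y, w = a • y) ↔ ∃ y, w = b • y := by
  constructor
  · rintro ⟨y, rfl⟩
    obtain ⟨q, rfl⟩ := hab.symm.dvd
    exact ⟨q • y, mul_smul _ _ _⟩
  · rintro ⟨y, rfl⟩
    obtain ⟨q, rfl⟩ := hab.dvd
    exact ⟨q • y, mul_smul _ _ _⟩

theorem associated_parProd {A : Arrangement K ℓ} {c : Fin ℓ → K} {c' : Fin (ℓ - 1) → K} {t : K}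
    (ht : t ≠ 0) (hc : restrictForm e c = t • c') :
    Associated (parProd e (A.hyps.erase c0) c) (linP c' ^ zieglerMult A c0 e c') := by
  have hcl : parClass e (A.hyps.erase c0) c =
      A.hyps.filter fun c => c ≠ c0 ∧ ∃ t : K, t ≠ 0 ∧ restrictForm e c = t • c' := by
    ext d
    rw [mem_parClass, Finset.mem_erase, Finset.mem_filter, and_comm (a := d ≠ c0), and_assoc]
    refine and_congr_right fun _ => and_congr_right fun _ => ⟨?_, ?_⟩
    · rintro ⟨u, hu, h⟩
      exact ⟨u * t, mul_ne_zero hu ht, by rw [h, hc, smul_smul]⟩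
    · rintro ⟨u, hu, h⟩
      refine ⟨u * t⁻¹, mul_ne_zero hu (inv_ne_zero ht), ?_⟩
      rw [h, hc, smul_smul, mul_assoc, inv_mul_cancel₀ ht, mul_one]
  rw [parProd, hcl, zieglerMult, ← Finset.prod_const]
  refine Associated.prod _ _ _ fun d hd => ?_
  obtain ⟨-, -, u, hu, hd⟩ := Finset.mem_filter.1 hd
  rw [hd]
  exact associated_linP_smul hu c'

theorem Omega_zieglerMult {A : Arrangement K ℓ} {B : Arrangement K (ℓ - 1)}
    (hB : IsRestrictionOf B A c0 e) (p : ℕ) :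
    Omega B (zieglerMult A c0 e) p = NF e (A.hyps.erase c0) p := by
  have key : ∀ (c : Fin ℓ → K) (c' : Fin (ℓ - 1) → K) (t : K), t ≠ 0 → restrictForm e c = t • c' →
      ∀ x : ExteriorAlgebra (PS K (ℓ - 1)) (Fin (ℓ - 1) → PS K (ℓ - 1)),
      (∃ y, ExteriorAlgebra.ι _ (cvec (ℓ - 1) c') * x = linP c' ^ zieglerMult A c0 e c' • y) ↔
      ∃ y, ExteriorAlgebra.ι _ (cvec (ℓ - 1) (restrictForm e c)) * x =
        parProd e (A.hyps.erase c0) c • y := by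
    intro c c' t ht hc x
    rw [← exists_smul_congr (associated_parProd ht hc), hc, cvec_smul, map_smul, smul_mul_assoc]
    constructor
    · rintro ⟨y, hy⟩
      exact ⟨(C t : PS K (ℓ - 1)) • y, by rw [hy, smul_comm]⟩
    · rintro ⟨y, hy⟩
      refine ⟨(C t⁻¹ : PS K (ℓ - 1)) • y, ?_⟩
      rw [smul_comm, ← hy, smul_smul, ← C_mul, inv_mul_cancel₀ ht, C_1, one_smul]
  rw [Omega_eq_logF]
  ext x
  rw [mem_logF, mem_logF]
  refine and_congr_right fun _ => ⟨fun hx c hc => ?_, fun hx c' hc' => ?_⟩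
  · obtain ⟨hcc, hc⟩ := Finset.mem_erase.1 hc
    obtain ⟨c', hc', t, ht, h⟩ := hB.1 c hc hcc
    exact (key c c' t ht h x).1 (hx c' hc')
  · obtain ⟨c, hc, hcc, t, ht, h⟩ := hB.2 c' hc'
    exact (key c c' t ht h x).2 (hx c (Finset.mem_erase.2 ⟨hcc, hc⟩))

/-- A chosen member of the class of `c`. -/
def parRep (e : (Fin (ℓ - 1) → K) →ₗ[K] (Fin ℓ → K)) (s : Finset (Fin ℓ → K)) (c : Fin ℓ → K) :
    Fin ℓ → K := Classical.epsilon fun d => d ∈ parClass e s c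

theorem parRep_mem {s : Finset (Fin ℓ → K)} {c : Fin ℓ → K} (hc : c ∈ s) :
    parRep e s c ∈ parClass e s c :=
  Classical.epsilon_spec (p := fun d => d ∈ parClass e s c) ⟨c, mem_parClass.2 ⟨hc, Par.refl c⟩⟩

theorem exists_isRestrictionOf (h : HypSplit c0 e) {A : Arrangement K ℓ} (hc0 : c0 ∈ A.hyps) :
    ∃ B : Arrangement K (ℓ - 1), IsRestrictionOf B A c0 e := by
  set s := A.hyps.erase c0 with hs_def
  have hs : OffForms c0 s := OffForms.erase hc0
  have hrep : ∀ c ∈ s, parRep e s c ∈ s ∧ Par e (parRep e s c) c := fun c hc =>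
    mem_parClass.1 (parRep_mem hc)
  refine ⟨⟨s.image fun c => restrictForm e (parRep e s c), ?_, ?_⟩, ?_, ?_⟩
  · intro c' hc'
    obtain ⟨c, hc, rfl⟩ := Finset.mem_image.1 hc'
    exact hs.restrictForm_ne_zero h (hrep c hc).1
  · intro c' hc' d' hd' hne t ht
    obtain ⟨c, hc, rfl⟩ := Finset.mem_image.1 hc'
    obtain ⟨d, hd, rfl⟩ := Finset.mem_image.1 hd'
    have ht0 : t ≠ 0 := by
      rintro rfl
      exact hs.restrictForm_ne_zero h (hrep c hc).1 (by rw [ht, zero_smul])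
    have hp : Par e c d := ((hrep c hc).2.symm.trans ⟨t, ht0, ht⟩).trans (hrep d hd).2
    exact hne (by simp only [parRep, (parClass_eq_iff hc).2 hp])
  · intro c hc hcc
    have hc' : c ∈ s := Finset.mem_erase.2 ⟨hcc, hc⟩
    exact ⟨_, Finset.mem_image_of_mem _ hc', (hrep c hc').2.symm⟩
  · intro c' hc'
    obtain ⟨c, hc, rfl⟩ := Finset.mem_image.1 hc'
    obtain ⟨hcc, hc⟩ := Finset.mem_erase.1 (hrep c hc).1
    exact ⟨_, hc, hcc, 1, one_ne_zero, (one_smul _ _).symm⟩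

end ZieglerRestriction
section Bounds

variable {c0 : Fin ℓ → K} {e : (Fin (ℓ - 1) → K) →ₗ[K] (Fin ℓ → K)} {s : Finset (Fin ℓ → K)} {p : ℕ}

theorem pdLE_MF_of_le (hs : OffForms c0 s)
    (hp : ℓ ≤ p + 2) : pdLE (PS K ℓ) p (MF e s p) :=
  pdLE_logF (fun _ => pdLE_mono hp (pdLE_mvPolynomial K ℓ _)) hs.linP_ne_zero

theorem HypSplit.pdLE_NF_of_le (h : HypSplit c0 e) (hs : OffForms c0 s)
    (hp : ℓ - 1 ≤ p + 2) : pdLE (PS K (ℓ - 1)) p (NF e s p) :=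
  pdLE_logF (fun _ => pdLE_mono hp (pdLE_mvPolynomial K (ℓ - 1) _))
    fun c _ => parProd_ne_zero h hs c

/-- All modules of logarithmic forms are bounded if the restricted one-forms are. -/
theorem HypSplit.pdLE_MF (h : HypSplit c0 e) {A : Arrangement K ℓ}
    (hc0 : c0 ∈ A.hyps) (hlf : LocallyFreeAlong A (fun _ => 1) c0)
    (h1 : pdLE (PS K (ℓ - 1)) 1 (h.MFbar (A.hyps.erase c0) 1)) (p : ℕ) :
    pdLE (PS K ℓ) p (MF e (A.hyps.erase c0) p) := by
  have hs := OffForms.erase hc0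
  by_cases hp : ℓ ≤ p + 2
  · exact pdLE_MF_of_le hs hp
  obtain ⟨N, r, π, g, hπ, hgi, hg⟩ := h.exists_presentation hs h1
  obtain ⟨F, -, hF, hFr, -⟩ := h.exists_regular_sequence (A.hyps.erase c0)
  refine pdLE_logF_of_presentation hs.linP_ne_zero hs.isRelPrime (hs.constDual_cvec h ℓ) π g hπ
    hgi hg (pointFlats (A.hyps.erase c0) c0)
    (fun t ht => ⟨subset_of_mem_pointFlats ht, h.exists_basis_of_mem_pointFlats hc0 hlf ht⟩) hFr ?_ ?_
  · intro c hc
    obtain ⟨i, rfl⟩ := (List.mem_ofFn' _ _).1 hc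
    convert hF i
    unfold pointIdeal
    congr!
  · rw [List.length_ofFn]
    omega

theorem HypSplit.tame_of_pdLE (h : HypSplit c0 e) {A : Arrangement K ℓ}
    (hc0 : c0 ∈ A.hyps) (hlf : LocallyFreeAlong A (fun _ => 1) c0)
    (h1 : pdLE (PS K (ℓ - 1)) 1 (h.MFbar (A.hyps.erase c0) 1)) : Tame A := by
  rintro (_ | p) -
  · have hO : Omega A (fun _ => 1) 0 = logF A.hyps (cvec ℓ) linP 0 := by
      rw [Omega_eq_logF]
      simp only [pow_one]
    change pdLE (PS K ℓ) 0 (Omega A (fun _ => 1) 0)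
    rw [hO]
    exact pdLE_logF_zero (fun c hc => linP_ne_zero (A.ne_zero c hc))
      (fun c hc c' hc' hne => isRelPrime_linP (A.ne_zero c hc) (A.nonprop c' hc' c hc hne.symm))
      (fun c hc => constDual_cvec ℓ (A.ne_zero c hc)) 0
  · obtain ⟨E⟩ := nonempty_equiv_Omega h hc0 p
    exact pdLE_of_linearEquiv E (pdLE_prod (h.pdLE_MF hc0 hlf h1 (p + 1))
      (pdLE_mono p.le_succ (h.pdLE_MF hc0 hlf h1 p)))

theorem HypSplit.pdLE_NF (h : HypSplit c0 e) {A : Arrangement K ℓ}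
    (hc0 : c0 ∈ A.hyps) (hlf : LocallyFreeAlong A (fun _ => 1) c0)
    (h1 : pdLE (PS K (ℓ - 1)) 1 (h.MFbar (A.hyps.erase c0) 1)) (p : ℕ) :
    pdLE (PS K (ℓ - 1)) p (NF e (A.hyps.erase c0) p) := by
  have hs := OffForms.erase hc0
  by_cases hp : ℓ - 1 ≤ p + 2
  · exact h.pdLE_NF_of_le hs hp
  have hM := h.pdLE_MFbar hs (h.pdLE_MF hc0 hlf h1 p)
  obtain ⟨F, k, hF, -, hFk⟩ := h.exists_regular_sequence (A.hyps.erase c0)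
  rw [← eq_of_pdLE (h.MFbar_le hs) _ (isWeaklyRegular_X_pow (K := K) (ℓ - 1) k) ?_ ?_ ?_ hM]
  · exact hM
  · intro r hr z hz
    obtain ⟨i, rfl⟩ := (List.mem_ofFn' _ _).1 hr
    change (X i ^ k i : PS K (ℓ - 1)) • z ∈ _
    rw [← hFk]
    exact h.smul_mem_MFbar hc0 hlf (hF i) hz
  · intro z _ hz
    exact extAlg_smul_eq_zero (pow_ne_zero _ (X_ne_zero (⟨0, by omega⟩ : Fin (ℓ - 1))))
      (hz _ ((List.mem_ofFn' _ _).2 ⟨_, rfl⟩))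
  · rw [List.length_ofFn]
    omega

end Bounds
section Saturation

theorem pow_smul_mem_of_pow_smul_mem {R M : Type} [CommRing R] [AddCommGroup M] [Module R M]
    {L : Submodule R M} {a f : R} (h : ∀ d, a • d ∈ L → f • d ∈ L) (k : ℕ) (d : M)
    (hd : a ^ k • d ∈ L) : f ^ k • d ∈ L := by
  induction k generalizing d with
  | zero => simpa using hd
  | succ k ih =>
    rw [pow_succ, mul_smul]
    refine ih _ ?_
    rw [smul_comm]
    refine h _ ?_
    rwa [smul_smul, ← pow_succ']

/-- A criterion for a submodule to be saturated with respect to an element. -/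
theorem mem_of_smul_mem_of_forall {R M : Type} [CommRing R] [AddCommGroup M] [Module R M]
    [IsNoetherian R M] {L : Submodule R M} {a : R} {F : Set R}
    (h1 : ∀ f ∈ F, ∀ d, a • d ∈ L → f • d ∈ L)
    (h2 : ∀ d k, (∀ f ∈ F, f ^ k • d ∈ L) → ∃ l ∈ L, ∃ d', d = l + a • d') {d : M}
    (hd : a • d ∈ L) : d ∈ L := by
  let G : ℕ →o Submodule R M :=
    { toFun := fun k => L.comap (LinearMap.lsmul R M (a ^ k))
      monotone' := monotone_nat_of_le_succ fun k d hd => by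
        rw [Submodule.mem_comap, LinearMap.lsmul_apply] at hd ⊢
        rw [pow_succ', mul_smul]
        exact L.smul_mem a hd }
  have hG : ∀ k d, d ∈ G k ↔ a ^ k • d ∈ L := fun _ _ => Iff.rfl
  obtain ⟨k, hk⟩ := monotone_stabilizes_iff_noetherian.2 ‹IsNoetherian R M› G
  have hdk : d ∈ G k := by
    rw [hk (k + 1) k.le_succ, hG, pow_succ, mul_smul]
    exact L.smul_mem _ hd
  have hstep : ∀ d ∈ G k, ∀ j, ∃ l ∈ L, ∃ d' ∈ G k, d = l + a ^ j • d' := by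
    intro d hd j
    induction j with
    | zero => exact ⟨0, zero_mem _, d, hd, by simp⟩
    | succ j ih =>
      obtain ⟨l, hl, d', hd', rfl⟩ := ih
      obtain ⟨l', hl', d'', rfl⟩ := h2 d' k fun f hf =>
        pow_smul_mem_of_pow_smul_mem (h1 f hf) k d' ((hG k d').1 hd')
      refine ⟨l + a ^ j • l', add_mem hl (L.smul_mem _ hl'), d'', ?_, ?_⟩
      · rw [hk (k + 1) k.le_succ, hG]
        have := (hG k _).1 hd'
        rw [smul_add, smul_smul, ← pow_succ] at this
        exact (Submodule.add_mem_iff_right _ (L.smul_mem _ hl')).1 this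
      · rw [smul_add, smul_smul, ← pow_succ, add_assoc]
  obtain ⟨l, hl, d', hd', rfl⟩ := hstep d hdk k
  exact add_mem hl hd'

end Saturation

section LogMap

variable {R : Type} [CommRing R] {n : ℕ} {J : Type} {s : Finset J} {β : J → Fin n → R} {a : J → R}

/-- The map whose kernel consists of the vectors in `vecLog s β a` together with the quotients
witnessing the divisibilities. -/
def logMap (s : Finset J) (β : J → Fin n → R) (a : J → R) :
    ((Fin n → R) × (s × Fin n × Fin n → R)) →ₗ[R] (s × Fin n × Fin n → R) where
  toFun x k := β k.1 k.2.1 * x.1 k.2.2 - β k.1 k.2.2 * x.1 k.2.1 - a k.1 * x.2 k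
  map_add' x y := by
    funext k
    simp only [Prod.fst_add, Prod.snd_add, Pi.add_apply]
    ring
  map_smul' r x := by
    funext k
    simp only [Prod.smul_fst, Prod.smul_snd, Pi.smul_apply, smul_eq_mul, RingHom.id_apply]
    ring

theorem logMap_apply (x k) : logMap s β a x k =
    β k.1 k.2.1 * x.1 k.2.2 - β k.1 k.2.2 * x.1 k.2.1 - a k.1 * x.2 k := rfl

theorem mem_vecLog_iff_logMap {v : Fin n → R} : v ∈ vecLog s β a ↔ ∃ d, logMap s β a (v, d) = 0 := by
  rw [mem_vecLog]
  constructor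
  · intro h
    choose! d hd using h
    exact ⟨fun k => d k.1 k.2.1 k.2.2, funext fun k => by
      rw [logMap_apply, hd k.1 k.1.2, sub_self, Pi.zero_apply]⟩
  · rintro ⟨d, hd⟩ c hc i j
    exact ⟨d (⟨c, hc⟩, i, j), sub_eq_zero.1 (congrFun hd (⟨c, hc⟩, i, j))⟩

theorem logMap_zero_left (d : s × Fin n × Fin n → R) (k) :
    logMap s β a (0, d) k = - (a k.1 * d k) := by
  rw [logMap_apply]
  simp

/-- The kernel of `logMap` consists of the logarithmic vectors. -/
def kerLogMapEquiv [IsDomain R] (ha : ∀ c ∈ s, a c ≠ 0) :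
    LinearMap.ker (logMap s β a) ≃ₗ[R] vecLog s β a :=
  LinearEquiv.ofBijective
    (((LinearMap.fst R _ _).comp (LinearMap.ker (logMap s β a)).subtype).codRestrict _
      fun x => mem_vecLog_iff_logMap.2 ⟨x.1.2, x.2⟩) (by
    constructor
    · rintro ⟨⟨v, d⟩, hx⟩ ⟨⟨w, d'⟩, hy⟩ h
      obtain rfl : v = w := congrArg Subtype.val h
      refine Subtype.ext (Prod.ext rfl (funext fun k => ?_))
      have h1 := congrFun (LinearMap.mem_ker.1 hx) k
      have h2 := congrFun (LinearMap.mem_ker.1 hy) k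
      rw [logMap_apply] at h1 h2
      exact mul_left_cancel₀ (ha k.1 k.1.2) (sub_right_injective (h1.trans h2.symm))
    · rintro ⟨v, hv⟩
      obtain ⟨d, hd⟩ := mem_vecLog_iff_logMap.1 hv
      exact ⟨⟨(v, d), hd⟩, rfl⟩)

theorem pdLE_range_logMap [IsDomain R] (ha : ∀ c ∈ s, a c ≠ 0) (h : pdLE R 1 (vecLog s β a)) :
    pdLE R 2 (LinearMap.range (logMap s β a)) := by
  refine pdLE_of_pdLE_ker (logMap s β a).surjective_rangeRestrict ?_ (pdLE_of_projective 2)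
  rw [LinearMap.ker_rangeRestrict]
  exact pdLE_of_linearEquiv (kerLogMapEquiv ha).symm h

end LogMap
section Lifting

variable {c0 : Fin ℓ → K} {e : (Fin (ℓ - 1) → K) →ₗ[K] (Fin ℓ → K)} {s : Finset (Fin ℓ → K)}

/-- The product of the forms in `parClass e s c`. -/
def parLift (e : (Fin (ℓ - 1) → K) →ₗ[K] (Fin ℓ → K)) (s : Finset (Fin ℓ → K)) (c : Fin ℓ → K) :
    PS K ℓ := ∏ c' ∈ parClass e s c, linP c'

theorem resH_parLift (c : Fin ℓ → K) : resH e (parLift e s c) = parProd e s c := by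
  rw [parLift, map_prod]
  simp only [resH_linP]
  rfl

theorem vecLog_parLift (hs : OffForms c0 s) :
    vecLog s (fun c => cvec ℓ (restrictForm e c)) (parLift e s) =
      vecLog s (fun c => cvec ℓ (restrictForm e c)) linP := by
  ext v
  rw [mem_vecLog, mem_vecLog]
  refine ⟨fun h c hc i j => (Finset.dvd_prod_of_mem (fun c => linP c)
    (mem_parClass.2 ⟨hc, Par.refl c⟩)).trans (h c hc i j), fun h c hc i j => ?_⟩
  refine Finset.prod_dvd_of_isRelPrime (fun d hd d' hd' hne => hs.isRelPrime d
    (mem_parClass.1 hd).1 d' (mem_parClass.1 hd').1 hne) fun d hd => ?_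
  obtain ⟨hds, hd⟩ := mem_parClass.1 hd
  obtain ⟨t, -, ht⟩ := hd.symm
  have := (h d hds i j).mul_left (C t)
  simp only [ht, cvec_smul, Pi.smul_apply, smul_eq_mul]
  rwa [mul_assoc, mul_assoc, ← mul_sub]

theorem HypSplit.exists_piMap_eq (h : HypSplit c0 e) {ι : Type} (y : ι → PS K (ℓ - 1)) :
    ∃ x, piMap (resH e) ι x = y := by
  choose x hx using fun i => h.resH_surjective (y i)
  exact ⟨x, funext hx⟩

theorem HypSplit.exists_eq_smul_of_piMap_eq_zero (h : HypSplit c0 e) {ι : Type} {x : ι → PS K ℓ}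
    (hx : piMap (resH e) ι x = 0) : ∃ y, x = linP c0 • y := by
  choose y hy using fun i => h.exists_of_resH_eq_zero (congrFun hx i)
  exact ⟨y, funext hy⟩

theorem piMap_logMap (x) : piMap (resH e) (s × Fin (ℓ - 1) × Fin (ℓ - 1))
      (logMap s (fun c => cvec ℓ (restrictForm e c)) (parLift e s) x) =
    logMap s (fun c => cvec (ℓ - 1) (restrictForm e c)) (parProd e s)
      (piMap (resH e) _ x.1, piMap (resH e) _ x.2) := by
  funext k
  rw [logMap_apply, ← resH_parLift]
  refine (congrArg (resH e) (logMap_apply _ _)).trans ?_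
  rw [map_sub, map_sub, map_mul, map_mul, map_mul]
  simp only [cvec, resH_C]
  rfl

theorem HypSplit.parLift_dvd_cancel (h : HypSplit c0 e) (hs : OffForms c0 s) (c : Fin ℓ → K)
    {f : PS K ℓ} (hf : linP c0 ∣ parLift e s c * f) : linP c0 ∣ f := by
  refine (IsRelPrime.prod_left fun d hd => ?_).symm.dvd_of_dvd_mul_left hf
  exact hs.isRelPrime_self h.ne_zero d (mem_parClass.1 hd).1

theorem HypSplit.mem_NF_one_iff (h : HypSplit c0 e) (hs : OffForms c0 s) {z} :
    z ∈ NF e s 1 ↔ ∃ v ∈ vecLog s (fun c => cvec (ℓ - 1) (restrictForm e c)) (parProd e s),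
      ExteriorAlgebra.ι _ v = z := by
  constructor
  · intro hz
    obtain ⟨v, hv⟩ := (vecLogEquiv (hs.constDual_cvec h (ℓ - 1))).surjective ⟨z, hz⟩
    exact ⟨v.1, v.2, congrArg Subtype.val hv⟩
  · rintro ⟨v, hv, rfl⟩
    exact (vecLogEquiv (hs.constDual_cvec h (ℓ - 1)) ⟨v, hv⟩).2

theorem HypSplit.mem_MFbar_one_iff (h : HypSplit c0 e) (hs : OffForms c0 s) {z} :
    z ∈ h.MFbar s 1 ↔ ∃ v ∈ vecLog s (fun c => cvec ℓ (restrictForm e c)) linP,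
      ExteriorAlgebra.ι _ (piMap (resH e) (Fin (ℓ - 1)) v) = z := by
  rw [h.mem_MFbar]
  constructor
  · rintro ⟨x, hx, rfl⟩
    obtain ⟨v, hv⟩ := (vecLogEquiv (hs.constDual_cvec h ℓ)).surjective ⟨x, hx⟩
    exact ⟨v.1, v.2, (extBC_ι _).symm.trans (congrArg _ (congrArg Subtype.val hv))⟩
  · rintro ⟨v, hv, rfl⟩
    exact ⟨_, (vecLogEquiv (hs.constDual_cvec h ℓ) ⟨v, hv⟩).2, extBC_ι _⟩

theorem HypSplit.smul_mem_range_logMap (h : HypSplit c0 e) (hs : OffForms c0 s) {f : PS K ℓ}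
    (hf : ∀ z ∈ NF e s 1, resH e f • z ∈ h.MFbar s 1) {d}
    (hd : linP c0 • d ∈ LinearMap.range
      (logMap s (fun c => cvec ℓ (restrictForm e c)) (parLift e s))) :
    f • d ∈ LinearMap.range (logMap s (fun c => cvec ℓ (restrictForm e c)) (parLift e s)) := by
  obtain ⟨⟨v, d1⟩, hx⟩ := hd
  have hv : piMap (resH e) (Fin (ℓ - 1)) v ∈
      vecLog s (fun c => cvec (ℓ - 1) (restrictForm e c)) (parProd e s) := by
    refine mem_vecLog_iff_logMap.2 ⟨piMap (resH e) _ d1, ?_⟩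
    refine (piMap_logMap (v, d1)).symm.trans ?_
    rw [hx, piMap_smul, h.resH_self, zero_smul]
  obtain ⟨w, hw, hwz⟩ := (h.mem_MFbar_one_iff hs).1 (hf _ ((h.mem_NF_one_iff hs).2 ⟨_, hv, rfl⟩))
  rw [← map_smul, ← piMap_smul] at hwz
  have hwz := (ExteriorAlgebra.ι_inj _ _ _).1 hwz
  obtain ⟨u, hu⟩ := h.exists_eq_smul_of_piMap_eq_zero (x := f • v - w)
    (by rw [map_sub, hwz, sub_self])
  rw [← vecLog_parLift hs] at hw
  obtain ⟨d2, hw⟩ := mem_vecLog_iff_logMap.1 hw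
  set L := logMap s (fun c => cvec ℓ (restrictForm e c)) (parLift e s) with hL
  have hfd : L (0, f • d1 - d2) = linP c0 • (f • d - L (u, 0)) := by
    have key : ((0, f • d1 - d2) : (Fin (ℓ - 1) → PS K ℓ) × _) =
        f • (v, d1) - linP c0 • (u, 0) - (w, d2) := by
      refine Prod.ext ?_ ?_
      · change 0 = f • v - linP c0 • u - w
        rw [← hu]
        abel
      · change f • d1 - d2 = f • d1 - linP c0 • 0 - d2
        rw [smul_zero, sub_zero]
    rw [key, map_sub, map_sub, map_smul, map_smul, hx, hw, sub_zero, smul_sub, smul_comm]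
  have hdvd : ∀ k, ∃ t, (f • d1 - d2) k = linP c0 * t := fun k => by
    have := congrFun hfd k
    rw [hL, logMap_zero_left] at this
    refine h.parLift_dvd_cancel hs k.1 ((dvd_neg (α := PS K ℓ)).1 ⟨_, this⟩)
  choose d3 hd3 using hdvd
  refine ⟨(u, 0) + (0, d3), ?_⟩
  have hd3' : ((0, f • d1 - d2) : (Fin (ℓ - 1) → PS K ℓ) × _) = linP c0 • (0, d3) :=
    Prod.ext (smul_zero _).symm (funext hd3)
  rw [hd3', map_smul] at hfd
  rw [map_add, smul_right_injective _ (linP_ne_zero h.ne_zero) hfd, add_sub_cancel]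

end Lifting
section Restriction

variable {c0 : Fin ℓ → K} {e : (Fin (ℓ - 1) → K) →ₗ[K] (Fin ℓ → K)} {s : Finset (Fin ℓ → K)}

theorem HypSplit.mem_range_logMap_of_X_pow (h : HypSplit c0 e) (hs : OffForms c0 s) (hl : 5 ≤ ℓ)
    (hN : pdLE (PS K (ℓ - 1)) 1 (NF e s 1)) (k : Fin (ℓ - 1) → ℕ) {z}
    (hz : ∀ i, (X i ^ k i : PS K (ℓ - 1)) • z ∈ LinearMap.range
      (logMap s (fun c => cvec (ℓ - 1) (restrictForm e c)) (parProd e s))) :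
    z ∈ LinearMap.range
      (logMap s (fun c => cvec (ℓ - 1) (restrictForm e c)) (parProd e s)) := by
  set I := LinearMap.range
    (logMap s (fun c => cvec (ℓ - 1) (restrictForm e c)) (parProd e s)) with hI
  let J := ⨅ i, I.comap (LinearMap.lsmul (PS K (ℓ - 1)) _ (X i ^ k i))
  have hJ : ∀ y, y ∈ J ↔ ∀ i, (X i ^ k i : PS K (ℓ - 1)) • y ∈ I := fun y => by
    simp only [J, Submodule.mem_iInf, Submodule.mem_comap, LinearMap.lsmul_apply]
  have hpd : pdLE (PS K (ℓ - 1)) 2 I := pdLE_range_logMap (fun c _ => parProd_ne_zero h hs c)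
    (pdLE_of_linearEquiv (vecLogEquiv (hs.constDual_cvec h (ℓ - 1))).symm hN)
  rw [eq_of_pdLE (J := J) (fun y hy => (hJ y).2 fun i => I.smul_mem _ hy) _
    (isWeaklyRegular_X_pow (K := K) (ℓ - 1) k) ?_ ?_ ?_ hpd]
  · exact (hJ z).2 hz
  · intro r hr y hy
    obtain ⟨i, rfl⟩ := (List.mem_ofFn' _ _).1 hr
    exact (hJ y).1 hy i
  · intro y _ hy
    have := hy _ ((List.mem_ofFn' _ _).2 ⟨(⟨0, by omega⟩ : Fin (ℓ - 1)), rfl⟩)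
    exact (smul_eq_zero.1 this).resolve_left (pow_ne_zero _ (X_ne_zero _))
  · rw [List.length_ofFn]
    omega

theorem HypSplit.exists_logMap_add_smul (h : HypSplit c0 e) {d}
    (hd : piMap (resH e) _ d ∈ LinearMap.range
      (logMap s (fun c => cvec (ℓ - 1) (restrictForm e c)) (parProd e s))) :
    ∃ l ∈ LinearMap.range (logMap s (fun c => cvec ℓ (restrictForm e c)) (parLift e s)),
      ∃ d', d = l + linP c0 • d' := by
  obtain ⟨⟨v, y⟩, hvy⟩ := hd
  obtain ⟨v, rfl⟩ := h.exists_piMap_eq v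
  obtain ⟨y, rfl⟩ := h.exists_piMap_eq y
  obtain ⟨d', hd'⟩ := h.exists_eq_smul_of_piMap_eq_zero
    (x := d - logMap s (fun c => cvec ℓ (restrictForm e c)) (parLift e s) (v, y))
    (by rw [map_sub, piMap_logMap, hvy, sub_self])
  exact ⟨_, ⟨(v, y), rfl⟩, d', by rw [← hd', add_sub_cancel]⟩

theorem HypSplit.mem_range_logMap_of_smul (h : HypSplit c0 e) (hs : OffForms c0 s) (hl : 5 ≤ ℓ)
    (hN : pdLE (PS K (ℓ - 1)) 1 (NF e s 1)) {F : Fin (ℓ - 1) → PS K ℓ} {k : Fin (ℓ - 1) → ℕ}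
    (hF : ∀ i, ∀ z ∈ NF e s 1, resH e (F i) • z ∈ h.MFbar s 1)
    (hFk : ∀ i, resH e (F i) = X i ^ k i) {d}
    (hd : linP c0 • d ∈ LinearMap.range
      (logMap s (fun c => cvec ℓ (restrictForm e c)) (parLift e s))) :
    d ∈ LinearMap.range (logMap s (fun c => cvec ℓ (restrictForm e c)) (parLift e s)) := by
  refine mem_of_smul_mem_of_forall (F := Set.range F) ?_ ?_ hd
  · rintro _ ⟨i, rfl⟩ d hd
    exact h.smul_mem_range_logMap hs (hF i) hd
  · intro d n hn
    refine h.exists_logMap_add_smul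
      (h.mem_range_logMap_of_X_pow hs hl hN (fun i => k i * n) fun i => ?_)
    obtain ⟨x, hx⟩ := hn _ ⟨i, rfl⟩
    rw [pow_mul, ← hFk, ← map_pow, ← piMap_smul, ← hx, piMap_logMap]
    exact ⟨_, rfl⟩

/-- If the multirestriction has projective dimension at most one in degree one, then every
logarithmic one-form on the hyperplane lifts. -/
theorem HypSplit.MFbar_one_eq (h : HypSplit c0 e) {A : Arrangement K ℓ} (hl : 5 ≤ ℓ)
    (hc0 : c0 ∈ A.hyps) (hlf : LocallyFreeAlong A (fun _ => 1) c0)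
    (hN : pdLE (PS K (ℓ - 1)) 1 (NF e (A.hyps.erase c0) 1)) :
    h.MFbar (A.hyps.erase c0) 1 = NF e (A.hyps.erase c0) 1 := by
  have hs := OffForms.erase hc0
  refine le_antisymm (h.MFbar_le hs) fun z hz => ?_
  obtain ⟨F, k, hF, -, hFk⟩ := h.exists_regular_sequence (A.hyps.erase c0)
  obtain ⟨v, hv, rfl⟩ := (h.mem_NF_one_iff hs).1 hz
  obtain ⟨y, hvy⟩ := mem_vecLog_iff_logMap.1 hv
  obtain ⟨v, rfl⟩ := h.exists_piMap_eq v
  obtain ⟨y, rfl⟩ := h.exists_piMap_eq y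
  obtain ⟨d, hd⟩ := h.exists_eq_smul_of_piMap_eq_zero ((piMap_logMap (v, y)).trans hvy)
  obtain ⟨⟨u, d1⟩, hu⟩ := h.mem_range_logMap_of_smul hs hl hN
    (fun i z hz => h.smul_mem_MFbar hc0 hlf (hF i) hz) hFk ⟨_, hd⟩
  refine (h.mem_MFbar_one_iff hs).2 ⟨v - linP c0 • u, ?_, ?_⟩
  · rw [← vecLog_parLift hs]
    refine mem_vecLog_iff_logMap.2 ⟨y - linP c0 • d1, ?_⟩
    refine (map_sub _ (v, y) (linP c0 • (u, d1))).trans ?_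
    rw [map_smul, hu, hd, sub_self]
  · rw [map_sub, piMap_smul, h.resH_self, zero_smul, sub_zero]

end Restriction
/-- **Generalized Yoshinaga criterion.**  For `ℓ ≥ 5` and `A` locally free along `H ∈ A`,
the following are equivalent: (1) `A` is tame; (2) `pd_S Ω^1(A) ≤ 1`; (3) the Ziegler
restriction `(A^H, m^H)` is tame; (4) `pd_{S̄} Ω^1(A^H, m^H) ≤ 1`. -/
theorem generalized_yoshinaga_criterion
    {K : Type} [Field K] {ℓ : ℕ} (hl : 5 ≤ ℓ)
    (A : Arrangement K ℓ) (hess : Essential A)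
    (c0 : Fin ℓ → K) (hc0 : c0 ∈ A.hyps)
    (hlf : LocallyFreeAlong A (fun _ => 1) c0) :
    (Tame A ↔ pdLE (PS K ℓ) 1 (Omega A (fun _ => 1) 1)) ∧
    (pdLE (PS K ℓ) 1 (Omega A (fun _ => 1) 1) ↔
      (∃ (e : (Fin (ℓ - 1) → K) →ₗ[K] (Fin ℓ → K)) (B : Arrangement K (ℓ - 1)),
        IsHypEmbedding c0 e ∧ IsRestrictionOf B A c0 e ∧
          TameM B (zieglerMult A c0 e))) ∧
    ((∃ (e : (Fin (ℓ - 1) → K) →ₗ[K] (Fin ℓ → K)) (B : Arrangement K (ℓ - 1)),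
        IsHypEmbedding c0 e ∧ IsRestrictionOf B A c0 e ∧
          TameM B (zieglerMult A c0 e)) ↔
      (∃ (e : (Fin (ℓ - 1) → K) →ₗ[K] (Fin ℓ → K)) (B : Arrangement K (ℓ - 1)),
        IsHypEmbedding c0 e ∧ IsRestrictionOf B A c0 e ∧
          pdLE (PS K (ℓ - 1)) 1 (Omega B (zieglerMult A c0 e) 1))) := by
  have key : ∀ e, ∀ h : HypSplit c0 e,
      pdLE (PS K (ℓ - 1)) 1 (h.MFbar (A.hyps.erase c0) 1) ↔
        pdLE (PS K ℓ) 1 (Omega A (fun _ => 1) 1) := fun _ h =>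
    ⟨fun h1 => h.tame_of_pdLE hc0 hlf h1 1 (by omega), fun h1 =>
      h.pdLE_MFbar (OffForms.erase hc0) (pdLE_MF_one_of_Omega h hc0 h1)⟩
  have h12 : Tame A ↔ pdLE (PS K ℓ) 1 (Omega A (fun _ => 1) 1) := by
    refine ⟨fun hT => hT 1 (by omega), fun h1 => ?_⟩
    obtain ⟨e, he⟩ := exists_hypEmbedding (A.ne_zero c0 hc0)
    obtain ⟨h⟩ := exists_hypSplit (A.ne_zero c0 hc0) he
    exact h.tame_of_pdLE hc0 hlf ((key e h).2 h1)
  have h23 : pdLE (PS K ℓ) 1 (Omega A (fun _ => 1) 1) →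
      ∃ (e : (Fin (ℓ - 1) → K) →ₗ[K] (Fin ℓ → K)) (B : Arrangement K (ℓ - 1)),
        IsHypEmbedding c0 e ∧ IsRestrictionOf B A c0 e ∧ TameM B (zieglerMult A c0 e) := by
    intro h1
    obtain ⟨e, he⟩ := exists_hypEmbedding (A.ne_zero c0 hc0)
    obtain ⟨h⟩ := exists_hypSplit (A.ne_zero c0 hc0) he
    obtain ⟨B, hB⟩ := exists_isRestrictionOf h hc0
    refine ⟨e, B, he, hB, fun p _ => ?_⟩
    rw [Omega_zieglerMult hB]
    exact h.pdLE_NF hc0 hlf ((key e h).2 h1) p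
  have h34 : (∃ (e : (Fin (ℓ - 1) → K) →ₗ[K] (Fin ℓ → K)) (B : Arrangement K (ℓ - 1)),
        IsHypEmbedding c0 e ∧ IsRestrictionOf B A c0 e ∧ TameM B (zieglerMult A c0 e)) →
      ∃ (e : (Fin (ℓ - 1) → K) →ₗ[K] (Fin ℓ → K)) (B : Arrangement K (ℓ - 1)),
        IsHypEmbedding c0 e ∧ IsRestrictionOf B A c0 e ∧
          pdLE (PS K (ℓ - 1)) 1 (Omega B (zieglerMult A c0 e) 1) :=
    fun ⟨e, B, he, hB, hT⟩ => ⟨e, B, he, hB, hT 1 (by omega)⟩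
  have h42 : (∃ (e : (Fin (ℓ - 1) → K) →ₗ[K] (Fin ℓ → K)) (B : Arrangement K (ℓ - 1)),
        IsHypEmbedding c0 e ∧ IsRestrictionOf B A c0 e ∧
          pdLE (PS K (ℓ - 1)) 1 (Omega B (zieglerMult A c0 e) 1)) →
      pdLE (PS K ℓ) 1 (Omega A (fun _ => 1) 1) := by
    rintro ⟨e, B, he, hB, h4⟩
    obtain ⟨h⟩ := exists_hypSplit (A.ne_zero c0 hc0) he
    rw [Omega_zieglerMult hB] at h4
    refine (key e h).1 ?_
    rwa [h.MFbar_one_eq hl hc0 hlf h4]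
  exact ⟨h12, ⟨h23, fun h3 => h42 (h34 h3)⟩, ⟨h34, fun h4 => h23 (h42 h4)⟩⟩
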